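/- arXiv:1811.12226 — 5 statements merged into one kernel-verified Lean document; each statement's English description precedes it below -/
import Mathlib

section
/- The abelianization of the group E₂(ℒ), where ℒ is the ring of Lipschitz quaternions, is isomorphic to the direct product of 4 copies of the cyclic group of order 2. -/
noncomputable section

/-- The elementary unit `E(x)` over a ring `R`. -/
def Em (R : Type*) [Ring R] (x : R) : (Matrix (Fin 2) (Fin 2) R)ˣ where
  val := !![x, 1; -1, 0]
  inv := !![0, -1; 1, x]
  val_inv := by
    ext i j
    fin_cases i <;> fin_cases j <;>
      simp [Matrix.mul_apply, Fin.sum_univ_two, Matrix.one_apply]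
  inv_val := by
    ext i j
    fin_cases i <;> fin_cases j <;>
      simp [Matrix.mul_apply, Fin.sum_univ_two, Matrix.one_apply]

/-- The group `E₂(R)` generated by the elementary matrices `E(x)`, `x ∈ R`. -/
def E2 (R : Type*) [Ring R] : Subgroup (Matrix (Fin 2) (Fin 2) R)ˣ :=
  Subgroup.closure (Set.range (Em R))

section QuaternionMod

variable {R : Type*} [CommRing R]

/-- The quaternion `a + bi + cj + dk`. -/
def quat (a b c d : R) : Quaternion R := ⟨a, b, c, d⟩

@[simp] theorem quat_re (a b c d : R) : (quat a b c d).re = a := rfl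
@[simp] theorem quat_imI (a b c d : R) : (quat a b c d).imI = b := rfl
@[simp] theorem quat_imJ (a b c d : R) : (quat a b c d).imJ = c := rfl
@[simp] theorem quat_imK (a b c d : R) : (quat a b c d).imK = d := rfl

theorem two_mul_comm_of_four (h4 : (4 : R) = 0) (x y : Quaternion R) :
    2 * (x * y) = 2 * (y * x) := by
  rw [two_mul, two_mul]
  ext <;> simp <;> grind

theorem exists_commutator_eq_two_mul (x y : Quaternion R) : ∃ c, x * y - y * x = 2 * c := by
  refine ⟨quat 0 (x.imJ * y.imK - x.imK * y.imJ) (x.imK * y.imI - x.imI * y.imK)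
    (x.imI * y.imJ - x.imJ * y.imI), ?_⟩
  rw [two_mul]
  ext <;> simp <;> ring

theorem two_mul_add_sq (hs : ∀ n : R, 2 * (n * n) = 2 * n) (h4 : (4 : R) = 0) (z : Quaternion R) :
    2 * (z + z * z) = 2 * quat (z.imI + z.imJ + z.imK) z.imI z.imJ z.imK := by
  have h1 := hs z.re
  have h2 := hs z.imI
  have h3 := hs z.imJ
  have h5 := hs z.imK
  rw [two_mul, two_mul]
  ext <;> simp <;> grind

theorem quat_one_mul_commutator (hs : ∀ n : R, 2 * (n * n) = 2 * n) (h4 : (4 : R) = 0)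
    (x y : Quaternion R) :
    quat 1 1 1 1 * (x * y - y * x) = 2 * ((x + x * x) * (y + y * y)) := by
  rw [← mul_assoc, two_mul_add_sq hs h4, mul_assoc, two_mul_comm_of_four h4, ← mul_assoc,
    two_mul_add_sq hs h4, mul_assoc, two_mul]
  ext <;> simp <;> grind

theorem two_mul_sq (h4 : (4 : R) = 0) (x : Quaternion R) :
    2 * (x * x) = ((2 * Quaternion.normSq x : R) : Quaternion R) := by
  have hn := Quaternion.normSq_def' x
  generalize Quaternion.normSq x = n at *
  rw [two_mul, two_mul]
  ext <;> simp <;> grind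

theorem two_mul_quat_one_mul (hs : ∀ n : R, 2 * (n * n) = 2 * n) (h4 : (4 : R) = 0)
    (x : Quaternion R) : 2 * (quat 1 1 1 1 * x) = 2 * (x * x) * quat 1 1 1 1 := by
  have h1 := hs x.re
  have h2 := hs x.imI
  have h3 := hs x.imJ
  have h5 := hs x.imK
  rw [two_mul_sq h4]
  have hn := Quaternion.normSq_def' x
  generalize Quaternion.normSq x = n at *
  rw [two_mul, two_mul]
  ext <;> simp <;> grind

end QuaternionMod

theorem two_mul_sq_eq_two_or (x : Quaternion (ZMod 4)) :
    (IsUnit x ∧ 2 * (x * x) = 2) ∨ 2 * (x * x) = 0 := by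
  have hN : ∀ n : ZMod 4, (n * n = 1 ∧ 2 * n = 2) ∨ 2 * n = 0 := by decide
  rw [two_mul_sq rfl]
  rcases hN (Quaternion.normSq x) with ⟨h1, h2⟩ | h2
  · left
    rw [h2]
    refine ⟨isUnit_iff_exists.2 ⟨star x * (Quaternion.normSq x : ZMod 4), ?_, ?_⟩, rfl⟩
    · rw [← mul_assoc, Quaternion.self_mul_star, ← Quaternion.coe_mul, h1]; rfl
    · rw [← Quaternion.coe_commutes, mul_assoc, Quaternion.star_mul_self, ← Quaternion.coe_mul, h1]
      rfl
  · right
    rw [h2]; rfl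

theorem quaternion_zmod_two_mul_comm (x y : Quaternion (ZMod 2)) : x * y = y * x := by
  have h2 : ∀ a b : ZMod 2, a - b = a + b := by decide
  ext <;> simp [h2] <;> ring

/-- The quaternions over `ZMod 2` form a commutative ring. -/
instance quaternionZModTwoCommRing : CommRing (Quaternion (ZMod 2)) :=
  { (inferInstance : Ring (Quaternion (ZMod 2))) with mul_comm := quaternion_zmod_two_mul_comm }

/-- The ring homomorphism on quaternions induced by a homomorphism of coefficient rings. -/
def quatMap {R S : Type*} [CommRing R] [CommRing S] (f : R →+* S) :
    Quaternion R →+* Quaternion S where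
  toFun x := quat (f x.re) (f x.imI) (f x.imJ) (f x.imK)
  map_one' := by ext <;> simp [Quaternion.re_one, Quaternion.imI_one, Quaternion.imJ_one,
    Quaternion.imK_one]
  map_mul' x y := by ext <;> simp
  map_zero' := by ext <;> simp [Quaternion.re_zero, Quaternion.imI_zero, Quaternion.imJ_zero,
    Quaternion.imK_zero]
  map_add' x y := by ext <;> simp

/-- Reduction of quaternions from `ZMod 4` to `ZMod 2`. -/
def redTwo : Quaternion (ZMod 4) →+* Quaternion (ZMod 2) :=
  quatMap (ZMod.castHom (by decide : 2 ∣ 4) (ZMod 2))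

theorem quaternion_zmod_two_two_eq_zero : (2 : Quaternion (ZMod 2)) = 0 := rfl

theorem redTwo_eq_redTwo_iff (x y : Quaternion (ZMod 4)) :
    redTwo x = redTwo y ↔ 2 * x = 2 * y := by
  have h : ∀ a b : ZMod 4, (ZMod.castHom (by decide : 2 ∣ 4) (ZMod 2) a =
      ZMod.castHom (by decide : 2 ∣ 4) (ZMod 2) b) ↔ a + a = b + b := by decide
  rw [two_mul, two_mul, Quaternion.ext_iff, Quaternion.ext_iff]
  exact and_congr (h _ _) (and_congr (h _ _) (and_congr (h _ _) (h _ _)))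

theorem exists_commutator_eq (x y : Quaternion (ZMod 4)) :
    ∃ c, x * y = y * x + 2 * c ∧ redTwo (quat 1 1 1 1) * redTwo c =
      (redTwo x + redTwo x ^ 2) * (redTwo y + redTwo y ^ 2) := by
  obtain ⟨c, hc⟩ := exists_commutator_eq_two_mul x y
  refine ⟨c, by rw [← hc]; abel, ?_⟩
  have hs : ∀ n : ZMod 4, 2 * (n * n) = 2 * n := by decide
  have h := quat_one_mul_commutator hs rfl x y
  rw [← map_mul, ← map_pow, ← map_pow, ← map_add, ← map_add, ← map_mul, redTwo_eq_redTwo_iff,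
    pow_two, pow_two, ← h, hc, two_mul, two_mul, mul_add]

theorem redTwo_quat_one_mul {x : Quaternion (ZMod 4)} (hx : redTwo x ^ 2 = 1) :
    redTwo (quat 1 1 1 1) * redTwo x = redTwo (quat 1 1 1 1) := by
  have hs : ∀ n : ZMod 4, 2 * (n * n) = 2 * n := by decide
  have h := two_mul_quat_one_mul hs rfl x
  rw [← map_pow, ← map_one redTwo, redTwo_eq_redTwo_iff, mul_one, pow_two] at hx
  rw [← map_mul, redTwo_eq_redTwo_iff, h, hx]

theorem redTwo_sq_eq_one_or (x : Quaternion (ZMod 4)) :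
    (IsUnit x ∧ redTwo x ^ 2 = 1) ∨ redTwo x ^ 2 = 0 := by
  rw [← map_pow, ← map_one redTwo, ← map_zero redTwo, redTwo_eq_redTwo_iff, redTwo_eq_redTwo_iff,
    mul_one, mul_zero, pow_two]
  exact two_mul_sq_eq_two_or x

theorem exists_inverse_of_redTwo_sq {x : Quaternion (ZMod 4)} (hx : redTwo x ^ 2 = 1) :
    ∃ y, x * y = 1 ∧ y * x = 1 ∧ redTwo y = redTwo x := by
  rcases redTwo_sq_eq_one_or x with ⟨h, -⟩ | h
  · obtain ⟨y, h1, h2⟩ := isUnit_iff_exists.1 h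
    refine ⟨y, h1, h2, ?_⟩
    have h3 : redTwo x * redTwo y = 1 := by rw [← map_mul, h1, map_one]
    linear_combination (-redTwo y) * hx + redTwo x * h3
  · rw [h] at hx
    exact absurd hx zero_ne_one

/-- The bookkeeping predicate: `M` lies in one of the two Bruhat cells of `GL₂` of the local ring
of quaternions mod `4`, and `v` is the value on it of the character `E(x) ↦ x + 1`. -/
def CellValue (M : Matrix (Fin 2) (Fin 2) (Quaternion (ZMod 4))) (v : Quaternion (ZMod 2)) : Prop :=
  ∃ p r y z t, redTwo p ^ 2 = 1 ∧ p * r = 1 + 2 * t ∧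
    ((M = !![p, p * z; y * p, y * p * z + r] ∧
      v = redTwo y + redTwo z + redTwo p + 1 + redTwo (quat 1 1 1 1) * redTwo t) ∨
    (M = !![y * p, y * p * z + r; -p, -(p * z)] ∧
      v = redTwo y + redTwo z + redTwo p + redTwo (quat 1 1 1 1) * redTwo t))

theorem cellValue_one : CellValue 1 0 := by
  refine ⟨1, 1, 0, 0, 0, by simp, by simp, Or.inl ⟨?_, ?_⟩⟩
  · refine Matrix.ext fun i j => ?_
    fin_cases i <;> fin_cases j <;> simp
  · simp only [map_zero, map_one]
    linear_combination -quaternion_zmod_two_two_eq_zero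

theorem CellValue.eq_zero {v : Quaternion (ZMod 2)} (h : CellValue 1 v) : v = 0 := by
  obtain ⟨p, r, y, z, t, hp, hpr, ⟨hM, hv⟩ | ⟨hM, hv⟩⟩ := h
  · have h00 := congrFun₂ hM 0 0
    have h01 := congrFun₂ hM 0 1
    have h10 := congrFun₂ hM 1 0
    have h11 := congrFun₂ hM 1 1
    simp at h00 h01 h10 h11
    subst h00
    simp at h01 h10
    subst h01 h10
    simp at h11
    subst h11
    have ht : redTwo t = redTwo 0 := by
      rw [redTwo_eq_redTwo_iff]; simpa using hpr
    rw [hv, ht]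
    simp only [map_zero, map_one]
    linear_combination quaternion_zmod_two_two_eq_zero
  · have h10 := congrFun₂ hM 1 0
    simp at h10
    subst h10
    simp at hp

theorem cellValue_lower_identity {B : Type*} [CommRing B] (h2 : (2 : B) = 0)
    {X P Q Z T C E σ : B} (hp : P ^ 2 = 1) (hq : Q ^ 2 = 0)
    (hσe : σ * E = (Q + Q ^ 2) * (X + X ^ 2))
    (hσc : σ * C = (P + P ^ 2) * ((1 - Q * X) + (1 - Q * X) ^ 2)) :
    X + 1 + (Q + Z + P + σ * T) = (1 - Q * X) * Q + (Z - P * (1 - X * Q) * X * P) +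
      -((1 - X * Q) * P) + 1 +
      σ * (E * (1 - Q * X) + T + E * (1 - Q * X) * (2 * T) + (1 - X * Q) * C * P) := by
  have s1 : σ * E = Q * X + Q * X ^ 2 := by linear_combination hσe + (X + X ^ 2) * hq
  have s2 : σ * C = (P + 1) * (Q * X) := by
    linear_combination hσc + (P + P ^ 2) * X ^ 2 * hq + (P + P ^ 2) * (1 - 2 * (Q * X)) * h2 +
      Q * X * hp
  linear_combination -(1 - Q * X) * (1 + 2 * T) * s1 - (1 - X * Q) * P * s2 +
    (X - X * Q - X ^ 2 * Q + X ^ 2 * Q ^ 2) * hp + (X + X ^ 2 * P + X ^ 3) * hq +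
    (X - X * Q - X ^ 2 * Q + X ^ 2 * Q ^ 2 - X * Q * P - X * Q * T - X ^ 2 * Q * T +
      X ^ 2 * Q ^ 2 * T + X ^ 3 * Q ^ 2 * T + P) * h2

theorem CellValue.mul_left {M : Matrix (Fin 2) (Fin 2) (Quaternion (ZMod 4))}
    {v : Quaternion (ZMod 2)} (h : CellValue M v) (x : Quaternion (ZMod 4)) :
    CellValue (!![x, 1; -1, 0] * M) (redTwo x + 1 + v) := by
  have h2 := quaternion_zmod_two_two_eq_zero
  obtain ⟨p, r, q, z, t, hp, hpr, ⟨rfl, rfl⟩ | ⟨rfl, rfl⟩⟩ := h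
  · refine ⟨p, r, x + q, z, t, hp, hpr, Or.inr ⟨?_, ?_⟩⟩
    · refine Matrix.ext fun i j => ?_
      fin_cases i <;> fin_cases j <;> simp [Matrix.mul_apply, Fin.sum_univ_two] <;> noncomm_ring
    · rw [map_add]
      linear_combination h2
  obtain ⟨p', hpp', hp'p, hp'⟩ := exists_inverse_of_redTwo_sq hp
  have hPR : redTwo p * redTwo r = 1 := by
    rw [← map_mul, hpr, map_add, map_one, map_mul, map_ofNat, h2, zero_mul, add_zero]
  have hR : redTwo r = redTwo p := by
    linear_combination (-redTwo r) * hp + redTwo p * hPR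
  have hσ : ∀ {w}, redTwo w ^ 2 = 1 → redTwo (quat 1 1 1 1) * redTwo w = redTwo (quat 1 1 1 1) :=
    fun hw => redTwo_quat_one_mul hw
  rcases redTwo_sq_eq_one_or q with ⟨-, hq⟩ | hq
  · obtain ⟨q', hqq', hq'q, hq'⟩ := exists_inverse_of_redTwo_sq hq
    obtain ⟨c, hc, hσc⟩ := exists_commutator_eq q p
    have key : q * p * (p' * q' * r) = r := by
      rw [show q * p * (p' * q' * r) = q * (p * p') * q' * r by noncomm_ring, hpp', mul_one, hqq',
        one_mul]
    refine ⟨q * p, q' * r, x - q', z + p' * q' * r, t + c * q' * r, ?_, ?_, Or.inr ⟨?_, ?_⟩⟩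
    · rw [map_mul, mul_pow, hq, hp, one_mul]
    · rw [hc, show (p * q + 2 * c) * (q' * r) = p * (q * q') * r + 2 * (c * q' * r) by noncomm_ring,
        hqq', mul_one, hpr, mul_add]
      abel
    · have h00 : (x - q') * (q * p) = x * (q * p) - p := by
        rw [sub_mul, ← mul_assoc q', hq'q, one_mul]
      have h01 : (x - q') * (q * p) * (z + p' * q' * r) + q' * r = x * (q * p * z + r) - p * z := by
        rw [mul_add, mul_assoc _ (q * p) (p' * q' * r), key, h00]
        noncomm_ring
      have h11 : q * p * (z + p' * q' * r) = q * p * z + r := by rw [mul_add, key]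
      rw [h01, h00, h11]
      refine Matrix.ext fun i j => ?_
      fin_cases i <;> fin_cases j <;> simp [Matrix.mul_apply, Fin.sum_univ_two, sub_eq_add_neg]
    · have hσq := hσ hq
      have hσp := hσ hp
      simp only [map_add, map_sub, map_mul, hp', hq', hR]
      generalize redTwo (quat 1 1 1 1) = σ at *
      generalize redTwo x = X at *
      generalize redTwo p = P at *
      generalize redTwo q = Q at *
      generalize redTwo z = Z at *
      generalize redTwo t = T at *
      generalize redTwo c = C at *
      clear hR hPR hσ key hc
      grind
  · obtain ⟨e, he, hσe⟩ := exists_commutator_eq q x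
    have hu : redTwo (1 - q * x) ^ 2 = 1 := by
      rw [map_sub, map_mul, map_one]
      linear_combination redTwo x ^ 2 * hq - redTwo q * redTwo x * h2
    have hu' : redTwo (1 - x * q) ^ 2 = 1 := by
      rw [map_sub, map_mul, map_one]
      linear_combination redTwo x ^ 2 * hq - redTwo q * redTwo x * h2
    obtain ⟨v, huv, hvu, hv⟩ := exists_inverse_of_redTwo_sq hu
    obtain ⟨w, huw, hwu, hw⟩ := exists_inverse_of_redTwo_sq hu'
    obtain ⟨c, hc, hσc⟩ := exists_commutator_eq p v
    have hqu : q * (1 - x * q) = (1 - q * x) * q := by noncomm_ring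
    have hvq : v * q * (1 - x * q) = q := by rw [mul_assoc, hqu, ← mul_assoc, hvu, one_mul]
    have hqw : q * w = v * q := by
      rw [← mul_one (v * q), ← huw, ← mul_assoc, hvq]
    have hqwx : q * w * x = v - 1 := by
      rw [hqw, ← hvu]
      noncomm_ring
    have key : (1 - x * q) * p * (p' * w * x * r) = x * r := by
      rw [show (1 - x * q) * p * (p' * w * x * r) = (1 - x * q) * (p * p') * w * x * r by
        noncomm_ring, hpp', mul_one, huw, one_mul]
    refine ⟨-((1 - x * q) * p), -(v * r), v * q, z - p' * w * x * r,
      e * v + t + e * v * (2 * t) + (1 - x * q) * c * r, ?_, ?_, Or.inl ⟨?_, ?_⟩⟩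
    · rw [map_neg, neg_pow_two, map_mul, mul_pow, hu', hp, one_mul]
    · have huv' : (1 - x * q) * v = 1 + 2 * (e * v) := by
        have h : (1 - x * q) * v = (1 - q * x) * v + 2 * (e * v) := by
          rw [he]
          noncomm_ring
        rw [h, huv]
      rw [neg_mul_neg, show (1 - x * q) * p * (v * r) = (1 - x * q) * (p * v) * r by noncomm_ring,
        hc, show (1 - x * q) * (v * p + 2 * c) * r =
          (1 - x * q) * v * (p * r) + 2 * ((1 - x * q) * c * r) by noncomm_ring, hpr, huv']
      noncomm_ring
    · have h01 : -((1 - x * q) * p) * (z - p' * w * x * r) = x * (q * p * z + r) - p * z := by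
        rw [neg_mul, mul_sub, key]
        noncomm_ring
      have h10 : v * q * -((1 - x * q) * p) = -(q * p) := by
        rw [mul_neg, ← mul_assoc, hvq]
      have h11 : v * q * -((1 - x * q) * p) * (z - p' * w * x * r) + -(v * r) =
          -(q * p * z + r) := by
        rw [h10, show -(q * p) * (z - p' * w * x * r) = -(q * p * z) + q * (p * p') * w * x * r by
          noncomm_ring, hpp', mul_one, hqwx]
        noncomm_ring
      rw [h11, h10, h01]
      refine Matrix.ext fun i j => ?_
      fin_cases i <;> fin_cases j <;> simp [Matrix.mul_apply, Fin.sum_univ_two] <;> noncomm_ring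
    · have hσp := hσ hp
      have hσv := hσ hu
      simp only [map_add, map_sub, map_mul, map_neg, map_one, map_ofNat, hp', hw, hv, hR]
        at hσe hσc hσv ⊢
      exact cellValue_lower_identity h2 hp hq hσe hσc

/-- A map on generators extends to a homomorphism as soon as the subgroup generated by its graph
meets the fibre over `1` trivially. -/
theorem exists_hom_of_graph {ι G H : Type*} [Group G] [Group H] (s : ι → G) (v : ι → H)
    (h : ∀ g ∈ Subgroup.closure (Set.range fun i => (s i, v i)), g.1 = 1 → g.2 = 1) :
    ∃ φ : Subgroup.closure (Set.range s) →* H,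
      ∀ i, φ ⟨s i, Subgroup.subset_closure ⟨i, rfl⟩⟩ = v i := by
  set F := Subgroup.closure (Set.range fun i => (s i, v i)) with hF
  have hmap : F.map (MonoidHom.fst G H) = Subgroup.closure (Set.range s) := by
    rw [hF, MonoidHom.map_closure, ← Set.range_comp]
    rfl
  have hmem : ∀ g : F, g.1.1 ∈ Subgroup.closure (Set.range s) := fun g =>
    hmap ▸ Subgroup.mem_map_of_mem (MonoidHom.fst G H) g.2
  let π : F →* Subgroup.closure (Set.range s) :=
    ((MonoidHom.fst G H).comp F.subtype).codRestrict _ hmem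
  have hπ : Function.Bijective π := by
    refine ⟨(injective_iff_map_eq_one π).2 fun g hg => ?_, fun ⟨a, ha⟩ => ?_⟩
    · have h1 : g.1.1 = 1 := congrArg Subtype.val hg
      exact Subtype.ext (Prod.ext h1 (h g.1 g.2 h1))
    · rw [← hmap] at ha
      obtain ⟨g, hg, rfl⟩ := ha
      exact ⟨⟨g, hg⟩, rfl⟩
  let e := MulEquiv.ofBijective π hπ
  refine ⟨((MonoidHom.snd G H).comp F.subtype).comp e.symm.toMonoidHom, fun i => ?_⟩
  have hi : e.symm ⟨s i, Subgroup.subset_closure ⟨i, rfl⟩⟩ =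
      ⟨(s i, v i), Subgroup.subset_closure ⟨i, rfl⟩⟩ := by
    rw [MulEquiv.symm_apply_eq]
    rfl
  simp [hi]

/-- Reduction of Lipschitz quaternions modulo `4`. -/
def redFour : Quaternion ℤ →+* Quaternion (ZMod 4) :=
  quatMap (Int.castRingHom (ZMod 4))

theorem Em_inv (x : Quaternion ℤ) :
    (Em (Quaternion ℤ) x)⁻¹ = Em _ 0 * (Em _ (-x) * Em _ 0) := by
  rw [inv_eq_iff_mul_eq_one]
  refine Units.ext (Matrix.ext fun i j => ?_)
  fin_cases i <;> fin_cases j <;> simp [Em, Matrix.mul_apply, Fin.sum_univ_two]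

theorem Em_map_redFour (x : Quaternion ℤ) :
    (Em (Quaternion ℤ) x).val.map redFour = !![redFour x, 1; -1, 0] := by
  refine Matrix.ext fun i j => ?_
  fin_cases i <;> fin_cases j <;> simp [Em]

theorem cellValue_of_mem_closure
    {g : (Matrix (Fin 2) (Fin 2) (Quaternion ℤ))ˣ × Multiplicative (Quaternion (ZMod 2))}
    (hg : g ∈ Subgroup.closure
      (Set.range fun x => (Em (Quaternion ℤ) x, Multiplicative.ofAdd (redTwo (redFour x) + 1)))) :
    CellValue (g.1.val.map redFour) g.2.toAdd := by
  induction hg using Subgroup.closure_induction_left with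
  | one =>
    have h := cellValue_one
    rw [← Matrix.map_one redFour (map_zero _) (map_one _)] at h
    exact h
  | mul_left _ hx y _ ih =>
    obtain ⟨x, rfl⟩ := hx
    have h := ih.mul_left (redFour x)
    rw [← Em_map_redFour, ← Matrix.map_mul] at h
    exact h
  | inv_mul_cancel _ hx y _ ih =>
    obtain ⟨x, rfl⟩ := hx
    have h := ((ih.mul_left (redFour 0)).mul_left (redFour (-x))).mul_left (redFour 0)
    simp only [← Em_map_redFour, ← Matrix.map_mul] at h
    convert h using 1
    · simp only [Prod.fst_mul, Prod.fst_inv, Em_inv, Units.val_mul, Matrix.mul_assoc]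
    · simp only [Prod.snd_mul, Prod.snd_inv, toAdd_mul, toAdd_inv, toAdd_ofAdd, map_neg, map_zero]
      linear_combination (-2 : Quaternion (ZMod 2)) * quaternion_zmod_two_two_eq_zero

/-- The character of `E₂(ℒ)` sending `E(x)` to `x + 1` modulo `2`. -/
theorem exists_character : ∃ φ : E2 (Quaternion ℤ) →* Multiplicative (Quaternion (ZMod 2)),
    ∀ x, φ ⟨Em _ x, Subgroup.subset_closure ⟨x, rfl⟩⟩ =
      Multiplicative.ofAdd (redTwo (redFour x) + 1) := by
  refine exists_hom_of_graph _ _ fun g hg h1 => ?_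
  have h := cellValue_of_mem_closure hg
  rw [h1, Units.val_one, Matrix.map_one _ (map_zero _) (map_one _)] at h
  exact h.eq_zero

/-- `E(x)` as an element of `E₂(R)`. -/
def EmE2 {R : Type*} [Ring R] (x : R) : E2 R :=
  ⟨Em R x, Subgroup.subset_closure ⟨x, rfl⟩⟩

theorem EmE2_mul_inv_mul {R : Type*} [Ring R] (x y : R) :
    EmE2 x * (EmE2 0)⁻¹ * EmE2 y = EmE2 (x + y) := by
  refine Subtype.ext (Units.ext ?_)
  change (!![x, 1; -1, 0] * !![0, -1; 1, 0]) * !![y, 1; -1, 0] = !![x + y, 1; -1, 0]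
  refine Matrix.ext fun i j => ?_
  fin_cases i <;> fin_cases j <;> simp [Matrix.mul_apply, Fin.sum_univ_two, add_comm]

theorem EmE2_one_pow_three {R : Type*} [Ring R] : (EmE2 (1 : R)) ^ 3 = EmE2 0 ^ 2 := by
  rw [pow_three, pow_two]
  refine Subtype.ext (Units.ext ?_)
  change !![(1 : R), 1; -1, 0] * (!![(1 : R), 1; -1, 0] * !![(1 : R), 1; -1, 0]) =
    !![(0 : R), 1; -1, 0] * !![(0 : R), 1; -1, 0]
  refine Matrix.ext fun i j => ?_
  fin_cases i <;> fin_cases j <;> simp [Matrix.mul_apply, Fin.sum_univ_two]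

/-- For `u` with `u² = -1`, the diagonal matrix `E(u) E(-u) E(u)` conjugates `E(x) E(0)⁻¹` to
`E(uxu) E(0)⁻¹`. -/
theorem EmE2_conj {R : Type*} [Ring R] {u : R} (hu : u * u = -1) (x : R) :
    EmE2 u * EmE2 (-u) * EmE2 u * (EmE2 x * (EmE2 0)⁻¹) =
      EmE2 (u * x * u) * (EmE2 0)⁻¹ * (EmE2 u * EmE2 (-u) * EmE2 u) := by
  have hd : (!![u, 1; -1, 0] * !![-u, 1; -1, 0] * !![u, 1; -1, 0] : Matrix (Fin 2) (Fin 2) R) =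
      !![-u, 0; 0, u] := by
    refine Matrix.ext fun i j => ?_
    fin_cases i <;> fin_cases j <;> simp [Matrix.mul_apply, Fin.sum_univ_two, hu]
  refine Subtype.ext (Units.ext ?_)
  change !![u, 1; -1, 0] * !![-u, 1; -1, 0] * !![u, 1; -1, 0] *
      (!![x, 1; -1, 0] * !![0, -1; 1, 0]) =
    !![u * x * u, 1; -1, 0] * !![0, -1; 1, 0] *
      (!![u, 1; -1, 0] * !![-u, 1; -1, 0] * !![u, 1; -1, 0])
  rw [hd]
  refine Matrix.ext fun i j => ?_
  fin_cases i <;> fin_cases j <;>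
    simp [Matrix.mul_apply, Fin.sum_univ_two, mul_assoc, hu]

/-- The homomorphism `x ↦ [E(x) E(0)⁻¹]` into the abelianization of `E₂(R)`. -/
def elemClass (R : Type*) [Ring R] : Multiplicative R →* Abelianization (E2 R) where
  toFun x := Abelianization.of (EmE2 x.toAdd * (EmE2 0)⁻¹)
  map_one' := by
    rw [toAdd_one, mul_inv_cancel, map_one]
  map_mul' x y := by
    rw [← map_mul, toAdd_mul, ← EmE2_mul_inv_mul, mul_assoc, mul_assoc]

theorem elemClass_apply {R : Type*} [Ring R] (x : R) :
    elemClass R (Multiplicative.ofAdd x) = Abelianization.of (EmE2 x * (EmE2 0)⁻¹) := rfl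

theorem elemClass_surjective (R : Type*) [Ring R] : Function.Surjective (elemClass R) := by
  have h0 : Abelianization.of (EmE2 (0 : R)) ∈ (elemClass R).range := by
    refine ⟨Multiplicative.ofAdd (-3 : R), ?_⟩
    have h3 : Multiplicative.ofAdd (-3 : R) = (Multiplicative.ofAdd 1 ^ 3)⁻¹ := by
      rw [← ofAdd_nsmul, ← ofAdd_neg]
      norm_num
    have h1 := congrArg Abelianization.of (EmE2_one_pow_three (R := R))
    rw [map_pow, map_pow] at h1
    rw [h3, map_inv, map_pow, elemClass_apply, map_mul, map_inv, mul_pow, h1]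
    group
  have hE : ∀ x : R, Abelianization.of (EmE2 x) ∈ (elemClass R).range := fun x => by
    have := mul_mem (MonoidHom.mem_range.2 ⟨Multiplicative.ofAdd x, rfl⟩) h0
    rwa [elemClass_apply, map_mul, map_inv, inv_mul_cancel_right] at this
  intro a
  obtain ⟨⟨g, hg⟩, rfl⟩ := QuotientGroup.mk_surjective a
  change Abelianization.of ⟨g, hg⟩ ∈ (elemClass R).range
  induction hg using Subgroup.closure_induction with
  | mem g hg =>
    obtain ⟨x, rfl⟩ := hg
    exact hE x
  | one => exact one_mem _
  | mul g h hg hh ihg ihh => exact mul_mem ihg ihh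
  | inv g hg ih => exact inv_mem ih

theorem elemClass_conj {R : Type*} [Ring R] {u : R} (hu : u * u = -1) (x : R) :
    elemClass R (Multiplicative.ofAdd (u * x * u)) = elemClass R (Multiplicative.ofAdd x) := by
  have h := congrArg Abelianization.of (EmE2_conj hu x)
  rw [map_mul, map_mul _ _ (EmE2 u * _ * _), mul_comm] at h
  exact (mul_right_cancel h).symm

theorem elemClass_sub_conj {R : Type*} [Ring R] {u : R} (hu : u * u = -1) (x : R) :
    elemClass R (Multiplicative.ofAdd (x - u * x * u)) = 1 := by
  rw [ofAdd_sub, map_div, elemClass_conj hu, div_self']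

theorem elemClass_two_mul (y : Quaternion ℤ) :
    elemClass (Quaternion ℤ) (Multiplicative.ofAdd (2 * y)) = 1 := by
  have hi : quat (0 : ℤ) 1 0 0 * quat 0 1 0 0 = -1 := by
    ext <;> simp [Quaternion.re_one, Quaternion.imI_one, Quaternion.imJ_one, Quaternion.imK_one]
  have hj : quat (0 : ℤ) 0 1 0 * quat 0 0 1 0 = -1 := by
    ext <;> simp [Quaternion.re_one, Quaternion.imI_one, Quaternion.imJ_one, Quaternion.imK_one]
  have hk : quat (0 : ℤ) 0 0 1 * quat 0 0 0 1 = -1 := by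
    ext <;> simp [Quaternion.re_one, Quaternion.imI_one, Quaternion.imJ_one, Quaternion.imK_one]
  have h : 2 * y =
      (quat y.re y.imI 0 0 - quat 0 1 0 0 * quat y.re y.imI 0 0 * quat 0 1 0 0) +
      (quat 0 0 y.imJ 0 - quat 0 0 1 0 * quat 0 0 y.imJ 0 * quat 0 0 1 0) +
      (quat 0 0 0 y.imK - quat 0 0 0 1 * quat 0 0 0 y.imK * quat 0 0 0 1) := by
    rw [two_mul]
    ext <;> simp
  rw [h, ofAdd_add, ofAdd_add, map_mul, map_mul, elemClass_sub_conj hi, elemClass_sub_conj hj,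
    elemClass_sub_conj hk, one_mul, one_mul]

theorem elemClass_eq_one_iff (x : Quaternion ℤ) :
    elemClass (Quaternion ℤ) (Multiplicative.ofAdd x) = 1 ↔ 2 ∣ x := by
  refine ⟨fun h => ?_, ?_⟩
  · obtain ⟨φ, hφ⟩ := exists_character
    have hx := congrArg (Abelianization.lift φ) h
    rw [elemClass_apply, Abelianization.lift_apply_of, map_mul, map_inv, EmE2, EmE2, hφ, hφ,
      map_one, ← ofAdd_neg, ← ofAdd_add, map_zero, map_zero, zero_add,
      add_neg_cancel_right, ofAdd_eq_one] at hx
    have hz : ∀ n : ℤ, ZMod.castHom (by decide : 2 ∣ 4) (ZMod 2) (Int.castRingHom (ZMod 4) n) = 0 →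
        2 ∣ n := fun n hn => by
      refine (ZMod.intCast_zmod_eq_zero_iff_dvd n 2).1 ?_
      simpa using hn
    obtain ⟨a, ha⟩ := hz _ (congrArg QuaternionAlgebra.re hx)
    obtain ⟨b, hb⟩ := hz _ (congrArg QuaternionAlgebra.imI hx)
    obtain ⟨c, hc⟩ := hz _ (congrArg QuaternionAlgebra.imJ hx)
    obtain ⟨d, hd⟩ := hz _ (congrArg QuaternionAlgebra.imK hx)
    refine ⟨quat a b c d, ?_⟩
    rw [two_mul]
    ext <;> simp [two_mul, *]
  · rintro ⟨y, rfl⟩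
    exact elemClass_two_mul y

/-- The coordinates of a Lipschitz quaternion modulo `2`. -/
def coordTwo : Multiplicative (Quaternion ℤ) →* (Fin 4 → Multiplicative (ZMod 2)) where
  toFun x i := Multiplicative.ofAdd
    ((![x.toAdd.re, x.toAdd.imI, x.toAdd.imJ, x.toAdd.imK] i : ℤ) : ZMod 2)
  map_one' := by
    funext i
    fin_cases i <;> rfl
  map_mul' x y := by
    funext i
    fin_cases i <;> simp

theorem coordTwo_surjective : Function.Surjective coordTwo := fun v => by
  have hz : ∀ a : Multiplicative (ZMod 2), ∃ n : ℤ, Multiplicative.ofAdd (n : ZMod 2) = a :=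
    fun a => ZMod.intCast_surjective a.toAdd
  choose n hn using hz
  refine ⟨Multiplicative.ofAdd (quat (n (v 0)) (n (v 1)) (n (v 2)) (n (v 3))), funext fun i => ?_⟩
  fin_cases i <;> exact hn _

theorem coordTwo_eq_one_iff (x : Quaternion ℤ) :
    coordTwo (Multiplicative.ofAdd x) = 1 ↔ 2 ∣ x := by
  have hz : ∀ n : ℤ, Multiplicative.ofAdd (n : ZMod 2) = 1 ↔ 2 ∣ n := fun n => by
    rw [ofAdd_eq_one]
    exact ZMod.intCast_zmod_eq_zero_iff_dvd n 2
  refine ⟨fun h => ?_, ?_⟩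
  · obtain ⟨a, ha⟩ := (hz _).1 (congrFun h 0)
    obtain ⟨b, hb⟩ := (hz _).1 (congrFun h 1)
    obtain ⟨c, hc⟩ := (hz _).1 (congrFun h 2)
    obtain ⟨d, hd⟩ := (hz _).1 (congrFun h 3)
    refine ⟨quat a b c d, ?_⟩
    rw [two_mul]
    ext
    · simpa [two_mul] using ha
    · simpa [two_mul] using hb
    · simpa [two_mul] using hc
    · simpa [two_mul] using hd
  · rintro ⟨y, rfl⟩
    rw [two_mul]
    funext i
    fin_cases i <;> exact (hz _).2 ⟨_, (two_mul _).symm⟩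

/-- The abelianization of `E₂(ℒ)`, `ℒ` the Lipschitz quaternions, is isomorphic to the
direct product of `4` copies of the cyclic group of order `2`. -/
theorem abelianization_E2_lipschitz :
    Nonempty (Abelianization ↥(E2 (Quaternion ℤ)) ≃* (Fin 4 → Multiplicative (ZMod 2))) := by
  have hker : (elemClass (Quaternion ℤ)).ker = coordTwo.ker := by
    ext x
    exact (elemClass_eq_one_iff x.toAdd).trans (coordTwo_eq_one_iff x.toAdd).symm
  exact ⟨(QuotientGroup.quotientKerEquivOfSurjective _ (elemClass_surjective _)).symm.trans
    ((QuotientGroup.quotientMulEquivOfEq hker).trans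
      (QuotientGroup.quotientKerEquivOfSurjective _ coordTwo_surjective))⟩
end
end

section
/- The group SL₂(ℤ[√−3]) (in Lean: Matrix.SpecialLinearGroup (Fin 2) (Zsqrtd (−3))) is a nontrivial free product with amalgamation; that is, there exist groups A, B, C, injective group homomorphisms f : C → A and g : C → B, neither of which is surjective, and a group isomorphism between SL₂(ℤ[√−3]) and the amalgamated free product A ∗_C B (the pushout of f and g). -/
universe u v w

/-- A two-element family of types indexed by `Bool`. -/
def boolFam (A B : Type u) : Bool → Type u := fun b => match b with
  | true => A
  | false => B

instance boolFamGroup {A B : Type u} [Group A] [Group B] : ∀ b, Group (boolFam A B b)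
  | true => inferInstanceAs (Group A)
  | false => inferInstanceAs (Group B)

/-- The pair of maps `f : C →* A`, `g : C →* B` as a `Bool`-indexed family. -/
def boolHoms {A B C : Type u} [Group A] [Group B] [Group C] (f : C →* A) (g : C →* B) :
    (b : Bool) → C →* boolFam A B b
  | true => f
  | false => g

/-- A group `Γ` is a nontrivial free product with amalgamation if it is isomorphic to the
pushout (amalgamated free product) `A ∗_C B` of two injective, non-surjective group
homomorphisms `f : C → A` and `g : C → B`. -/
def IsNontrivialAmalgam (Γ : Type v) [Group Γ] : Prop :=
  ∃ (A B C : Type v) (_ : Group A) (_ : Group B) (_ : Group C)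
    (f : C →* A) (g : C →* B),
      Function.Injective f ∧ Function.Injective g ∧
      ¬ Function.Surjective f ∧ ¬ Function.Surjective g ∧
      Nonempty (Γ ≃* Monoid.PushoutI (boolHoms f g))

/-- The inclusions of two subgroups as a `Bool`-indexed family of homomorphisms. -/
def boolSubtypes {G : Type u} [Group G] (A B : Subgroup G) : ∀ b, boolFam A B b →* G
  | true => A.subtype
  | false => B.subtype

/-- **Ping-pong for amalgams.** If `A` and `B` generate `G` and left multiplication by elements of
`A \ B` and of `B \ A` plays ping-pong with two subsets `S` and `T` of `G`, neither of which
contains `1`, then `G` is the amalgam of `A` and `B` along `A ⊓ B`. -/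
theorem IsNontrivialAmalgam.of_pingPong {G : Type u} [Group G] (A B : Subgroup G)
    (S T : Set G) (hgen : A ⊔ B = ⊤) (hAB : ¬ A ≤ B) (hBA : ¬ B ≤ A)
    (hS : 1 ∉ S) (hT : 1 ∉ T)
    (hCS : ∀ c ∈ A ⊓ B, ∀ g ∈ S, c * g ∈ S) (hCT : ∀ c ∈ A ⊓ B, ∀ g ∈ T, c * g ∈ T)
    (hA : ∀ a ∈ A, a ∉ B → ∀ g, g ∈ A ⊓ B ∨ g ∈ T → a * g ∈ S)
    (hB : ∀ b ∈ B, b ∉ A → ∀ g, g ∈ A ⊓ B ∨ g ∈ S → b * g ∈ T) :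
    IsNontrivialAmalgam G := by
  have hf : Function.Injective (Subgroup.inclusion (inf_le_left : A ⊓ B ≤ A)) :=
    Subgroup.inclusion_injective _
  have hg : Function.Injective (Subgroup.inclusion (inf_le_right : A ⊓ B ≤ B)) :=
    Subgroup.inclusion_injective _
  refine ⟨A, B, (A ⊓ B : Subgroup G), inferInstance, inferInstance, inferInstance,
    Subgroup.inclusion inf_le_left, Subgroup.inclusion inf_le_right, hf, hg, ?_, ?_, ?_⟩
  · refine fun h ↦ hAB fun a ha ↦ ?_
    obtain ⟨c, hc⟩ := h ⟨a, ha⟩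
    have : (c : G) = a := congrArg Subtype.val hc
    exact this ▸ c.2.2
  · refine fun h ↦ hBA fun b hb ↦ ?_
    obtain ⟨c, hc⟩ := h ⟨b, hb⟩
    have : (c : G) = b := congrArg Subtype.val hc
    exact this ▸ c.2.1
  set φ := boolHoms (Subgroup.inclusion (inf_le_left : A ⊓ B ≤ A))
    (Subgroup.inclusion (inf_le_right : A ⊓ B ≤ B))
  have hφi : ∀ b, Function.Injective (φ b) := Bool.rec hg hf
  let L : Monoid.PushoutI φ →* G :=
    Monoid.PushoutI.lift (boolSubtypes A B) (A ⊓ B).subtype (Bool.rec rfl rfl)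
  have hLbase (c) : L (Monoid.PushoutI.base φ c) = c := Monoid.PushoutI.lift_base ..
  have hLof (b) (x : boolFam A B b) : L (Monoid.PushoutI.of b x) = boolSubtypes A B b x :=
    Monoid.PushoutI.lift_of ..
  obtain ⟨d⟩ := Monoid.PushoutI.NormalWord.transversal_nonempty φ hφi
  classical
  have key (w : Monoid.PushoutI.NormalWord d) :
      (w.fstIdx = none → w.prod ∈ (Monoid.PushoutI.base φ).range) ∧
      (w.fstIdx = some true → L w.prod ∈ S) ∧ (w.fstIdx = some false → L w.prod ∈ T) := by
    induction w using Monoid.PushoutI.NormalWord.consRecOn with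
    | empty => 
      have h1 : (Monoid.PushoutI.NormalWord.empty : Monoid.PushoutI.NormalWord d).fstIdx = none :=
        rfl
      rw [Monoid.PushoutI.NormalWord.prod_empty, h1]
      exact ⟨fun _ ↦ one_mem _, by simp, by simp⟩
    | cons i g w hmw _ hgr _ ih =>
      rw [Monoid.PushoutI.NormalWord.prod_cons, map_mul, hLof]
      have hfst : (Monoid.PushoutI.NormalWord.cons g w hmw hgr).fstIdx = some i := by
        simp [Monoid.PushoutI.NormalWord.cons, Monoid.CoprodI.Word.fstIdx]
      have hnone : w.fstIdx = none → L w.prod ∈ A ⊓ B := fun h ↦ by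
        obtain ⟨c, hc⟩ := ih.1 h
        rw [← hc, hLbase]
        exact c.2
      rw [hfst]
      match i, g, hmw, hgr with
      | true, g, hmw, hgr =>
        refine ⟨by simp, fun _ ↦ ?_, by simp⟩
        refine hA _ (Subtype.prop (p := (· ∈ A)) g)
          (fun h ↦ hgr ⟨⟨_, Subtype.prop (p := (· ∈ A)) g, h⟩, rfl⟩) _ ?_
        match hw : w.fstIdx, hmw with
        | none, _ => exact .inl (hnone hw)
        | some false, _ => exact .inr (ih.2.2 hw)
        | some true, h => exact absurd rfl h
      | false, g, hmw, hgr =>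
        refine ⟨by simp, by simp, fun _ ↦ ?_⟩
        refine hB _ (Subtype.prop (p := (· ∈ B)) g)
          (fun h ↦ hgr ⟨⟨_, h, Subtype.prop (p := (· ∈ B)) g⟩, rfl⟩) _ ?_
        match hw : w.fstIdx, hmw with
        | none, _ => exact .inl (hnone hw)
        | some true, _ => exact .inr (ih.2.1 hw)
        | some false, h => exact absurd rfl h
    | base c w hw ih =>
      rw [Monoid.PushoutI.NormalWord.base_smul_eq_smul, Monoid.PushoutI.NormalWord.prod_base_smul,
        map_mul, hLbase]
      have hfst : (c • w).fstIdx = w.fstIdx := by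
        simp [Monoid.PushoutI.NormalWord.base_smul_def', Monoid.CoprodI.Word.fstIdx]
      rw [hfst]
      exact ⟨fun h ↦ mul_mem ⟨c, rfl⟩ (ih.1 h), fun h ↦ hCS _ c.2 _ (ih.2.1 h),
        fun h ↦ hCT _ c.2 _ (ih.2.2 h)⟩
  have hinj : Function.Injective L := by
    refine (injective_iff_map_eq_one L).2 fun x hx ↦ ?_
    obtain ⟨w, rfl⟩ : ∃ w : Monoid.PushoutI.NormalWord d, w.prod = x :=
      ⟨_, Monoid.PushoutI.NormalWord.equiv.symm_apply_apply x⟩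
    obtain ⟨h0, h1, h2⟩ := key w
    rw [hx] at h1 h2
    match hw : w.fstIdx with
    | none =>
      obtain ⟨c, hc⟩ := h0 hw
      rw [← hc, hLbase] at hx
      rw [← hc, (Subtype.ext hx : c = 1), map_one]
    | some true => exact absurd (h1 hw) hS
    | some false => exact absurd (h2 hw) hT
  have hsurj : Function.Surjective L := by
    rw [← MonoidHom.range_eq_top, eq_top_iff, ← hgen, sup_le_iff]
    exact ⟨fun a ha ↦ ⟨Monoid.PushoutI.of (φ := φ) true (⟨a, ha⟩ : A), hLof true _⟩,
      fun b hb ↦ ⟨Monoid.PushoutI.of (φ := φ) false (⟨b, hb⟩ : B), hLof false _⟩⟩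
  exact ⟨(MulEquiv.ofBijective L ⟨hinj, hsurj⟩).symm⟩

/-- A group `G` acting on a partially ordered set `P` of halfspaces, compatibly with the operation
`σ` of passing to the complementary halfspace, such that any two halfspaces are nested (in exactly
one way) and intervals are finite, as witnessed by a strictly monotone integer valued rank. -/
structure IsNestedAction (G : Type u) {P : Type w} [Group G] [PartialOrder P] [MulAction G P]
    (σ : P → P) (rank : P → ℤ) : Prop where
  smul_le_smul (g : G) {x y : P} : x ≤ y → g • x ≤ g • y
  invol (x : P) : σ (σ x) = x
  antitone {x y : P} : x ≤ y → σ y ≤ σ x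
  smul_compl (g : G) (x : P) : g • σ x = σ (g • x)
  nested (x y : P) : x ≤ y ∨ y ≤ x ∨ x ≤ σ y ∨ σ y ≤ x
  not_le_compl {x y : P} : x ≤ y → ¬ x ≤ σ y
  rank_strictMono : StrictMono rank

namespace IsNestedAction

variable {G : Type u} {P : Type w} [Group G] [PartialOrder P] [MulAction G P]
  {σ : P → P} {rank : P → ℤ}

theorem smul_lt_smul (h : IsNestedAction G σ rank) (g : G) {x y : P} (hxy : x < y) :
    g • x < g • y :=
  lt_of_le_of_ne (h.smul_le_smul g hxy.le) fun e ↦ hxy.ne (smul_left_cancel g e)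

theorem smul_covBy_smul (h : IsNestedAction G σ rank) (g : G) {x y : P} (hxy : x ⋖ y) :
    g • x ⋖ g • y := by
  refine ⟨h.smul_lt_smul g hxy.1, fun z hz hz' ↦ hxy.2 (c := g⁻¹ • z) ?_ ?_⟩
  · simpa using h.smul_lt_smul g⁻¹ hz
  · simpa using h.smul_lt_smul g⁻¹ hz'

theorem compl_lt_compl (h : IsNestedAction G σ rank) {x y : P} (hxy : x < y) : σ y < σ x :=
  lt_of_le_of_ne (h.antitone hxy.le) fun e ↦ hxy.ne (by rw [← h.invol x, ← e, h.invol])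

theorem compl_covBy_compl (h : IsNestedAction G σ rank) {x y : P} (hxy : x ⋖ y) :
    σ y ⋖ σ x := by
  refine ⟨h.compl_lt_compl hxy.1, fun z hz hz' ↦ hxy.2 (c := σ z) ?_ ?_⟩
  · simpa [h.invol] using h.compl_lt_compl hz'
  · simpa [h.invol] using h.compl_lt_compl hz

theorem not_compl_le (h : IsNestedAction G σ rank) {x y : P} (hxy : x ≤ y) : ¬ σ x ≤ y :=
  fun hc ↦ h.not_le_compl (h.antitone hxy) (by simpa [h.invol] using h.antitone hc)

theorem exists_covBy_le (h : IsNestedAction G σ rank) {x y : P} (hxy : x < y) :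
    ∃ z, x ⋖ z ∧ z ≤ y := by
  induction hn : (rank y - rank x).toNat using Nat.strong_induction_on generalizing y with
  | _ n ih =>
    by_cases hc : x ⋖ y
    · exact ⟨y, hc, le_rfl⟩
    · obtain ⟨z, hxz, hzy⟩ := (not_covBy_iff hxy).1 hc
      have h1 := h.rank_strictMono hxz
      have h2 := h.rank_strictMono hzy
      obtain ⟨m, hm, hmz⟩ := ih _ (by lia) hxz rfl
      exact ⟨m, hm, hmz.trans hzy.le⟩

/-- Two halfspaces are adjacent when their boundary walls bound a common region, which lies in
both of them. -/
def Adj (σ : P → P) (x y : P) : Prop := x = y ∨ σ x ⋖ y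

theorem Adj.symm (h : IsNestedAction G σ rank) {x y : P} (hxy : Adj σ x y) : Adj σ y x := by
  obtain rfl | hxy := hxy
  · exact .inl rfl
  · exact .inr (by simpa [h.invol] using h.compl_covBy_compl hxy)

theorem Adj.smul (h : IsNestedAction G σ rank) (g : G) {x y : P} (hxy : Adj σ x y) :
    Adj σ (g • x) (g • y) := by
  obtain rfl | hxy := hxy
  · exact .inl rfl
  · exact .inr (by simpa [h.smul_compl] using h.smul_covBy_smul g hxy)

theorem Adj.trans (h : IsNestedAction G σ rank) {x y z : P} (hxy : Adj σ x y)
    (hyz : Adj σ y z) : Adj σ x z := by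
  have hzy := hyz.symm h
  obtain rfl | hxy := hxy
  · exact hyz
  obtain rfl | hyz := hyz
  · exact .inr hxy
  obtain rfl | hzy := hzy
  · exact .inr hxy
  have hle : ¬ z ≤ σ x := fun hc ↦ h.not_compl_le (hc.trans hxy.le) hzy.le
  rcases h.nested (σ x) z with hn | hn | hn | hn
  · refine .inr ⟨lt_of_le_of_ne hn fun e ↦ hle e.ge, fun w hw hwz ↦ ?_⟩
    rcases h.nested w y with hm | hm | hm | hm
    · obtain rfl | hm := hm.eq_or_lt
      · exact h.not_compl_le hwz.le hyz.le
      · exact hxy.2 hw hm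
    · exact h.not_compl_le (hm.trans hwz.le) hyz.le
    · exact h.not_le_compl hxy.le (hw.le.trans hm)
    · obtain rfl | hm := hm.eq_or_lt
      · exact h.not_le_compl hxy.le hw.le
      · exact hyz.2 hm hwz
  · exact absurd hn hle
  · obtain e | hn := hn.eq_or_lt
    · exact .inl (by rw [← h.invol x, e, h.invol])
    · exact absurd hzy.lt (hxy.2 hn)
  · obtain e | hn := hn.eq_or_lt
    · exact .inl (by rw [← h.invol x, ← e, h.invol])
    · exact absurd hxy.lt (hzy.2 hn)

/-- The stabilizer of the wall bounding the halfspace `o`. -/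
def wallStabilizer (h : IsNestedAction G σ rank) (o : P) : Subgroup G where
  carrier := {g | g • o = o ∨ g • o = σ o}
  one_mem' := .inl (one_smul _ _)
  mul_mem' := by
    rintro a b ha (hb | hb)
    · simpa [mul_smul, hb] using ha
    · rcases ha with ha | ha <;> simp [mul_smul, hb, h.smul_compl, ha, h.invol]
  inv_mem' := by
    rintro a (ha | ha)
    · exact .inl (inv_smul_eq_iff.2 ha.symm)
    · exact .inr (inv_smul_eq_iff.2 (by rw [h.smul_compl, ha, h.invol]))

/-- The stabilizer of the region inside the halfspace `o` next to its boundary wall. -/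
def regionStabilizer (h : IsNestedAction G σ rank) (o : P) : Subgroup G where
  carrier := {g | Adj σ o (g • o)}
  one_mem' := .inl (one_smul _ _).symm
  mul_mem' {a b} ha hb := by
    change Adj σ o ((a * b) • o)
    rw [mul_smul]
    exact Adj.trans h ha (hb.smul h a)
  inv_mem' {a} ha := by
    simpa using (Adj.smul h a⁻¹ ha).symm h

theorem wallStabilizer_sup_regionStabilizer (h : IsNestedAction G σ rank) {o : P}
    (htrans : ∀ x : P, ∃ g : G, g • o = x) :
    h.wallStabilizer o ⊔ h.regionStabilizer o = ⊤ := by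
  set K := h.wallStabilizer o ⊔ h.regionStabilizer o
  have hwall : h.wallStabilizer o ≤ K := le_sup_left
  have hregion : h.regionStabilizer o ≤ K := le_sup_right
  obtain ⟨s, hs⟩ := htrans (σ o)
  have hsK : s ∈ K := hwall (.inr hs)
  have hcompl (x : P) (hx : ∃ g ∈ K, g • o = x) : ∃ g ∈ K, g • o = σ x := by
    obtain ⟨g, hg, rfl⟩ := hx
    exact ⟨g * s, mul_mem hg hsK, by rw [mul_smul, hs, h.smul_compl]⟩
  have hstep (n : ℕ) : ∀ x y : P, (∃ g ∈ K, g • o = x) → x < y → (rank y - rank x).toNat = n →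
      ∃ g ∈ K, g • o = y := by
    induction n using Nat.strong_induction_on with
    | _ n ih =>
      rintro x y hx hxy rfl
      obtain ⟨z, hxz, hzy⟩ := h.exists_covBy_le hxy
      have hz : ∃ g ∈ K, g • o = z := by
        obtain ⟨g, hg, hgx⟩ := hcompl x hx
        obtain ⟨b, hb⟩ := htrans (g⁻¹ • z)
        refine ⟨g * b, mul_mem hg (hregion (.inr ?_)), by rw [mul_smul, hb, smul_inv_smul]⟩
        have := h.smul_covBy_smul g⁻¹ hxz
        rwa [← h.invol x, ← hgx, h.smul_compl, inv_smul_smul, ← hb] at this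
      obtain rfl | hzy := hzy.eq_or_lt
      · exact hz
      · have h1 := h.rank_strictMono hxz.lt
        have h2 := h.rank_strictMono hzy
        exact ih _ (by lia) z y hz hzy rfl
  have hle (x y : P) (hx : ∃ g ∈ K, g • o = x) (hxy : x ≤ y) : ∃ g ∈ K, g • o = y := by
    obtain rfl | hxy := hxy.eq_or_lt
    · exact hx
    · exact hstep _ x y hx hxy rfl
  have ho : ∃ g ∈ K, g • o = o := ⟨1, one_mem _, one_smul _ _⟩
  have hall (x : P) : ∃ g ∈ K, g • o = x := by
    rcases h.nested o x with hn | hn | hn | hn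
    · exact hle _ _ ho hn
    · simpa [h.invol] using hcompl _ (hle _ _ (hcompl _ ho) (h.antitone hn))
    · simpa [h.invol] using hcompl _ (hle _ _ ho hn)
    · exact hle _ _ (hcompl _ ho) (by simpa [h.invol] using h.antitone hn)
  refine eq_top_iff.2 fun g _ ↦ ?_
  obtain ⟨k, hk, hko⟩ := hall (g • o)
  have hmem : k⁻¹ * g ∈ K := hwall (.inl (by rw [mul_smul, ← hko, inv_smul_smul]))
  simpa using mul_mem hk hmem

/-- A group acting transitively on halfspaces, not all walls of which coincide, is a
nontrivial amalgam. -/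
theorem isNontrivialAmalgam (h : IsNestedAction G σ rank) {o p : P}
    (htrans : ∀ x : P, ∃ g : G, g • o = x) (hp : σ o < p) : IsNontrivialAmalgam G := by
  have ho : ¬ o ≤ σ o := h.not_le_compl le_rfl
  have ho' : ¬ σ o ≤ o := h.not_compl_le le_rfl
  have hinf {g : G} (hg : g ∈ h.wallStabilizer o ⊓ h.regionStabilizer o) : g • o = o := by
    obtain ⟨hg | hg, hg' | hg'⟩ := hg
    · exact hg
    · exact hg
    · exact hg'.symm
    · exact absurd hg'.lt (by rw [hg]; exact lt_irrefl _)
  refine .of_pingPong (h.wallStabilizer o) (h.regionStabilizer o)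
    {g | g • o ≤ σ o ∨ g • σ o < σ o} {g | g • o < o ∨ g • σ o < o}
    (h.wallStabilizer_sup_regionStabilizer htrans) ?_ ?_ ?_ ?_ ?_ ?_ ?_ ?_
  · intro hle
    obtain ⟨s, hs⟩ := htrans (σ o)
    have := hinf ⟨.inr hs, hle (.inr hs)⟩
    exact ho (this.symm.trans hs).le
  · intro hle
    obtain ⟨m, hm, -⟩ := h.exists_covBy_le hp
    obtain ⟨b, rfl⟩ := htrans m
    have hb : b ∈ h.regionStabilizer o := .inr hm
    have := hinf ⟨hle hb, hb⟩
    rw [this] at hm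
    exact ho' hm.le
  · rintro (hc | hc)
    · exact ho (by simpa using hc)
    · simp at hc
  · rintro (hc | hc)
    · simp at hc
    · exact ho' (by simpa using hc.le)
  · rintro c hc g (hg | hg)
    · left; simpa [mul_smul, h.smul_compl, hinf hc] using h.smul_le_smul c hg
    · right; simpa [mul_smul, h.smul_compl, hinf hc] using h.smul_lt_smul c hg
  · rintro c hc g (hg | hg)
    · left; simpa [mul_smul, hinf hc] using h.smul_lt_smul c hg
    · right; simpa [mul_smul, h.smul_compl, hinf hc] using h.smul_lt_smul c hg
  · intro a ha ha' g hg
    have hao : a • o = σ o := ha.resolve_left fun e ↦ ha' (.inl e.symm)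
    rcases hg with hg | hg | hg
    · left; rw [mul_smul, hinf hg, hao]
    · left; simpa [mul_smul, hao] using (h.smul_lt_smul a hg).le
    · right; simpa [mul_smul, hao] using h.smul_lt_smul a hg
  · intro b hb hb' g hg
    have hbo : b • σ o < o := by
      rcases hb with hb | hb
      · exact absurd (.inl hb.symm) hb'
      · simpa [h.smul_compl, h.invol] using h.compl_lt_compl hb.lt
    rcases hg with hg | hg | hg
    · right; rwa [mul_smul, h.smul_compl, hinf hg]
    · left; rw [mul_smul]; exact (h.smul_le_smul b hg).trans_lt hbo
    · right; rw [mul_smul]; exact (h.smul_lt_smul b hg).trans hbo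

end IsNestedAction

/-- The binary Hermitian form over `ℤ[√-3]` with diagonal coefficients `a`, `c` and
off-diagonal coefficient `(x - y√-3) / 2`, as an integer valued function on vectors. -/
def hermForm (a x y c : ℤ) (v : Fin 2 → ℤ√(-3)) : ℤ :=
  a * ((v 0).re ^ 2 + 3 * (v 0).im ^ 2)
    + x * ((v 0).re * (v 1).re + 3 * ((v 0).im * (v 1).im))
    + 3 * y * ((v 0).re * (v 1).im - (v 0).im * (v 1).re)
    + c * ((v 1).re ^ 2 + 3 * (v 1).im ^ 2)

namespace hermForm

theorem nonneg {a x y c : ℤ} (ha : 0 ≤ a) (hc : 0 ≤ c) (hdisc : x ^ 2 + 3 * y ^ 2 ≤ 4 * a * c)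
    (v : Fin 2 → ℤ√(-3)) : 0 ≤ hermForm a x y c v := by
  obtain rfl | ha := ha.eq_or_lt
  · have hx : x = 0 := by nlinarith
    have hy : y = 0 := by nlinarith
    subst hx hy
    simp only [hermForm, zero_mul, mul_zero, zero_add]
    positivity
  · have key : 4 * a * hermForm a x y c v =
        (2 * a * (v 0).re + x * (v 1).re + 3 * y * (v 1).im) ^ 2
        + 3 * (2 * a * (v 0).im + x * (v 1).im - y * (v 1).re) ^ 2
        + (4 * a * c - (x ^ 2 + 3 * y ^ 2)) * ((v 1).re ^ 2 + 3 * (v 1).im ^ 2) := by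
      simp only [hermForm]
      ring
    have h0 : 0 ≤ 4 * a * c - (x ^ 2 + 3 * y ^ 2) := by linarith
    refine nonneg_of_mul_nonneg_right (a := 4 * a) ?_ (by positivity)
    rw [key]
    positivity

theorem sub_apply (a x y c a' x' y' c' : ℤ) (v : Fin 2 → ℤ√(-3)) :
    hermForm a' x' y' c' v - hermForm a x y c v
      = hermForm (a' - a) (x' - x) (y' - y) (c' - c) v := by
  simp only [hermForm]
  ring

theorem neg_eq (a x y c : ℤ) : -hermForm a x y c = hermForm (-a) (-x) (-y) (-c) := by
  ext v
  simp only [hermForm, Pi.neg_apply]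
  ring

/-- Two Hermitian forms whose difference is not indefinite are comparable. -/
theorem le_or_le {a x y c a' x' y' c' : ℤ}
    (h : (x' - x) ^ 2 + 3 * (y' - y) ^ 2 ≤ 4 * (a' - a) * (c' - c)) :
    hermForm a x y c ≤ hermForm a' x' y' c' ∨ hermForm a' x' y' c' ≤ hermForm a x y c := by
  have hac : 0 ≤ (a' - a) * (c' - c) := by nlinarith [sq_nonneg (x' - x), sq_nonneg (y' - y)]
  by_cases hs : 0 ≤ a' - a ∧ 0 ≤ c' - c
  · left
    intro v
    rw [← sub_nonneg, sub_apply]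
    exact nonneg hs.1 hs.2 h v
  · right
    intro v
    rw [← sub_nonneg, sub_apply]
    have : a' - a ≤ 0 ∧ c' - c ≤ 0 := by
      rcases mul_nonneg_iff.1 hac with h' | h'
      · exact absurd h' hs
      · exact h'
    exact nonneg (by linarith) (by linarith) (by nlinarith) v

theorem nested {a x y c a' x' y' c' : ℤ} (h : x ^ 2 + 3 * y ^ 2 - 4 * a * c = 1)
    (h' : x' ^ 2 + 3 * y' ^ 2 - 4 * a' * c' = 1) :
    hermForm a x y c ≤ hermForm a' x' y' c' ∨ hermForm a' x' y' c' ≤ hermForm a x y c ∨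
    hermForm a x y c ≤ -hermForm a' x' y' c' ∨ -hermForm a' x' y' c' ≤ hermForm a x y c := by
  have parity {a x y c : ℤ} (h : x ^ 2 + 3 * y ^ 2 - 4 * a * c = 1) : Odd x ∧ Even y := by
    have h4 : (x ^ 2 + 3 * y ^ 2) % 4 = 1 := by
      rw [(by linarith : x ^ 2 + 3 * y ^ 2 = 1 + 4 * (a * c))]
      simp
    obtain ⟨m, rfl | rfl⟩ := x.even_or_odd' <;> obtain ⟨n, rfl | rfl⟩ := y.even_or_odd'
    · ring_nf at h4; lia
    · ring_nf at h4; lia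
    · simp
    · ring_nf at h4; lia
  obtain ⟨⟨m, rfl⟩, ⟨n, rfl⟩⟩ := parity h
  obtain ⟨⟨m', rfl⟩, ⟨n', rfl⟩⟩ := parity h'
  rcases le_or_gt 1 ((2 * m + 1) * (2 * m' + 1) + 3 * (n + n) * (n' + n')
    - 2 * (a * c' + a' * c)) with hB | hB
  · rcases le_or_le (a := a) (x := 2 * m + 1) (y := n + n) (c := c) (a' := a')
      (x' := 2 * m' + 1) (y' := n' + n') (c' := c') (by nlinarith) with hn | hn
    · exact .inl hn
    · exact .inr (.inl hn)
  · have hB' : (2 * m + 1) * (2 * m' + 1) + 3 * (n + n) * (n' + n')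
        - 2 * (a * c' + a' * c) ≤ -1 := by
      ring_nf at hB ⊢
      lia
    rw [neg_eq]
    rcases le_or_le (a := a) (x := 2 * m + 1) (y := n + n) (c := c) (a' := -a')
      (x' := -(2 * m' + 1)) (y' := -(n' + n')) (c' := -c') (by nlinarith) with hn | hn
    · exact .inr (.inr (.inl hn))
    · exact .inr (.inr (.inr hn))

/-- A Hermitian form of discriminant one takes negative values. -/
theorem exists_neg {a x y c : ℤ} (h : x ^ 2 + 3 * y ^ 2 - 4 * a * c = 1) :
    ∃ v, hermForm a x y c v < 0 := by
  by_contra! hv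
  have h0 := hv ![1, 0]
  have h1 := hv ![0, 1]
  have h2 := hv ![⟨-x, y⟩, ⟨2 * a, 0⟩]
  have h3 := hv ![⟨2 * c, 0⟩, ⟨-x, -y⟩]
  have h4 := hv ![⟨-x, y⟩, 1]
  simp [hermForm] at h0 h1 h2 h3 h4
  have ha : a = 0 := by nlinarith
  have hc : c = 0 := by nlinarith
  subst ha hc
  nlinarith

/-- A nonnegative Hermitian form with zero diagonal vanishes. -/
theorem eq_of_le {a x y c x' y' : ℤ} (h : hermForm a x y c ≤ hermForm a x' y' c) :
    x = x' ∧ y = y' := by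
  have h1 := h ![1, 1]
  have h2 := h ![1, -1]
  have h3 := h ![1, ⟨0, 1⟩]
  have h4 := h ![1, ⟨0, -1⟩]
  simp [hermForm] at h1 h2 h3 h4
  constructor <;> linarith

end hermForm

section Orbit

attribute [local instance] arrowAction

open Matrix

theorem smul_hermForm (g : SpecialLinearGroup (Fin 2) (ℤ√(-3))) :
    ∃ a x y c, g⁻¹ • hermForm 0 1 0 0 = hermForm a x y c ∧ x ^ 2 + 3 * y ^ 2 - 4 * a * c = 1 := by
  obtain ⟨p, hp⟩ : ∃ p, p = g 0 0 := ⟨_, rfl⟩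
  obtain ⟨q, hq⟩ : ∃ q, q = g 0 1 := ⟨_, rfl⟩
  obtain ⟨r, hr⟩ : ∃ r, r = g 1 0 := ⟨_, rfl⟩
  obtain ⟨s, hs⟩ : ∃ s, s = g 1 1 := ⟨_, rfl⟩
  have hdet : p * s - q * r = 1 := by
    rw [hp, hq, hr, hs, ← det_fin_two, g.det_coe]
  have hre : p.re * s.re - 3 * p.im * s.im - (q.re * r.re - 3 * q.im * r.im) = 1 := by
    have := congrArg Zsqrtd.re hdet
    simp at this
    linarith
  have him : p.re * s.im + p.im * s.re - (q.re * r.im + q.im * r.re) = 0 := by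
    have := congrArg Zsqrtd.im hdet
    simpa using this
  refine ⟨p.re * r.re + 3 * p.im * r.im,
    p.re * s.re + 3 * p.im * s.im + (q.re * r.re + 3 * q.im * r.im),
    -(p.re * s.im - p.im * s.re + (q.im * r.re - q.re * r.im)),
    q.re * s.re + 3 * q.im * s.im, ?_, ?_⟩
  · ext v
    have h0 : (g • v) 0 = p * v 0 + q * v 1 := by
      rw [hp, hq]
      change (g.val *ᵥ v) 0 = _
      simp [mulVec, dotProduct, Fin.sum_univ_two]
    have h1 : (g • v) 1 = r * v 0 + s * v 1 := by
      rw [hr, hs]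
      change (g.val *ᵥ v) 1 = _
      simp [mulVec, dotProduct, Fin.sum_univ_two]
    change hermForm 0 1 0 0 (g⁻¹⁻¹ • v) = _
    rw [inv_inv]
    simp only [hermForm, h0, h1, Zsqrtd.re_add, Zsqrtd.re_mul, Zsqrtd.im_add, Zsqrtd.im_mul]
    ring
  · linear_combination (p.re * s.re - 3 * p.im * s.im - (q.re * r.re - 3 * q.im * r.im) + 1) * hre
      + 3 * (p.re * s.im + p.im * s.re - (q.re * r.im + q.im * r.re)) * him

theorem exists_eq_hermForm
    (f : MulAction.orbit (SpecialLinearGroup (Fin 2) (ℤ√(-3))) (hermForm 0 1 0 0)) :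
    ∃ a x y c, f.1 = hermForm a x y c ∧ x ^ 2 + 3 * y ^ 2 - 4 * a * c = 1 := by
  obtain ⟨_, g, rfl⟩ := f
  simpa using smul_hermForm g⁻¹

theorem mem_orbit_hermForm {f : (Fin 2 → ℤ√(-3)) → ℤ}
    (g : Matrix.SpecialLinearGroup (Fin 2) (ℤ√(-3)))
    (hf : ∀ v, hermForm 0 1 0 0 (g.val *ᵥ v) = f v) :
    f ∈ MulAction.orbit (Matrix.SpecialLinearGroup (Fin 2) (ℤ√(-3))) (hermForm 0 1 0 0) := by
  refine ⟨g⁻¹, funext fun v ↦ ?_⟩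
  change hermForm 0 1 0 0 (g⁻¹⁻¹ • v) = f v
  rw [inv_inv]
  exact hf v

theorem neg_mem_orbit {f : (Fin 2 → ℤ√(-3)) → ℤ}
    (hf : f ∈ MulAction.orbit (SpecialLinearGroup (Fin 2) (ℤ√(-3))) (hermForm 0 1 0 0)) :
    -f ∈ MulAction.orbit (SpecialLinearGroup (Fin 2) (ℤ√(-3))) (hermForm 0 1 0 0) := by
  obtain ⟨g, rfl⟩ := hf
  have hneg : -hermForm 0 1 0 0 ∈
      MulAction.orbit (SpecialLinearGroup (Fin 2) (ℤ√(-3))) (hermForm 0 1 0 0) := by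
    refine mem_orbit_hermForm ⟨!![0, -1; 1, 0], by simp [det_fin_two]⟩ fun v ↦ ?_
    simp [hermForm, mulVec, dotProduct, Fin.sum_univ_two]
    ring
  exact MulAction.mem_orbit_of_mem_orbit g hneg

/-- The halfspaces of hyperbolic three-space given by the orbit of the Hermitian form
`Re (v̄₀ v₁)` under `SL₂(ℤ[√-3])`, ordered by the Loewner order, are pairwise nested. -/
theorem isNestedAction_hermForm :
    IsNestedAction (SpecialLinearGroup (Fin 2) (ℤ√(-3)))
      (P := MulAction.orbit (SpecialLinearGroup (Fin 2) (ℤ√(-3))) (hermForm 0 1 0 0))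
      (fun f ↦ ⟨-f.1, neg_mem_orbit f.2⟩) (fun f ↦ f.1 ![1, 0] + f.1 ![0, 1]) where
  smul_le_smul g _ _ h := fun v ↦ h (g⁻¹ • v)
  invol f := Subtype.ext (neg_neg f.1)
  antitone h := neg_le_neg (Subtype.coe_le_coe.2 h)
  smul_compl _ _ := rfl
  nested f k := by
    obtain ⟨a, x, y, c, hf, h⟩ := exists_eq_hermForm f
    obtain ⟨a', x', y', c', hk, h'⟩ := exists_eq_hermForm k
    have := hermForm.nested h h'
    rwa [← hf, ← hk] at this
  not_le_compl {f k} h h' := by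
    obtain ⟨a, x, y, c, hf, hdisc⟩ := exists_eq_hermForm f
    rw [(by linarith : x ^ 2 + 3 * y ^ 2 - 4 * a * c = (-x) ^ 2 + 3 * (-y) ^ 2 - 4 * (-a) * (-c))]
      at hdisc
    obtain ⟨v, hv⟩ := hermForm.exists_neg hdisc
    rw [← hermForm.neg_eq, ← hf] at hv
    have h1 : f.1 v ≤ k.1 v := h v
    have h2 : f.1 v ≤ -k.1 v := h' v
    have h3 : -f.1 v < 0 := hv
    linarith
  rank_strictMono := by
    intro f k hfk
    have h0 : f.1 ![1, 0] ≤ k.1 ![1, 0] := hfk.le _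
    have h1 : f.1 ![0, 1] ≤ k.1 ![0, 1] := hfk.le _
    refine lt_of_le_of_ne (add_le_add h0 h1) fun e ↦ hfk.ne (Subtype.ext ?_)
    obtain ⟨a, x, y, c, hf, h⟩ := exists_eq_hermForm f
    obtain ⟨a', x', y', c', hk, h'⟩ := exists_eq_hermForm k
    have hle : f.1 ≤ k.1 := hfk.le
    simp only [hf, hk] at h0 h1 e hle ⊢
    simp [hermForm] at h0 h1 e
    obtain rfl : a = a' := by linarith
    obtain rfl : c = c' := by linarith
    obtain ⟨rfl, rfl⟩ := hermForm.eq_of_le hle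
    rfl

end Orbit

/-- `SL₂(ℤ[√-3])` is a nontrivial free product with amalgamation. -/
theorem SL2_Zsqrtd_neg_three_isNontrivialAmalgam :
    IsNontrivialAmalgam (Matrix.SpecialLinearGroup (Fin 2) (Zsqrtd (-3))) := by
  let := arrowAction (G := Matrix.SpecialLinearGroup (Fin 2) (ℤ√(-3)))
    (A := Fin 2 → ℤ√(-3)) (B := ℤ)
  refine isNestedAction_hermForm.isNontrivialAmalgam (o := ⟨_, MulAction.mem_orbit_self _⟩)
    (p := ⟨hermForm 1 (-1) 0 0, mem_orbit_hermForm
      ⟨!![1, -1; 1, 0], by simp [Matrix.det_fin_two]⟩ fun v ↦ ?_⟩)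
    (fun x ↦ MulAction.exists_smul_eq _ _ x) (lt_of_le_of_ne ?_ ?_)
  · simp [hermForm, Matrix.mulVec, dotProduct, Fin.sum_univ_two]
    ring
  · intro v
    change -hermForm 0 1 0 0 v ≤ hermForm 1 (-1) 0 0 v
    have := sq_nonneg (v 0).re
    have := sq_nonneg (v 0).im
    simp only [hermForm]
    linarith
  · intro e
    have := congrFun (congrArg Subtype.val e) ![1, 0]
    simp [hermForm] at this
end

section
/- Let K be any group and let H be a finite-index subgroup of the direct product SL₂(ℤ) × K. Then H is a nontrivial free product with amalgamation; that is, there exist groups A, B, C, injective group homomorphisms f : C → A and g : C → B, neither of which is surjective, and a group isomorphism between H and the amalgamated free product A ∗_C B (the pushout of f and g). -/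
universe u v w

open Monoid in
/-- Let `lift α β : A ∗ B → Q` be injective, with the same image as `θ : Γ → Q`. If a group `P` is
generated by compatible images of the preimages in `Γ` of `A` and of `B`, then it is isomorphic to
`Γ`. -/
theorem bijective_of_range_lift_eq_range {Γ Q A B P : Type*} [Group Γ] [Group Q] [Group A] [Group B]
    [Group P] (θ : Γ →* Q) (α : A →* Q) (β : B →* Q)
    (hinj : Function.Injective (Coprod.lift α β)) (hrange : (Coprod.lift α β).range = θ.range)
    (f : θ.ker →* α.range.comap θ) (g : θ.ker →* β.range.comap θ)
    (hf : ∀ n, (f n : Γ) = n) (hg : ∀ n, (g n : Γ) = n)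
    (ιA : α.range.comap θ →* P) (ιB : β.range.comap θ →* P) (ιN : θ.ker →* P)
    (ιA_f : ∀ n, ιA (f n) = ιN n) (ιB_g : ∀ n, ιB (g n) = ιN n)
    (ind : ∀ {motive : P → Prop}, (∀ a, motive (ιA a)) → (∀ b, motive (ιB b)) →
      (∀ x y, motive x → motive y → motive (x * y)) → ∀ x, motive x)
    (ψ : P →* Γ) (ψA : ∀ a, ψ (ιA a) = a) (ψB : ∀ b, ψ (ιB b) = b) :
    Function.Bijective ψ := by
  have ψN (n) : ψ (ιN n) = n := by rw [← ιA_f, ψA, hf]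
  have conj_mem (x : P) : ∀ n ∈ ιN.range, x * n * x⁻¹ ∈ ιN.range := by
    refine ind (motive := fun x ↦ ∀ n ∈ ιN.range, x * n * x⁻¹ ∈ ιN.range) ?_ ?_ ?_ x
    · intro a
      rintro _ ⟨n, rfl⟩
      refine ⟨⟨a * n * a⁻¹, θ.normal_ker.conj_mem _ n.2 _⟩, ?_⟩
      rw [← ιA_f, ← ιA_f, ← map_inv, ← map_mul, ← map_mul]
      exact congrArg ιA (Subtype.ext (by simp [hf]))
    · intro a
      rintro _ ⟨n, rfl⟩
      refine ⟨⟨a * n * a⁻¹, θ.normal_ker.conj_mem _ n.2 _⟩, ?_⟩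
      rw [← ιB_g, ← ιB_g, ← map_inv, ← map_mul, ← map_mul]
      exact congrArg ιB (Subtype.ext (by simp [hg]))
    · intro x y hx hy n hn
      simpa [mul_assoc] using hx _ (hy n hn)
  have : ιN.range.Normal := ⟨fun n hn x ↦ conj_mem x n hn⟩
  let q := QuotientGroup.mk' ιN.range
  have qA (a b : α.range.comap θ) (h : θ a = θ b) : q (ιA a) = q (ιA b) := by
    refine QuotientGroup.eq.2 ⟨⟨a⁻¹ * b, by simp [MonoidHom.mem_ker, h]⟩, ?_⟩
    rw [← ιA_f, ← map_inv ιA, ← map_mul ιA]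
    exact congrArg ιA (Subtype.ext (hf _))
  have qB (a b : β.range.comap θ) (h : θ a = θ b) : q (ιB a) = q (ιB b) := by
    refine QuotientGroup.eq.2 ⟨⟨a⁻¹ * b, by simp [MonoidHom.mem_ker, h]⟩, ?_⟩
    rw [← ιB_g, ← map_inv ιB, ← map_mul ιB]
    exact congrArg ιB (Subtype.ext (hg _))
  have lift_α (a : A) : ∃ x, θ x = α a := by
    have : α a ∈ θ.range := hrange ▸ ⟨Coprod.inl a, by simp⟩
    simpa using this
  have lift_β (b : B) : ∃ x, θ x = β b := by
    have : β b ∈ θ.range := hrange ▸ ⟨Coprod.inr b, by simp⟩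
    simpa using this
  choose sA hsA using lift_α
  choose sB hsB using lift_β
  let μA : A →* P ⧸ ιN.range := MonoidHom.mk' (fun a ↦ q (ιA ⟨sA a, a, (hsA a).symm⟩)) fun a b ↦ by
    rw [← map_mul, ← map_mul]
    exact qA _ _ (by simp [hsA])
  let μB : B →* P ⧸ ιN.range := MonoidHom.mk' (fun a ↦ q (ιB ⟨sB a, a, (hsB a).symm⟩)) fun a b ↦ by
    rw [← map_mul, ← map_mul]
    exact qB _ _ (by simp [hsB])
  let μ := Coprod.lift μA μB
  have key (x : P) : ∃ y, Coprod.lift α β y = θ (ψ x) ∧ μ y = q x := by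
    refine ind (motive := fun x ↦ ∃ y, Coprod.lift α β y = θ (ψ x) ∧ μ y = q x) ?_ ?_ ?_ x
    · intro a
      obtain ⟨b, hb⟩ := a.2
      refine ⟨Coprod.inl b, by rw [ψA, Coprod.lift_apply_inl, hb], ?_⟩
      rw [Coprod.lift_apply_inl]
      exact qA _ _ (by rw [← hb]; exact hsA b)
    · intro a
      obtain ⟨b, hb⟩ := a.2
      refine ⟨Coprod.inr b, by rw [ψB, Coprod.lift_apply_inr, hb], ?_⟩
      rw [Coprod.lift_apply_inr]
      exact qB _ _ (by rw [← hb]; exact hsB b)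
    · intro x y hx hy
      obtain ⟨x', hx, hx'⟩ := hx
      obtain ⟨y', hy, hy'⟩ := hy
      exact ⟨x' * y', by simp [hx, hy], by simp [hx', hy']⟩
  constructor
  · rw [injective_iff_map_eq_one]
    intro x hx
    obtain ⟨y, hy, hy'⟩ := key x
    have : y = 1 := hinj (by rw [hy, hx, map_one, map_one])
    rw [this, map_one] at hy'
    obtain ⟨n, rfl⟩ := (QuotientGroup.eq_one_iff x).1 hy'.symm
    have hn : n = 1 := Subtype.ext (by rw [← ψN, hx]; rfl)
    rw [hn, map_one]
  · have hlift (y : Coprod A B) : ∃ x : P, θ (ψ x) = Coprod.lift α β y := by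
      induction y using Coprod.induction_on with
      | inl a => exact ⟨ιA ⟨sA a, a, (hsA a).symm⟩, by simp [ψA, hsA]⟩
      | inr b => exact ⟨ιB ⟨sB b, b, (hsB b).symm⟩, by simp [ψB, hsB]⟩
      | mul x y hx hy =>
        obtain ⟨x', hx⟩ := hx
        obtain ⟨y', hy⟩ := hy
        exact ⟨x' * y', by simp [hx, hy]⟩
    intro γ
    have : θ γ ∈ (Coprod.lift α β).range := hrange ▸ ⟨γ, rfl⟩
    obtain ⟨y, hy⟩ := this
    obtain ⟨x, hx⟩ := hlift y
    refine ⟨x * ιN ⟨(ψ x)⁻¹ * γ, by simp [MonoidHom.mem_ker, hx, hy]⟩, ?_⟩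
    rw [map_mul, ψN]
    simp

open Monoid in
/-- If a homomorphism out of `Γ` has the same image as an injective homomorphism out of the free
product `A ∗ B` of two nontrivial groups, then `Γ` is a nontrivial amalgam: the factors are the
preimages of `A` and `B`, and the amalgamated subgroup is the kernel. -/
theorem isNontrivialAmalgam_of_range_eq_range_lift {Γ : Type v} [Group Γ] {Q A B : Type*} [Group Q]
    [Group A] [Group B] [Nontrivial A] [Nontrivial B] (θ : Γ →* Q) (α : A →* Q) (β : B →* Q)
    (hinj : Function.Injective (Coprod.lift α β)) (hrange : (Coprod.lift α β).range = θ.range) :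
    IsNontrivialAmalgam Γ := by
  have hα : Function.Injective α := fun a b h ↦ Coprod.inl_injective (hinj (by simpa using h))
  have hβ : Function.Injective β := fun a b h ↦ Coprod.inr_injective (hinj (by simpa using h))
  have lift_α (a : A) : ∃ x, θ x = α a := by
    have : α a ∈ θ.range := hrange ▸ ⟨Coprod.inl a, by simp⟩
    simpa using this
  have lift_β (b : B) : ∃ x, θ x = β b := by
    have : β b ∈ θ.range := hrange ▸ ⟨Coprod.inr b, by simp⟩
    simpa using this
  let A' := α.range.comap θ
  let B' := β.range.comap θ
  have hA : θ.ker ≤ A' := fun x hx ↦ ⟨1, by rw [map_one, MonoidHom.mem_ker.1 hx]⟩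
  have hB : θ.ker ≤ B' := fun x hx ↦ ⟨1, by rw [map_one, MonoidHom.mem_ker.1 hx]⟩
  let f := Subgroup.inclusion hA
  let g := Subgroup.inclusion hB
  refine ⟨A', B', θ.ker, inferInstance, inferInstance, inferInstance, f, g,
    Subgroup.inclusion_injective hA, Subgroup.inclusion_injective hB, ?_, ?_, ?_⟩
  · intro hs
    obtain ⟨a, ha⟩ := exists_ne (1 : A)
    obtain ⟨x, hx⟩ := lift_α a
    obtain ⟨y, hy⟩ := hs ⟨x, a, hx.symm⟩
    have : (y : Γ) = x := congrArg Subtype.val hy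
    exact ha (hα (by rw [← hx, ← this, map_one]; exact y.2))
  · intro hs
    obtain ⟨a, ha⟩ := exists_ne (1 : B)
    obtain ⟨x, hx⟩ := lift_β a
    obtain ⟨y, hy⟩ := hs ⟨x, a, hx.symm⟩
    have : (y : Γ) = x := congrArg Subtype.val hy
    exact ha (hβ (by rw [← hx, ← this, map_one]; exact y.2))
  let F : ∀ b, boolFam A' B' b →* Γ := fun b ↦ match b with
    | true => A'.subtype
    | false => B'.subtype
  have hF (b) : (F b).comp (boolHoms f g b) = θ.ker.subtype := by cases b <;> rfl
  have hbij := bijective_of_range_lift_eq_range θ α β hinj hrange f g (fun _ ↦ rfl) (fun _ ↦ rfl)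
    (PushoutI.of (φ := boolHoms f g) true) (PushoutI.of (φ := boolHoms f g) false)
    (PushoutI.base (boolHoms f g)) (PushoutI.of_apply_eq_base (boolHoms f g) true)
    (PushoutI.of_apply_eq_base (boolHoms f g) false)
    (fun {motive} hA hB mul x ↦ by
      induction x using PushoutI.induction_on with
      | of i x =>
        cases i with
        | true => exact hA x
        | false => exact hB x
      | base n => exact PushoutI.of_apply_eq_base (boolHoms f g) true n ▸ hA (f n)
      | mul x y hx hy => exact mul x y hx hy)
    (PushoutI.lift F θ.ker.subtype hF) (PushoutI.lift_of F θ.ker.subtype hF (i := true))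
    (PushoutI.lift_of F θ.ker.subtype hF (i := false))
  exact ⟨(MulEquiv.ofBijective _ hbij).symm⟩

namespace FreeProduct

open Monoid CoprodI

variable {M : Bool → Type*} [∀ i, Group (M i)] (H : Subgroup (CoprodI M))

/-- The half-edges of the Bass–Serre tree of the free product `M false ∗ M true` are the pairs
`(g, i)`, the edges being the elements `g` of the free product. Two half-edges are adjacent if they
share a vertex, or if they form an edge which is not in the orbit `H` of the base edge. -/
inductive HalfEdgeAdj : CoprodI M × Bool → CoprodI M × Bool → Prop
  | rotate {i : Bool} (m : M i) (g : CoprodI M) : HalfEdgeAdj (g, i) (of m * g, i)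
  | flip {g : CoprodI M} (hg : g ∉ H) (i : Bool) : HalfEdgeAdj (g, i) (g, !i)

/-- Two half-edges are connected if they lie in the same component of the Bass–Serre tree with the
edges in `H` cut open. -/
def Conn : CoprodI M × Bool → CoprodI M × Bool → Prop := Relation.ReflTransGen (HalfEdgeAdj H)

variable {H}

namespace Conn

theorem symm {a b : CoprodI M × Bool} (h : Conn H a b) : Conn H b a := by
  have : Std.Symm (HalfEdgeAdj H) := ⟨?_⟩
  · exact Relation.ReflTransGen.stdSymm.symm _ _ h
  rintro _ _ (⟨m, g⟩ | ⟨hg, i⟩)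
  · simpa using HalfEdgeAdj.rotate (H := H) m⁻¹ (of m * g)
  · simpa using HalfEdgeAdj.flip hg (!i)

theorem trans {a b c : CoprodI M × Bool} (h : Conn H a b) (h' : Conn H b c) : Conn H a c :=
  Relation.ReflTransGen.trans h h'

theorem rotate {i : Bool} {a : CoprodI M × Bool} {g : CoprodI M} (h : Conn H a (g, i)) (m : M i) :
    Conn H a (of m * g, i) :=
  Relation.ReflTransGen.tail h (.rotate m g)

theorem flip {i : Bool} {a : CoprodI M × Bool} {g : CoprodI M} (h : Conn H a (g, i))
    (hg : g ∉ H) : Conn H a (g, !i) :=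
  Relation.ReflTransGen.tail h (.flip hg i)

theorem mul_right {g g' h : CoprodI M} {i j : Bool} (hc : Conn H (g, i) (g', j)) (hh : h ∈ H) :
    Conn H (g * h, i) (g' * h, j) := by
  refine Relation.ReflTransGen.lift (fun a : CoprodI M × Bool ↦ (a.1 * h, a.2)) ?_ _ _ hc
  rintro _ _ (⟨m, g⟩ | ⟨hg, i⟩)
  · simpa [Function.onFun, mul_assoc] using HalfEdgeAdj.rotate (H := H) m (g * h)
  · exact .flip (by rwa [Subgroup.mul_mem_cancel_right H hh]) i

end Conn

variable (H) in
/-- The stabilizer in `H` of the component of the half-edge `(1, i)`. -/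
def side (i : Bool) : Subgroup (CoprodI M) where
  carrier := {h | h ∈ H ∧ Conn H (1, i) (h, i)}
  one_mem' := ⟨H.one_mem, .refl⟩
  mul_mem' := fun {a b} ha hb ↦
    ⟨H.mul_mem ha.1 hb.1, hb.2.trans (by simpa using ha.2.mul_right hb.1)⟩
  inv_mem' := fun {a} ha ↦
    ⟨H.inv_mem ha.1, by simpa using (ha.2.mul_right (H.inv_mem ha.1)).symm⟩

theorem mem_side_of_conn {g g' : CoprodI M} {i k : Bool} (hgg' : g⁻¹ * g' ∈ H)
    (h : Conn H (1, k) (g, i)) (h' : Conn H (1, k) (g', i)) : g⁻¹ * g' ∈ side H k :=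
  ⟨hgg', h'.trans (by simpa using (h.mul_right hgg').symm)⟩

/-- Every half-edge is in the `H`-orbit of one that is connected to one of the two halves of the
base edge. -/
theorem exists_conn (g : CoprodI M) (i : Bool) :
    ∃ k, ∃ h ∈ H, Conn H (1, k) (g * h, i) := by
  induction g using CoprodI.induction_left generalizing i with
  | one => exact ⟨i, 1, H.one_mem, by simpa using .refl⟩
  | @mul j m g ih =>
    obtain ⟨k, h, hh, hc⟩ := ih j
    have hc' := hc.rotate m
    rw [← mul_assoc] at hc'
    obtain rfl | rfl : i = j ∨ i = !j := by cases i <;> cases j <;> simp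
    · exact ⟨k, h, hh, hc'⟩
    by_cases hm : of m * g * h ∈ H
    · have : of m * g ∈ H := (Subgroup.mul_mem_cancel_right H hh).1 hm
      exact ⟨_, _, H.inv_mem this, by simpa using .refl⟩
    · exact ⟨k, h, hh, hc'.flip hm⟩

variable (H) in
/-- The coset of the base edge. -/
abbrev baseCoset : CoprodI M ⧸ H := QuotientGroup.mk 1

/-- Data expressing that the homomorphism `π` from `L` to a free product presents its subgroup `H`
as the fundamental group of the graph of groups obtained by collapsing all edges outside `H`. The
component of the half-edge `ρ x i`, a representative of the coset `x`, is that of `(1, κ x i)`;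
`lam` is a section of `π` over the stabilizers of components, and `δ` records the element of `L`
picked up when crossing an edge. -/
structure EdgeSplitting (H : Subgroup (CoprodI M)) (L : Type*) [Group L] where
  π : L →* CoprodI M
  lam : Bool → CoprodI M → L
  κ : CoprodI M ⧸ H → Bool → Bool
  ρ : CoprodI M ⧸ H → Bool → CoprodI M
  δ : CoprodI M ⧸ H → Bool → L
  lam_mul : ∀ x i, ∀ a ∈ side H (κ x i), ∀ b ∈ side H (κ x i),
    lam (κ x i) (a * b) = lam (κ x i) a * lam (κ x i) b
  π_lam : ∀ x i, ∀ a ∈ side H (κ x i), π (lam (κ x i) a) = a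
  mk_ρ : ∀ x i, (ρ x i : CoprodI M ⧸ H) = x
  conn_ρ : ∀ x i, Conn H (1, κ x i) (ρ x i, i)
  κ_smul : ∀ x i (m : M i), κ ((of m : CoprodI M) • x) i = κ x i
  κ_flip : ∀ x i, x ≠ (baseCoset H) → κ x (!i) = κ x i
  ρ_flip : ∀ x i, x ≠ (baseCoset H) → ρ x (!i) = ρ x i
  δ_ne : ∀ x i, x ≠ (baseCoset H) → δ x i = 1
  ρ_one : ∀ i, ρ (baseCoset H) i = π (δ (baseCoset H) i)
  κ_κ : ∀ i, κ (baseCoset H) (κ (baseCoset H) i) = κ (baseCoset H) i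
  δ_κ : ∀ i, δ (baseCoset H) (κ (baseCoset H) i) = 1
  closure_eq : Subgroup.closure
    ({l | ∃ i, ∃ h ∈ side H (κ (baseCoset H) i), l = lam (κ (baseCoset H) i) h} ∪
      Set.range (δ (baseCoset H))) = ⊤

namespace EdgeSplitting

variable {L : Type*} [Group L] (D : EdgeSplitting H L)

/-- The generator of the cocycle of `D` given by `m` at the coset `x`. -/
def step {i : Bool} (m : M i) (x : CoprodI M ⧸ H) : CoprodI M :=
  (D.ρ ((of m : CoprodI M) • x) i)⁻¹ * (of m * D.ρ x i)

theorem step_mem {i : Bool} (m : M i) (x : CoprodI M ⧸ H) : D.step m x ∈ side H (D.κ x i) := by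
  refine mem_side_of_conn ?_ (D.κ_smul x i m ▸ D.conn_ρ _ i) ((D.conn_ρ x i).rotate m)
  rw [← QuotientGroup.eq, D.mk_ρ]
  conv_lhs => rw [← D.mk_ρ x i]
  rfl

theorem lam_one (x : CoprodI M ⧸ H) (i : Bool) : D.lam (D.κ x i) 1 = 1 := by
  have := D.lam_mul x i 1 (one_mem _) 1 (one_mem _)
  simpa using this

/-- The action of a factor on the cosets of `H` times `L`. -/
def factorHom (i : Bool) : M i →* Equiv.Perm ((CoprodI M ⧸ H) × L) :=
  MonoidHom.toHomPerm
    { toFun := fun m e ↦ ((of m : CoprodI M) • e.1,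
        D.δ ((of m : CoprodI M) • e.1) i * D.lam (D.κ e.1 i) (D.step m e.1) *
          (D.δ e.1 i)⁻¹ * e.2)
      map_one' := by
        funext e
        simp [step, D.lam_one, Function.End.one_def]
      map_mul' := fun m n ↦ by
        funext e
        have h1 := D.step_mem n e.1
        have h2 := D.step_mem m ((of n : CoprodI M) • e.1)
        rw [D.κ_smul] at h2
        have h3 : D.step (m * n) e.1 = D.step m ((of n : CoprodI M) • e.1) * D.step n e.1 := by
          simp [step, mul_smul, mul_assoc]
        simp only [map_mul, mul_smul, h3, D.lam_mul _ _ _ h2 _ h1]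
        refine Eq.trans ?_ (Function.comp_apply (x := e)).symm
        simp [D.κ_smul, mul_assoc] }

/-- The action of the free product on the cosets of `H` times `L`. -/
def hom : CoprodI M →* Equiv.Perm ((CoprodI M ⧸ H) × L) := CoprodI.lift D.factorHom

theorem hom_of {i : Bool} (m : M i) (e : (CoprodI M ⧸ H) × L) :
    D.hom (of m) e = ((of m : CoprodI M) • e.1,
      D.δ ((of m : CoprodI M) • e.1) i * D.lam (D.κ e.1 i) (D.step m e.1) *
        (D.δ e.1 i)⁻¹ * e.2) := by
  rw [hom, CoprodI.lift_of]
  rfl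

theorem hom_fst (g : CoprodI M) (e : (CoprodI M ⧸ H) × L) : (D.hom g e).1 = g • e.1 := by
  induction g using CoprodI.induction_left with
  | one => simp
  | mul m g ih => rw [map_mul, Equiv.Perm.mul_apply, hom_of, ih, mul_smul]

theorem hom_mul_right (g : CoprodI M) (e : (CoprodI M ⧸ H) × L) (l : L) :
    D.hom g (e.1, e.2 * l) = ((D.hom g e).1, (D.hom g e).2 * l) := by
  induction g using CoprodI.induction_left with
  | one => simp
  | mul m g ih => simp only [map_mul, Equiv.Perm.mul_apply, ih, hom_of, mul_assoc]

theorem ρ_mul_δ_inv (x : CoprodI M ⧸ H) (i : Bool) :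
    D.ρ x i * (D.π (D.δ x i))⁻¹ = D.ρ x true * (D.π (D.δ x true))⁻¹ := by
  by_cases hx : x = (baseCoset H)
  · subst hx
    simp [D.ρ_one]
  · cases i with
    | true => rfl
    | false =>
      rw [D.δ_ne x _ hx, D.δ_ne x _ hx]
      simpa using D.ρ_flip x true hx

/-- The projection from the constructed action to the free product acting on itself. -/
def toCoprodI (e : (CoprodI M ⧸ H) × L) : CoprodI M :=
  D.ρ e.1 true * (D.π (D.δ e.1 true))⁻¹ * D.π e.2

theorem toCoprodI_hom (g : CoprodI M) (e : (CoprodI M ⧸ H) × L) :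
    D.toCoprodI (D.hom g e) = g * D.toCoprodI e := by
  induction g using CoprodI.induction_left with
  | one => simp
  | @mul i m g ih =>
    rw [map_mul, Equiv.Perm.mul_apply, mul_assoc, ← ih]
    generalize D.hom g e = e
    rw [hom_of, toCoprodI, toCoprodI, ← D.ρ_mul_δ_inv _ i, ← D.ρ_mul_δ_inv _ i]
    simp only [map_mul, map_inv, D.π_lam _ _ _ (D.step_mem m e.1)]
    simp [step, mul_assoc]

theorem hom_of_conn {k i : Bool} {g : CoprodI M} (hk : D.κ (baseCoset H) k = k)
    (hδ : D.δ (baseCoset H) k = 1) (hc : Conn H (1, k) (g, i)) :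
    D.κ (QuotientGroup.mk g) i = k ∧ D.hom g ((baseCoset H), 1) =
      (QuotientGroup.mk g,
        D.δ (QuotientGroup.mk g) i * D.lam k ((D.ρ (QuotientGroup.mk g) i)⁻¹ * g)) := by
  suffices ∀ a, Conn H (1, k) a → D.κ (QuotientGroup.mk a.1) a.2 = k ∧
      D.hom a.1 ((baseCoset H), 1) =
        (QuotientGroup.mk a.1, D.δ (QuotientGroup.mk a.1) a.2 *
          D.lam k ((D.ρ (QuotientGroup.mk a.1) a.2)⁻¹ * a.1)) from this _ hc
  intro a ha
  induction ha with
  | refl =>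
    refine ⟨hk, ?_⟩
    have := D.lam_one (baseCoset H) k
    rw [hk] at this
    simp [D.ρ_one, hδ, this]
  | @tail b c hb hbc ih =>
    obtain ⟨ih1, ih2⟩ := ih
    cases hbc with
    | flip hg i =>
      rename_i g
      have hne : QuotientGroup.mk g ≠ baseCoset H := fun h ↦ hg (by
        simpa using QuotientGroup.eq.1 h.symm)
      exact ⟨(D.κ_flip _ i hne).trans ih1, by
        simpa [D.δ_ne _ _ hne, D.ρ_flip _ i hne] using ih2⟩
    | rotate m g =>
      rename_i i
      refine ⟨(D.κ_smul (QuotientGroup.mk g) i m).trans ih1, ?_⟩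
      have h1 := D.step_mem m (QuotientGroup.mk g)
      have h2 : (D.ρ (QuotientGroup.mk g) i)⁻¹ * g ∈ side H k := by
        refine mem_side_of_conn ?_ (by simpa only [ih1] using D.conn_ρ (QuotientGroup.mk g) i) hb
        rw [← QuotientGroup.eq, D.mk_ρ]
      have h3 := D.lam_mul (QuotientGroup.mk g) i _ h1
      rw [ih1] at h1 h3
      have h4 : (D.ρ (QuotientGroup.mk (of m * g)) i)⁻¹ * (of m * g) =
          D.step m (QuotientGroup.mk g) * ((D.ρ (QuotientGroup.mk g) i)⁻¹ * g) := by
        simp [step, mul_assoc]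
      rw [map_mul, Equiv.Perm.mul_apply, ih2, hom_of]
      simp only [ih1]
      rw [h4, h3 _ h2]
      simp [mul_assoc]

theorem range_π : D.π.range = H := by
  apply le_antisymm
  · rw [MonoidHom.range_eq_map, ← D.closure_eq, MonoidHom.map_closure, Subgroup.closure_le]
    rintro _ ⟨l, ⟨i, h, hh, rfl⟩ | ⟨i, rfl⟩, rfl⟩
    · rw [D.π_lam _ _ _ hh]
      exact hh.1
    · rw [← D.ρ_one]
      simpa using QuotientGroup.eq.1 (D.mk_ρ (baseCoset H) i).symm
  · intro h hh
    refine ⟨(D.hom h (baseCoset H, 1)).2, ?_⟩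
    have h1 := D.toCoprodI_hom h (baseCoset H, 1)
    have h2 : (D.hom h (baseCoset H, 1)).1 = baseCoset H := by
      rw [hom_fst]
      exact QuotientGroup.eq.2 (by simpa using hh)
    simpa [toCoprodI, h2, D.ρ_one] using h1

theorem hom_π (l : L) : D.hom (D.π l) (baseCoset H, 1) = (baseCoset H, l) := by
  have hl : l ∈ (⊤ : Subgroup L) := Subgroup.mem_top l
  rw [← D.closure_eq] at hl
  induction hl using Subgroup.closure_induction with
  | mem l hl =>
    obtain ⟨i, h, hh, rfl⟩ | ⟨i, rfl⟩ := hl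
    · rw [D.π_lam _ _ _ hh, (D.hom_of_conn (D.κ_κ i) (D.δ_κ i) hh.2).2]
      have : QuotientGroup.mk h = baseCoset H := QuotientGroup.eq.2 (by simpa using hh.1)
      simp [this, D.ρ_one, D.δ_κ]
    · have h1 := D.conn_ρ (baseCoset H) i
      rw [← D.ρ_one, (D.hom_of_conn (D.κ_κ i) (D.δ_κ i) h1).2, D.mk_ρ]
      simp [D.lam_one]
  | one => simp
  | mul a b _ _ ha hb =>
    rw [map_mul, map_mul, Equiv.Perm.mul_apply, hb]
    simpa [ha] using D.hom_mul_right (D.π a) (baseCoset H, 1) b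
  | inv a _ ha =>
    rw [map_inv, map_inv, Equiv.Perm.inv_eq_iff_eq]
    simpa [ha] using (D.hom_mul_right (D.π a) (baseCoset H, 1) a⁻¹).symm

theorem π_injective : Function.Injective D.π := by
  intro a b hab
  have := D.hom_π a
  rw [hab, D.hom_π] at this
  exact (congrArg Prod.snd this).symm

end EdgeSplitting

/-- Every edge is in the `H`-orbit of one whose positive half is connected to the base edge. -/
theorem exists_rep (H : Subgroup (CoprodI M)) (x : CoprodI M ⧸ H) :
    ∃ k, ∃ g : CoprodI M, (g : CoprodI M ⧸ H) = x ∧ Conn H (1, k) (g, true) := by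
  induction x using QuotientGroup.induction_on with
  | H g =>
    obtain ⟨k, h, hh, hc⟩ := exists_conn (H := H) g true
    exact ⟨k, g * h, QuotientGroup.mk_mul_of_mem g hh, hc⟩

theorem conn_of_ne {x : CoprodI M ⧸ H} (hx : x ≠ baseCoset H) {k : Bool} {g : CoprodI M}
    (hg : (g : CoprodI M ⧸ H) = x) (hc : Conn H (1, k) (g, true)) (i : Bool) :
    Conn H (1, k) (g, i) := by
  cases i with
  | true => exact hc
  | false => exact hc.flip (i := true) fun h ↦ hx (hg ▸ QuotientGroup.eq.2 (by simpa using h))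

/-- Connectedness determines the half of the base edge if the halves are not connected by `H`. -/
theorem eq_of_conn (hE : ¬ ∃ u ∈ H, Conn H (1, true) (u, false)) {k k' i : Bool}
    {g g' : CoprodI M} (hgg' : (g : CoprodI M ⧸ H) = g') (h : Conn H (1, k) (g, i))
    (h' : Conn H (1, k') (g', i)) : k = k' := by
  have hu := QuotientGroup.eq.1 hgg'
  have hc : Conn H (1, k') (g⁻¹ * g', k) := h'.trans (by simpa using (h.mul_right hu).symm)
  by_contra hne
  obtain ⟨rfl, rfl⟩ | ⟨rfl, rfl⟩ : (k = true ∧ k' = false) ∨ (k = false ∧ k' = true) := by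
    cases k <;> cases k' <;> simp at hne ⊢
  · exact hE ⟨_, H.inv_mem hu, by simpa using (hc.mul_right (H.inv_mem hu)).symm⟩
  · exact hE ⟨_, hu, hc⟩

open Classical in
/-- The extension by `1` of a homomorphism on a subgroup to a total function. -/
noncomputable def extendByOne {G L : Type*} [Group G] [Group L] {S : Subgroup G} (f : S →* L)
    (g : G) : L :=
  if h : g ∈ S then f ⟨g, h⟩ else 1

theorem extendByOne_of_mem {G L : Type*} [Group G] [Group L] {S : Subgroup G} (f : S →* L) {g : G}
    (h : g ∈ S) :
    extendByOne f g = f ⟨g, h⟩ := dif_pos h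

open Classical in
/-- If `H` does not connect the halves of the base edge, then `H` is the free product of the
stabilizers of the two components adjacent to that edge. -/
theorem exists_edgeSplitting_coprod (hE : ¬ ∃ u ∈ H, Conn H (1, true) (u, false)) :
    ∃ D : EdgeSplitting H (Coprod (side H true) (side H false)),
      D.π = Coprod.lift (side H true).subtype (side H false).subtype := by
  choose kk r hr hc using exists_rep H
  let κ (x : CoprodI M ⧸ H) (i : Bool) : Bool := if x = baseCoset H then i else kk x
  let ρ (x : CoprodI M ⧸ H) (i : Bool) : CoprodI M := if x = baseCoset H then 1 else r x
  have hκ (i) : κ (baseCoset H) i = i := if_pos rfl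
  have mk_ρ (x i) : (ρ x i : CoprodI M ⧸ H) = x := by
    by_cases hx : x = baseCoset H
    · subst hx
      simp [ρ]
    · simp [ρ, hx, hr]
  have conn_ρ (x i) : Conn H (1, κ x i) (ρ x i, i) := by
    by_cases hx : x = baseCoset H
    · subst hx
      simpa [ρ, κ] using .refl
    · simpa [ρ, κ, hx] using conn_of_ne hx (hr x) (hc x) i
  let lam (i : Bool) : CoprodI M → Coprod (side H true) (side H false) :=
    match i with
    | true => extendByOne Coprod.inl
    | false => extendByOne Coprod.inr
  refine ⟨{
    π := Coprod.lift (side H true).subtype (side H false).subtype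
    lam := lam
    κ := κ
    ρ := ρ
    δ := fun _ _ ↦ 1
    lam_mul := ?_
    π_lam := ?_
    mk_ρ := mk_ρ
    conn_ρ := conn_ρ
    κ_smul := ?_
    κ_flip := fun x i hx ↦ by simp [κ, hx]
    ρ_flip := fun x i hx ↦ by simp [ρ]
    δ_ne := fun x i hx ↦ rfl
    ρ_one := fun i ↦ by simp [ρ]
    κ_κ := fun i ↦ by simp [κ]
    δ_κ := fun i ↦ rfl
    closure_eq := ?_ }, rfl⟩
  · intro x i a ha b hb
    generalize κ x i = k at *
    cases k <;> simp only [lam] <;>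
      rw [extendByOne_of_mem _ ha, extendByOne_of_mem _ hb, extendByOne_of_mem _ (mul_mem ha hb),
        ← map_mul] <;> rfl
  · intro x i a ha
    generalize κ x i = k at *
    cases k <;> simp [lam, extendByOne_of_mem _ ha]
  · intro x i m
    refine eq_of_conn hE ?_ (conn_ρ _ i) ((conn_ρ x i).rotate m)
    rw [mk_ρ _ i]
    conv_lhs => rw [← mk_ρ x i]
    rfl
  · rw [eq_top_iff]
    intro y _
    induction y using Coprod.induction_on with
    | inl a =>
      exact Subgroup.subset_closure (.inl ⟨true, a, by simp [hκ], by
        simp [hκ, lam, extendByOne_of_mem _ a.2]⟩)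
    | inr a =>
      exact Subgroup.subset_closure (.inl ⟨false, a, by simp [hκ], by
        simp [hκ, lam, extendByOne_of_mem _ a.2]⟩)
    | mul x y hx hy => exact mul_mem (hx trivial) (hy trivial)

open Classical in
/-- If `u ∈ H` connects the halves of the base edge, then `H` is the free product of the stabilizer
of a component and the infinite cyclic group generated by `u`. -/
theorem exists_edgeSplitting_zpowers {u : CoprodI M} (hu : u ∈ H)
    (huc : Conn H (1, true) (u, false)) :
    ∃ D : EdgeSplitting H (Coprod (side H true) (Multiplicative ℤ)),
      D.π = Coprod.lift (side H true).subtype (zpowersHom _ u) := by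
  have hrep (x : CoprodI M ⧸ H) :
      ∃ g : CoprodI M, (g : CoprodI M ⧸ H) = x ∧ Conn H (1, true) (g, true) := by
    obtain ⟨k, g, hg, hc⟩ := exists_rep H x
    cases k with
    | true => exact ⟨g, hg, hc⟩
    | false =>
      exact ⟨g * u, (QuotientGroup.mk_mul_of_mem g hu).trans hg,
        huc.trans (by simpa using hc.mul_right hu)⟩
  choose r hr hc using hrep
  let ρ (x : CoprodI M ⧸ H) (i : Bool) : CoprodI M :=
    if x = baseCoset H then (if i then 1 else u) else r x
  let δ (x : CoprodI M ⧸ H) (i : Bool) : Coprod (side H true) (Multiplicative ℤ) :=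
    if x = baseCoset H then (if i then 1 else Coprod.inr (.ofAdd 1)) else 1
  have mk_ρ (x i) : (ρ x i : CoprodI M ⧸ H) = x := by
    by_cases hx : x = baseCoset H
    · subst hx
      cases i <;> simp [ρ, QuotientGroup.eq, hu]
    · simp [ρ, hx, hr]
  have conn_ρ (x i) : Conn H (1, true) (ρ x i, i) := by
    by_cases hx : x = baseCoset H
    · subst hx
      cases i with
      | true => simpa [ρ] using .refl
      | false => simpa [ρ] using huc
    · simpa [ρ, hx] using conn_of_ne hx (hr x) (hc x) i
  refine ⟨{
    π := Coprod.lift (side H true).subtype (zpowersHom _ u)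
    lam := fun _ ↦ extendByOne Coprod.inl
    κ := fun _ _ ↦ true
    ρ := ρ
    δ := δ
    lam_mul := ?_
    π_lam := ?_
    mk_ρ := mk_ρ
    conn_ρ := conn_ρ
    κ_smul := fun x i m ↦ rfl
    κ_flip := fun x i hx ↦ rfl
    ρ_flip := fun x i hx ↦ by simp [ρ, hx]
    δ_ne := fun x i hx ↦ by simp [δ, hx]
    ρ_one := fun i ↦ by cases i <;> simp [ρ, δ]
    κ_κ := fun i ↦ rfl
    δ_κ := fun i ↦ by simp [δ]
    closure_eq := ?_ }, rfl⟩
  · intro x i a ha b hb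
    rw [extendByOne_of_mem _ ha, extendByOne_of_mem _ hb, extendByOne_of_mem _ (mul_mem ha hb),
      ← map_mul]
    rfl
  · intro x i a ha
    simp [extendByOne_of_mem _ ha]
  · rw [eq_top_iff]
    intro y _
    induction y using Coprod.induction_on with
    | inl a =>
      exact Subgroup.subset_closure (.inl ⟨true, a, a.2, by simp [extendByOne_of_mem _ a.2]⟩)
    | inr n =>
      have : n = Multiplicative.ofAdd 1 ^ n.toAdd := by
        rw [← ofAdd_zsmul]; simp
      rw [this, map_zpow]
      exact zpow_mem (Subgroup.subset_closure (.inr ⟨false, by simp [δ]⟩)) _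
    | mul x y hx hy => exact mul_mem (hx trivial) (hy trivial)

/-- A component adjacent to the base edge has nontrivial stabilizer: otherwise, walking along the
axis of `b a` would never meet an edge in `H`, which contradicts the finiteness of its index. -/
theorem side_ne_bot [H.FiniteIndex] (hE : ¬ ∃ u ∈ H, Conn H (1, true) (u, false)) {i : Bool}
    (a : M i) (b : M !i) (ha : a ≠ 1) (hb : ¬ IsOfFinOrder (of b * of a : CoprodI M))
    (ha' : IsOfFinOrder a) : side H i ≠ ⊥ := by
  intro hbot
  set P : CoprodI M := of a
  set Q : CoprodI M := of b
  have hE' (u) (hu : u ∈ H) (hc : Conn H (1, i) (u, !i)) : False := by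
    have := eq_of_conn hE (g := u) (g' := 1) (QuotientGroup.eq.2 (by simpa using hu)) hc .refl
    simp at this
  have hside (h) (hh : h ∈ H) (hc : Conn H (1, i) (h, i)) : h = 1 := by
    have : h ∈ side H i := ⟨hh, hc⟩
    simpa [hbot] using this
  have hP (n : ℕ) : P * (Q * P) ^ n ≠ 1 := by
    intro h
    have hn : (Q * P) ^ n = P⁻¹ := eq_inv_of_mul_eq_one_right h
    have hfin : IsOfFinOrder ((Q * P) ^ n) := by
      rw [hn]; exact (MonoidHom.isOfFinOrder of ha').inv
    rcases Nat.eq_zero_or_pos n with rfl | hpos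
    · exact ha (of_injective i (by simpa using h))
    · exact hb (hfin.of_pow hpos.ne')
  have walk (n : ℕ) : Conn H (1, i) (P * (Q * P) ^ n, i) := by
    induction n with
    | zero =>
      rw [pow_zero]
      exact Conn.rotate .refl a
    | succ n ih =>
      have h1 : P * (Q * P) ^ n ∉ H := fun h ↦ hP n (hside _ h ih)
      have h2 := (ih.flip h1).rotate b
      have h3 : Q * (P * (Q * P) ^ n) ∉ H := fun h ↦ hE' _ h h2
      have h4 := h2.flip h3
      rw [Bool.not_not] at h4
      have h5 := h4.rotate a
      rwa [pow_succ', mul_assoc Q]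
  obtain ⟨n, hn, hmem⟩ : ∃ n, 0 < n ∧ (Q * P) ^ n ∈ H := by
    obtain ⟨n, hn, -, h⟩ :=
      H.exists_pow_mem_of_index_ne_zero Subgroup.FiniteIndex.index_ne_zero (Q * P)
    exact ⟨n, hn, h⟩
  obtain ⟨n, rfl⟩ := Nat.exists_eq_succ_of_ne_zero hn.ne'
  have h1 : P * (Q * P) ^ n ∉ H := fun h ↦ hP n (hside _ h (walk n))
  have h2 := ((walk n).flip h1).rotate b
  refine hE' _ hmem ?_
  rwa [pow_succ', mul_assoc Q]

/-- A group is a nontrivial amalgam if it maps onto a noncommutative subgroup of finite index in the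
free product of two nontrivial groups. -/
theorem isNontrivialAmalgam_of_finiteIndex {Γ : Type v} [Group Γ] (θ : Γ →* CoprodI M)
    [θ.range.FiniteIndex] (a : M true) (b : M false) (ha : a ≠ 1) (hb : b ≠ 1)
    (ha' : IsOfFinOrder a) (hb' : IsOfFinOrder b)
    (hab : ¬ IsOfFinOrder (of a * of b : CoprodI M))
    (hcomm : ∃ x ∈ θ.range, ∃ y ∈ θ.range, x * y ≠ y * x) : IsNontrivialAmalgam Γ := by
  by_cases hE : ∃ u ∈ θ.range, Conn θ.range (1, true) (u, false)
  · obtain ⟨u, hu, huc⟩ := hE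
    obtain ⟨D, hD⟩ := exists_edgeSplitting_zpowers hu huc
    have hrange := D.range_π
    have hinj := D.π_injective
    rw [hD] at hrange hinj
    have : Nontrivial (side θ.range true) := by
      rw [Subgroup.nontrivial_iff_ne_bot]
      intro hbot
      obtain ⟨x, hx, y, hy, hxy⟩ := hcomm
      have hu : θ.range ≤ Subgroup.zpowers u := by
        rw [← hrange, Coprod.range_lift, hbot]
        refine sup_le (by simp) ?_
        rintro _ ⟨n, rfl⟩
        exact ⟨n.toAdd, rfl⟩
      obtain ⟨m, rfl⟩ := hu hx
      obtain ⟨n, rfl⟩ := hu hy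
      exact hxy (by simp only [← zpow_add, add_comm])
    exact isNontrivialAmalgam_of_range_eq_range_lift θ _ _ hinj hrange
  · obtain ⟨D, hD⟩ := exists_edgeSplitting_coprod hE
    have hrange := D.range_π
    have hinj := D.π_injective
    rw [hD] at hrange hinj
    have hba : ¬ IsOfFinOrder (of b * of a : CoprodI M) := fun h ↦
      hab ((isConj_iff.2 ⟨of a, by simp [mul_assoc]⟩ : IsConj _ _).isOfFinOrder h)
    have := (Subgroup.nontrivial_iff_ne_bot _).2 (side_ne_bot hE a b ha hba ha')
    have := (Subgroup.nontrivial_iff_ne_bot _).2 (side_ne_bot hE b a hb hab hb')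
    exact isNontrivialAmalgam_of_range_eq_range_lift θ _ _ hinj hrange

end FreeProduct

namespace SL2Z

open Monoid CoprodI ModularGroup UpperHalfPlane MatrixGroups

/-- The generators of order two and three of `PSL₂(ℤ)`, as permutations of the upper half-plane. -/
noncomputable def torsionGen (b : Bool) : Equiv.Perm ℍ :=
  MulAction.toPermHom SL(2, ℤ) ℍ (if b then S else S * T)

theorem toPermHom_neg (g : SL(2, ℤ)) :
    MulAction.toPermHom SL(2, ℤ) ℍ (-g) = MulAction.toPermHom SL(2, ℤ) ℍ g :=
  Equiv.ext fun z ↦ ModularGroup.SL_neg_smul g z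

theorem torsionGen_true_sq : torsionGen true ^ 2 = 1 := by
  rw [torsionGen, if_pos rfl, ← map_pow, (by decide : S ^ 2 = -1), toPermHom_neg, map_one]

theorem torsionGen_false_pow_three : torsionGen false ^ 3 = 1 := by
  rw [torsionGen, if_neg Bool.false_ne_true, ← map_pow,
    (by decide : (S * T) ^ 3 = -1), toPermHom_neg, map_one]

theorem torsionGen_true_mul_false :
    torsionGen true * torsionGen false = MulAction.toPermHom SL(2, ℤ) ℍ T := by
  rw [torsionGen, torsionGen, if_pos rfl, if_neg Bool.false_ne_true, ← map_mul,
    (by decide : S * (S * T) = -T), toPermHom_neg]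

theorem re_S_smul (z : ℍ) : (S • z).re = -z.re / Complex.normSq z := by
  rw [modular_S_smul]
  simp [Complex.inv_re, neg_div]

theorem re_T_smul (z : ℍ) : (T • z).re = 1 + z.re := by
  rw [modular_T_smul]
  simp

theorem re_S_smul_pos {z : ℍ} (hz : z.re < 0) : 0 < (S • z).re := by
  rw [re_S_smul]
  exact div_pos (neg_pos.2 hz) (Complex.normSq_pos.2 z.ne_zero)

theorem re_S_smul_neg {z : ℍ} (hz : 0 < z.re) : (S • z).re < 0 := by
  rw [re_S_smul]
  exact div_neg_of_neg_of_pos (neg_neg_of_pos hz) (Complex.normSq_pos.2 z.ne_zero)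

theorem torsionGen_false_apply (z : ℍ) : torsionGen false z = S • T • z := mul_smul S T z

theorem re_torsionGen_false_neg {z : ℍ} (hz : 0 < z.re) : (torsionGen false z).re < 0 := by
  rw [torsionGen_false_apply]
  exact re_S_smul_neg (by rw [re_T_smul]; positivity)

theorem re_torsionGen_false_sq_neg {z : ℍ} (hz : 0 < z.re) : ((torsionGen false ^ 2) z).re < 0 := by
  have h : (torsionGen false ^ 2) z = T⁻¹ • S • z := by
    rw [torsionGen, if_neg Bool.false_ne_true, ← map_pow, ← mul_smul,
      (by decide : (S * T) ^ 2 = T⁻¹ * S)]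
    rfl
  have h' := re_S_smul_neg hz
  have := re_T_smul (T⁻¹ • S • z)
  rw [smul_inv_smul] at this
  rw [h]
  linarith

theorem torsionGen_ne_one (b : Bool) : torsionGen b ≠ 1 := by
  intro h
  have hz : 0 < (T • I).re := by rw [re_T_smul]; simp
  have : (torsionGen b (T • I)).re < 0 := by
    cases b with
    | true => exact re_S_smul_neg hz
    | false => exact re_torsionGen_false_neg hz
  rw [h] at this
  exact lt_asymm hz this

theorem isOfFinOrder_torsionGen (b : Bool) : IsOfFinOrder (torsionGen b) := by
  cases b with
  | true => exact isOfFinOrder_iff_pow_eq_one.2 ⟨2, by simp, torsionGen_true_sq⟩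
  | false => exact isOfFinOrder_iff_pow_eq_one.2 ⟨3, by simp, torsionGen_false_pow_three⟩

theorem orderOf_torsionGen_true : orderOf (torsionGen true) = 2 :=
  orderOf_eq_prime torsionGen_true_sq (torsionGen_ne_one _)

theorem orderOf_torsionGen_false : orderOf (torsionGen false) = 3 :=
  orderOf_eq_prime torsionGen_false_pow_three (torsionGen_ne_one _)

/-- The homomorphism `ℤ/3 ∗ ℤ/2 → PSL₂(ℤ)`. -/
noncomputable abbrev ofCoprodI :
    CoprodI (fun b ↦ Subgroup.zpowers (torsionGen b)) →* Equiv.Perm ℍ :=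
  CoprodI.lift fun b ↦ (Subgroup.zpowers (torsionGen b)).subtype

theorem ofCoprodI_injective : Function.Injective ofCoprodI := by
  refine lift_injective_of_ping_pong _ (.inr ⟨false, ?_⟩)
    (fun b : Bool ↦ if b then {z : ℍ | 0 < z.re} else {z : ℍ | z.re < 0}) ?_ ?_ ?_
  · have h := Nat.card_zpowers (torsionGen false)
    rw [orderOf_torsionGen_false] at h
    have : Finite (Subgroup.zpowers (torsionGen false)) := Nat.finite_of_card_ne_zero (by simp [h])
    rw [← Nat.cast_card, h]
    rfl
  · have hz : 0 < (T • I).re := by rw [re_T_smul]; simp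
    intro b
    cases b with
    | true => exact ⟨T • I, hz⟩
    | false => exact ⟨S • T • I, re_S_smul_neg hz⟩
  · have h : Disjoint {z : ℍ | 0 < z.re} {z : ℍ | z.re < 0} :=
      Set.disjoint_left.2 fun z (h : 0 < z.re) h' ↦ lt_asymm h h'
    intro b c hbc
    cases b <;> cases c <;> simp at hbc
    · exact h.symm
    · exact h
  · rintro b c hbc ⟨_, hg⟩ h1
    classical
    rw [← (isOfFinOrder_torsionGen b).mem_powers_iff_mem_zpowers,
      (isOfFinOrder_torsionGen b).mem_powers_iff_mem_range_orderOf] at hg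
    obtain ⟨k, hk, rfl⟩ := Finset.mem_image.1 hg
    have hk0 : k ≠ 0 := by
      rintro rfl
      exact h1 (Subtype.ext (pow_zero _))
    rw [Finset.mem_range] at hk
    rintro _ ⟨z, hz, rfl⟩
    cases b <;> cases c <;> simp at hbc
    · rw [orderOf_torsionGen_false] at hk
      obtain rfl | rfl : k = 1 ∨ k = 2 := by omega
      · simpa using re_torsionGen_false_neg hz
      · exact re_torsionGen_false_sq_neg hz
    · rw [orderOf_torsionGen_true] at hk
      obtain rfl : k = 1 := by omega
      simp only [pow_one]
      exact re_S_smul_pos hz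

theorem range_ofCoprodI : ofCoprodI.range = (MulAction.toPermHom SL(2, ℤ) ℍ).range := by
  rw [CoprodI.range_eq_iSup]
  apply le_antisymm
  · refine iSup_le fun b ↦ ?_
    rw [Subgroup.range_subtype, Subgroup.zpowers_le]
    exact ⟨_, rfl⟩
  · rw [MonoidHom.range_eq_map, ← SpecialLinearGroup.SL2Z_generators, MonoidHom.map_closure,
      Subgroup.closure_le]
    have h (b) : torsionGen b ∈ ⨆ b, (Subgroup.zpowers (torsionGen b)).subtype.range :=
      Subgroup.mem_iSup_of_mem b (by simp)
    rintro _ ⟨g, rfl | rfl, rfl⟩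
    · exact h true
    · rw [← torsionGen_true_mul_false]
      exact mul_mem (h true) (h false)

/-- The projection `SL₂(ℤ) → PSL₂(ℤ) ≅ ℤ/3 ∗ ℤ/2`. -/
theorem exists_toCoprodI : ∃ f : SL(2, ℤ) →* CoprodI (fun b ↦ Subgroup.zpowers (torsionGen b)),
    Function.Surjective f ∧ ∀ g, ofCoprodI (f g) = MulAction.toPermHom SL(2, ℤ) ℍ g := by
  let e := MonoidHom.ofInjective ofCoprodI_injective
  have hmem (g : SL(2, ℤ)) : MulAction.toPermHom SL(2, ℤ) ℍ g ∈ ofCoprodI.range :=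
    range_ofCoprodI ▸ ⟨g, rfl⟩
  have he (x) : ofCoprodI (e.symm x) = x := congrArg Subtype.val (e.apply_symm_apply x)
  refine ⟨e.symm.toMonoidHom.comp ((MulAction.toPermHom SL(2, ℤ) ℍ).codRestrict _ hmem), ?_,
    fun g ↦ he _⟩
  intro x
  obtain ⟨g, hg⟩ : ofCoprodI x ∈ (MulAction.toPermHom SL(2, ℤ) ℍ).range :=
    range_ofCoprodI ▸ ⟨x, rfl⟩
  exact ⟨g, ofCoprodI_injective ((he _).trans hg)⟩

theorem T_pow_smul (n : ℕ) (z : ℍ) : T ^ n • z = (n : ℝ) +ᵥ z := by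
  simpa using modular_T_zpow_smul z n

theorem not_isOfFinOrder_T : ¬ IsOfFinOrder (MulAction.toPermHom SL(2, ℤ) ℍ T) := by
  rw [isOfFinOrder_iff_pow_eq_one]
  rintro ⟨n, hn, h⟩
  rw [← map_pow] at h
  have h : T ^ n • I = I := Equiv.congr_fun h I
  have := congrArg UpperHalfPlane.re h
  rw [T_pow_smul] at this
  simp at this
  omega

/-- A nontrivial power of `T` does not commute with its conjugate by `S` in `PSL₂(ℤ)`. -/
theorem not_commute_T_pow {n : ℕ} (hn : 0 < n) :
    MulAction.toPermHom SL(2, ℤ) ℍ (S * T ^ n * S⁻¹) * MulAction.toPermHom SL(2, ℤ) ℍ (T ^ n) ≠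
      MulAction.toPermHom SL(2, ℤ) ℍ (T ^ n) *
        MulAction.toPermHom SL(2, ℤ) ℍ (S * T ^ n * S⁻¹) := by
  intro h
  have h : (S * T ^ n * S⁻¹) • T ^ n • I = T ^ n • (S * T ^ n * S⁻¹) • I := Equiv.congr_fun h I
  have h0 : ((S * T ^ n * S⁻¹ : SL(2, ℤ)) : Matrix (Fin 2) (Fin 2) ℤ) = !![1, 0; -(n : ℤ), 1] := by
    have := coe_T_zpow n
    rw [zpow_natCast] at this
    rw [S_inv, Matrix.SpecialLinearGroup.coe_mul, Matrix.SpecialLinearGroup.coe_mul, this,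
      Matrix.SpecialLinearGroup.coe_neg, coe_S]
    simp
  have := congrArg UpperHalfPlane.im h
  rw [T_pow_smul, T_pow_smul, vadd_im, ModularGroup.im_smul_eq_div_normSq,
    ModularGroup.im_smul_eq_div_normSq, denom_apply, denom_apply, vadd_im, h0] at this
  simp [Complex.normSq_apply] at this
  field_simp at this
  have hn1 : (1 : ℝ) ≤ n := by exact_mod_cast hn
  have h2 : (n : ℝ) ^ 2 = 2 := by
    have h3 : (n : ℝ) ^ 2 * (n ^ 2 - 2) = 0 := by linear_combination this
    rcases mul_eq_zero.1 h3 with h3 | h3 <;> nlinarith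
  have h2 : n ^ 2 = 2 := by exact_mod_cast h2
  have hn2 : n ≤ 1 := by nlinarith
  interval_cases n
  simp at h2

end SL2Z

/-- Any finite-index subgroup of `SL₂(ℤ) × K`, for `K` any group, is a nontrivial free
product with amalgamation. -/
theorem finiteIndex_subgroup_SL2Z_prod_isNontrivialAmalgam (K : Type*) [Group K]
    (H : Subgroup (Matrix.SpecialLinearGroup (Fin 2) ℤ × K)) (hH : H.FiniteIndex) :
    IsNontrivialAmalgam ↥H := by
  obtain ⟨f, hf, hf'⟩ := SL2Z.exists_toCoprodI
  let F := f.comp (MonoidHom.fst _ K)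
  have hrange : (F.comp H.subtype).range = H.map F := by
    rw [MonoidHom.range_comp, Subgroup.range_subtype]
  have hF : Function.Surjective F := hf.comp Prod.fst_surjective
  have : (F.comp H.subtype).range.FiniteIndex := ⟨fun h ↦ hH.index_ne_zero <|
    zero_dvd_iff.1 (h ▸ hrange ▸ H.index_map_dvd hF)⟩
  have torsion (b : Bool) :
      IsOfFinOrder (⟨_, Subgroup.mem_zpowers _⟩ : Subgroup.zpowers (SL2Z.torsionGen b)) :=
    Submonoid.isOfFinOrder_coe.1 (SL2Z.isOfFinOrder_torsionGen b)
  refine FreeProduct.isNontrivialAmalgam_of_finiteIndex (F.comp H.subtype)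
    ⟨_, Subgroup.mem_zpowers _⟩ ⟨_, Subgroup.mem_zpowers _⟩
    (fun h ↦ SL2Z.torsionGen_ne_one _ (congrArg Subtype.val h))
    (fun h ↦ SL2Z.torsionGen_ne_one _ (congrArg Subtype.val h))
    (torsion _) (torsion _) ?_ ?_
  · intro h
    apply SL2Z.not_isOfFinOrder_T
    rw [← SL2Z.torsionGen_true_mul_false]
    simpa using SL2Z.ofCoprodI.isOfFinOrder h
  · obtain ⟨n, hn, -, hmem⟩ := H.normalCore.exists_pow_mem_of_index_ne_zero
      Subgroup.FiniteIndex.index_ne_zero (ModularGroup.T, 1)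
    have hconj := Subgroup.Normal.conj_mem inferInstance _ hmem (ModularGroup.S, 1)
    refine ⟨_, ⟨⟨_, H.normalCore_le hconj⟩, rfl⟩, _, ⟨⟨_, H.normalCore_le hmem⟩, rfl⟩, fun h ↦ ?_⟩
    have := congrArg SL2Z.ofCoprodI h
    rw [map_mul, map_mul] at this
    refine SL2Z.not_commute_T_pow hn ?_
    rw [← hf', ← hf']
    exact this
end

section
/- Every finite-index subgroup of SL₂(ℤ) is a nontrivial free product with amalgamation; that is, for every subgroup H of SL₂(ℤ) of finite index there exist groups A, B, C, injective group homomorphisms f : C → A and g : C → B, neither of which is surjective, and a group isomorphism between H and the amalgamated free product A ∗_C B (the pushout of f and g). -/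
universe u v w

open Monoid

theorem exists_hom_extending_comap_range {Γ Y A Q : Type*} [Group Γ] [Group Y] [Group A]
    [Group Q] {φ : Γ →* Y} (hφ : Function.Surjective φ) {i : A →* Y}
    (hi : Function.Injective i) (m : i.range.comap φ →* Q) (hm : ∀ x, φ x.1 = 1 → m x = 1) :
    ∃ h : A →* Q, ∀ a x, φ x.1 = i a → h a = m x := by
  let p : i.range.comap φ →* A :=
    (MonoidHom.ofInjective hi).symm.toMonoidHom.comp (φ.subgroupComap _)
  have hp (x) : i (p x) = φ x :=
    congrArg Subtype.val ((MonoidHom.ofInjective hi).apply_symm_apply _)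
  have hps : Function.Surjective p := fun a => by
    obtain ⟨x, hx⟩ := hφ (i a)
    exact ⟨⟨x, a, hx.symm⟩, hi (by rw [hp, hx])⟩
  have hk : p.ker ≤ m.ker := fun x hx => hm x (by rw [← hp, MonoidHom.mem_ker.1 hx, map_one])
  refine ⟨p.liftOfSurjective hps ⟨m, hk⟩, fun a x hx => ?_⟩
  rw [← hi ((hp x).trans hx)]
  exact MonoidHom.liftOfRightInverse_comp_apply _ _ _ ⟨m, hk⟩ x

theorem not_surjective_inclusion_ker {Γ Y A : Type*} [Group Γ] [Group Y] [Group A] [Nontrivial A]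
    {φ : Γ →* Y} (hφ : Function.Surjective φ) {i : A →* Y} (hi : Function.Injective i)
    (h : φ.ker ≤ i.range.comap φ) : ¬ Function.Surjective (Subgroup.inclusion h) := by
  intro hs
  obtain ⟨a, ha⟩ := exists_ne (1 : A)
  obtain ⟨x, hx⟩ := hφ (i a)
  obtain ⟨k, hk⟩ := hs ⟨x, a, hx.symm⟩
  have hkx : (k : Γ) = x := congrArg Subtype.val hk
  have h1 : φ x = 1 := hkx ▸ k.2
  exact ha (hi (by rw [← hx, h1, map_one]))

/-- A group surjecting onto a free product of two nontrivial groups splits as the amalgamated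
product of the preimages of the factors over the kernel. -/
theorem isNontrivialAmalgam_of_surjective_coprod {Γ : Type v} [Group Γ] {A B : Type w}
    [Group A] [Group B] [Nontrivial A] [Nontrivial B] (φ : Γ →* Coprod A B)
    (hφ : Function.Surjective φ) : IsNontrivialAmalgam Γ := by
  let A' : Subgroup Γ := (Coprod.inl : A →* Coprod A B).range.comap φ
  let B' : Subgroup Γ := (Coprod.inr : B →* Coprod A B).range.comap φ
  have hA : φ.ker ≤ A' := fun x hx => by
    rw [Subgroup.mem_comap, MonoidHom.mem_ker.1 hx]; exact one_mem _
  have hB : φ.ker ≤ B' := fun x hx => by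
    rw [Subgroup.mem_comap, MonoidHom.mem_ker.1 hx]; exact one_mem _
  let f : φ.ker →* A' := Subgroup.inclusion hA
  let g : φ.ker →* B' := Subgroup.inclusion hB
  refine ⟨A', B', φ.ker, inferInstance, inferInstance, inferInstance, f, g,
    Subgroup.inclusion_injective _, Subgroup.inclusion_injective _,
    not_surjective_inclusion_ker hφ Coprod.inl_injective hA,
    not_surjective_inclusion_ker hφ Coprod.inr_injective hB, ?_⟩
  let j : ∀ b, boolFam A' B' b →* Γ := fun b => match b with
    | true => A'.subtype
    | false => B'.subtype
  let Θ : PushoutI (boolHoms f g) →* Γ := PushoutI.lift j φ.ker.subtype (by rintro (_ | _) <;> rfl)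
  have hΘA (x : A') : Θ (PushoutI.of (φ := boolHoms f g) true x) = x :=
    PushoutI.lift_of (φ := boolHoms f g) _ _ _ _
  have hΘB (x : B') : Θ (PushoutI.of (φ := boolHoms f g) false x) = x :=
    PushoutI.lift_of (φ := boolHoms f g) _ _ _ _
  have hΘk (x : φ.ker) : Θ (PushoutI.base (boolHoms f g) x) = x := PushoutI.lift_base _ _ _ _
  have hsurj : Function.Surjective Θ := by
    have hmap : Θ.range.map φ = ⊤ := by
      rw [eq_top_iff, ← Coprod.range_inl_sup_range_inr, sup_le_iff]
      constructor
      · rintro _ ⟨a, rfl⟩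
        obtain ⟨x, hx⟩ := hφ (Coprod.inl a)
        exact ⟨x, ⟨_, hΘA ⟨x, a, hx.symm⟩⟩, hx⟩
      · rintro _ ⟨a, rfl⟩
        obtain ⟨x, hx⟩ := hφ (Coprod.inr a)
        exact ⟨x, ⟨_, hΘB ⟨x, a, hx.symm⟩⟩, hx⟩
    intro x
    obtain ⟨y, ⟨w, rfl⟩, hy⟩ : φ x ∈ Θ.range.map φ := hmap ▸ Subgroup.mem_top _
    have hk : (Θ w)⁻¹ * x ∈ φ.ker := by simp [MonoidHom.mem_ker, hy]
    exact ⟨w * PushoutI.base _ ⟨_, hk⟩, by rw [map_mul, hΘk]; simp⟩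
  let N := (PushoutI.base (boolHoms f g)).range
  have hconj (k : φ.ker) (w : PushoutI (boolHoms f g)) :
      w * PushoutI.base _ k * w⁻¹ ∈ N := by
    induction w using PushoutI.induction_on generalizing k with
    | of i x =>
      have hn : (j i x) * k * (j i x)⁻¹ ∈ φ.ker :=
        (inferInstance : φ.ker.Normal).conj_mem _ k.2 _
      refine ⟨⟨_, hn⟩, ?_⟩
      rw [← PushoutI.of_apply_eq_base _ i, ← PushoutI.of_apply_eq_base _ i,
        ← map_inv (PushoutI.of (φ := boolHoms f g) i),
        ← map_mul, ← map_mul]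
      congr 1
      cases i <;> rfl
    | base h => exact ⟨h * k * h⁻¹, by simp⟩
    | mul x y hx hy =>
      obtain ⟨k', hk'⟩ := hy k
      have := hx k'
      rw [hk'] at this
      simpa [mul_assoc] using this
  have : N.Normal := ⟨by rintro _ ⟨k, rfl⟩ w; exact hconj k w⟩
  let mkA : A' →* PushoutI (boolHoms f g) ⧸ N :=
    (QuotientGroup.mk' N).comp (PushoutI.of (φ := boolHoms f g) true)
  let mkB : B' →* PushoutI (boolHoms f g) ⧸ N :=
    (QuotientGroup.mk' N).comp (PushoutI.of (φ := boolHoms f g) false)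
  have hmkA (k : φ.ker) : mkA (f k) = 1 := by
    refine (QuotientGroup.eq_one_iff _).2 ⟨k, ?_⟩
    exact (PushoutI.of_apply_eq_base (boolHoms f g) true k).symm
  have hmkB (k : φ.ker) : mkB (g k) = 1 := by
    refine (QuotientGroup.eq_one_iff _).2 ⟨k, ?_⟩
    exact (PushoutI.of_apply_eq_base (boolHoms f g) false k).symm
  obtain ⟨ψA, hψA⟩ := exists_hom_extending_comap_range hφ Coprod.inl_injective mkA
    fun x hx => hmkA ⟨x, hx⟩
  obtain ⟨ψB, hψB⟩ := exists_hom_extending_comap_range hφ Coprod.inr_injective mkB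
    fun x hx => hmkB ⟨x, hx⟩
  let ψ : Coprod A B →* PushoutI (boolHoms f g) ⧸ N := Coprod.lift ψA ψB
  have hψΘA (x : A') : ψ (φ (Θ (PushoutI.of (φ := boolHoms f g) true x))) = mkA x := by
    obtain ⟨a, ha⟩ := x.2
    rw [hΘA, ← ha, Coprod.lift_apply_inl, hψA a x ha.symm]
  have hψΘB (x : B') : ψ (φ (Θ (PushoutI.of (φ := boolHoms f g) false x))) = mkB x := by
    obtain ⟨b, hb⟩ := x.2
    rw [hΘB, ← hb, Coprod.lift_apply_inr, hψB b x hb.symm]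
  have hcomp : (ψ.comp φ).comp Θ = QuotientGroup.mk' N := by
    refine PushoutI.hom_ext_nonempty fun i => MonoidHom.ext fun x => ?_
    cases i with
    | true => exact hψΘA x
    | false => exact hψΘB x
  have hinj : Function.Injective Θ := by
    refine (injective_iff_map_eq_one Θ).2 fun w hw => ?_
    have h1 : QuotientGroup.mk' N w = 1 := by
      rw [← hcomp]
      change ψ (φ (Θ w)) = 1
      rw [hw, map_one, map_one]
    obtain ⟨k, rfl⟩ := (QuotientGroup.eq_one_iff w).1 h1
    rw [hΘk] at hw
    rw [show k = 1 from Subtype.ext hw, map_one]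
  exact ⟨(MulEquiv.ofBijective Θ ⟨hinj, hsurj⟩).symm⟩

theorem Setoid.exists_finset_sup_eq_top {X ι : Type*} [Finite X] [Nonempty X] (σ : ι → Setoid X)
    (r : Setoid X) (h : r ⊔ ⨆ i, σ i = ⊤) :
    ∃ D : Finset ι, D.card + 1 ≤ Nat.card (Quotient r) ∧ r ⊔ ⨆ i ∈ D, σ i = ⊤ := by
  classical
  induction hn : Nat.card (Quotient r) using Nat.strong_induction_on generalizing r with
  | _ n ih =>
    subst hn
    by_cases hr : r = ⊤
    · have : Nonempty (Quotient r) := ⟨Quotient.mk r (Classical.arbitrary X)⟩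
      exact ⟨∅, Nat.card_pos (α := Quotient r), by simp [hr]⟩
    have hi : ∃ i, ¬ σ i ≤ r := by
      by_contra! hc
      exact hr (by rwa [sup_eq_left.2 (iSup_le hc)] at h)
    obtain ⟨i, hi⟩ := hi
    have hlt : Nat.card (Quotient (r ⊔ σ i)) < Nat.card (Quotient r) := by
      let q : Quotient r → Quotient (r ⊔ σ i) :=
        Quotient.map' id fun a b hab => (le_sup_left : r ≤ r ⊔ σ i) hab
      have hq : Function.Surjective q := by
        rintro ⟨x⟩
        exact ⟨Quotient.mk r x, rfl⟩
      refine lt_of_le_of_ne (Nat.card_le_card_of_surjective q hq) fun heq => hi fun a b hab => ?_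
      have hbij := Function.Surjective.bijective_of_nat_card_le hq heq.ge
      have hab' : q (Quotient.mk r a) = q (Quotient.mk r b) :=
        Quotient.sound' ((le_sup_right : σ i ≤ r ⊔ σ i) hab)
      exact Quotient.exact (hbij.1 hab')
    have htop : r ⊔ σ i ⊔ ⨆ i, σ i = ⊤ := by rw [sup_assoc, sup_eq_right.2 (le_iSup σ i), h]
    obtain ⟨D, hD, hDtop⟩ := ih _ hlt (r ⊔ σ i) htop rfl
    refine ⟨insert i D, ?_, ?_⟩
    · have := Finset.card_insert_le i D
      omega
    · rw [Finset.iSup_insert, ← sup_assoc, hDtop]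

namespace Equiv.Perm

variable {X : Type*}

theorem SameCycle.setoid_le {g : Perm X} {t : Setoid X} (h : ∀ x, t x (g x)) :
    SameCycle.setoid g ≤ t := by
  rintro x _ ⟨i, rfl⟩
  induction i with
  | zero => exact t.refl _
  | succ i hi =>
    rw [add_comm, zpow_add, zpow_one]
    exact t.trans hi (h _)
  | pred i hi =>
    have hg : g ((g ^ (-(i : ℤ) - 1)) x) = (g ^ (-(i : ℤ))) x := by
      rw [← mul_apply, ← zpow_one_add, add_sub_cancel]
    exact t.trans hi (t.symm (hg ▸ h _))

theorem SameCycle.eq_or_of_sq_eq_one {g : Perm X} (hg : g ^ 2 = 1) {x y : X}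
    (h : g.SameCycle x y) : y = x ∨ y = g x := by
  obtain ⟨i, rfl⟩ := h
  rcases Int.even_or_odd' i with ⟨k, rfl | rfl⟩
  · left; rw [zpow_mul, zpow_ofNat, hg, one_zpow, one_apply]
  · right; rw [zpow_add, zpow_mul, zpow_ofNat, hg, one_zpow, one_mul, zpow_one]

theorem card_cycles_lt [Finite X] [Nonempty X] {s u : Perm X} (hs : s ^ 2 = 1) (hu : u ^ 3 = 1) :
    Nat.card (Quotient (SameCycle.setoid u)) <
      Nat.card (Quotient (SameCycle.setoid s)) + Nat.card {x // u x = x} := by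
  classical
  cases nonempty_fintype X
  have hE : Nat.card X ≤ Nat.card (Quotient (SameCycle.setoid s)) * 2 := by
    let F : Quotient (SameCycle.setoid s) × Bool → X := fun p => bif p.2 then p.1.out else s p.1.out
    have hF : Function.Surjective F := fun x => by
      have hx : s.SameCycle (Quotient.mk (SameCycle.setoid s) x).out x :=
        Quotient.mk_out (s := SameCycle.setoid s) x
      rcases hx.eq_or_of_sq_eq_one hs with h | h
      · exact ⟨(_, true), h.symm⟩
      · exact ⟨(_, false), h.symm⟩
    simpa using Nat.card_le_card_of_surjective F hF
  have hV : Nat.card (Quotient (SameCycle.setoid u)) * 3 ≤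
      Nat.card X + 2 * Nat.card {x // u x = x} := by
    let w : X → ℕ := fun x => if u x = x then 3 else 1
    have hw : ∑ x, w x = Nat.card X + 2 * Nat.card {x // u x = x} := by
      have h1 : ∀ x, w x = 1 + 2 * if u x = x then 1 else 0 := fun x => by
        by_cases h : u x = x <;> simp [w, h]
      rw [Finset.sum_congr rfl fun x _ => h1 x, Finset.sum_add_distrib, ← Finset.mul_sum,
        Finset.sum_boole, Nat.card_eq_fintype_card, Nat.card_eq_fintype_card,
        Fintype.card_subtype]
      simp
    rw [← hw, ← Finset.sum_fiberwise Finset.univ (Quotient.mk (SameCycle.setoid u)) w,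
      Nat.card_eq_fintype_card, ← Finset.card_univ, ← smul_eq_mul]
    refine Finset.card_nsmul_le_sum _ _ _ fun v _ => ?_
    induction v using Quotient.inductionOn with
    | _ x =>
    have hmem : ∀ y, u.SameCycle x y → y ∈ Finset.univ.filter
        fun y => Quotient.mk (SameCycle.setoid u) y = Quotient.mk (SameCycle.setoid u) x :=
      fun y hy => Finset.mem_filter.2 ⟨Finset.mem_univ _, Quotient.sound' hy.symm⟩
    by_cases hx : u x = x
    · calc 3 = w x := by simp [w, hx]
        _ ≤ _ := Finset.single_le_sum (fun _ _ => Nat.zero_le _) (hmem x (SameCycle.refl _ _))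
    · have hux : u (u x) ≠ u x := fun h => hx (u.injective h)
      have huux : u (u x) ≠ x := fun h => by
        have h3 : u (u (u x)) = x := congrArg (· x) hu
        rw [h] at h3
        exact hx h3
      calc 3 = ({x, u x, u (u x)} : Finset X).card := by
            rw [Finset.card_eq_three.2 ⟨_, _, _, Ne.symm hx, huux.symm, hux.symm, rfl⟩]
        _ ≤ ∑ y ∈ {x, u x, u (u x)}, w y := by
            rw [Finset.card_eq_sum_ones]
            refine Finset.sum_le_sum fun y _ => ?_
            by_cases h : u y = y <;> simp [w, h]
        _ ≤ _ := by
            refine Finset.sum_le_sum_of_subset fun y hy => ?_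
            simp only [Finset.mem_insert, Finset.mem_singleton] at hy
            rcases hy with rfl | rfl | rfl
            · exact hmem _ (SameCycle.refl _ _)
            · exact hmem _ ⟨1, rfl⟩
            · exact hmem _ ⟨2, rfl⟩
  have hpos : 0 < Nat.card X := Nat.card_pos
  omega

/-- The equivalence relation whose only possibly nontrivial class is the cycle `e` of `g`. -/
def cycleSetoid (g : Perm X) (e : Quotient (SameCycle.setoid g)) : Setoid X where
  r x y := x = y ∨ Quotient.mk _ x = e ∧ Quotient.mk _ y = e
  iseqv :=
    { refl := fun _ => Or.inl rfl
      symm := fun h => h.imp Eq.symm And.symm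
      trans := by
        rintro x y z (rfl | h) (rfl | h')
        exacts [Or.inl rfl, Or.inr h', Or.inr h, Or.inr ⟨h.1, h'.2⟩] }

end Equiv.Perm

theorem exists_hom_zmod {G : Type*} [Group G] {n : ℕ} {g : G} (hg : g ^ n = 1) :
    ∃ f : Multiplicative (ZMod n) →* G, f (Multiplicative.ofAdd 1) = g := by
  let z : ℤ →+ Additive G := zmultiplesHom (Additive G) (Additive.ofMul g)
  have hz : z n = 0 := by
    rw [zmultiplesHom_apply, natCast_zsmul, ← ofMul_pow, hg, ofMul_one]
  refine ⟨AddMonoidHom.toMultiplicativeLeft (ZMod.lift n ⟨z, hz⟩), ?_⟩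
  have h1 : ZMod.lift n ⟨z, hz⟩ ((1 : ℤ) : ZMod n) = z 1 := ZMod.lift_coe n ⟨z, hz⟩ 1
  rw [Int.cast_one] at h1
  change (ZMod.lift n ⟨z, hz⟩ 1).toMul = g
  rw [h1, zmultiplesHom_apply, one_zsmul]
  rfl

theorem closure_ofAdd_one (n : ℕ) :
    Subgroup.closure {(Multiplicative.ofAdd 1 : Multiplicative (ZMod n))} = ⊤ := by
  rw [eq_top_iff, ← Subgroup.zpowers_eq_closure]
  rintro x -
  obtain ⟨k, hk⟩ := ZMod.intCast_surjective x.toAdd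
  exact ⟨k, by
    change Multiplicative.ofAdd (1 : ZMod n) ^ k = x
    rw [← ofAdd_zsmul, zsmul_one, hk]; rfl⟩

/-- The free product of cyclic groups of orders `2` (index `true`) and `3` (index `false`). -/
abbrev C2C3 : Type := CoprodI fun b : Bool => Multiplicative (ZMod (bif b then 2 else 3))

namespace C2C3

/-- The generator of order `2`. -/
def s : C2C3 := CoprodI.of (i := true) (Multiplicative.ofAdd 1)

/-- The generator of order `3`. -/
def u : C2C3 := CoprodI.of (i := false) (Multiplicative.ofAdd 1)

theorem s_sq : s ^ 2 = 1 := by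
  rw [s, ← map_pow]
  exact map_one _

theorem u_cube : u ^ 3 = 1 := by
  rw [u, ← map_pow]
  exact map_one _

theorem closure_s_u : Subgroup.closure {s, u} = (⊤ : Subgroup C2C3) := by
  have key (b : Bool) : (CoprodI.of (M := fun b : Bool => Multiplicative (ZMod (bif b then 2 else 3)))
      (i := b)).range ≤
      Subgroup.closure {CoprodI.of (i := b) (Multiplicative.ofAdd 1)} := by
    rw [MonoidHom.range_eq_map, ← closure_ofAdd_one, MonoidHom.map_closure, Set.image_singleton]
  rw [eq_top_iff]
  rintro x -
  induction x using CoprodI.induction_on with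
  | one => exact one_mem _
  | mul x y hx hy => exact mul_mem hx hy
  | of b x =>
    refine Subgroup.closure_mono ?_ (key b ⟨x, rfl⟩)
    cases b
    · exact Set.singleton_subset_iff.2 (Or.inr rfl)
    · exact Set.singleton_subset_iff.2 (Or.inl rfl)

theorem exists_hom {G : Type*} [Group G] {a b : G} (ha : a ^ 2 = 1) (hb : b ^ 3 = 1) :
    ∃ f : C2C3 →* G, f s = a ∧ f u = b := by
  obtain ⟨f, hf⟩ := exists_hom_zmod ha
  obtain ⟨g, hg⟩ := exists_hom_zmod hb
  let F : ∀ i : Bool, Multiplicative (ZMod (bif i then 2 else 3)) →* G := fun i => match i with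
    | true => f
    | false => g
  exact ⟨CoprodI.lift F, (CoprodI.lift_of F _).trans hf, (CoprodI.lift_of F _).trans hg⟩

open UpperHalfPlane MatrixGroups ModularGroup in
theorem exists_surjective_hom_of_SL2Z :
    ∃ π : SL(2, ℤ) →* C2C3, Function.Surjective π := by
  let ρ : SL(2, ℤ) →* Equiv.Perm ℍ := MulAction.toPermHom _ _
  have hS (z : ℍ) : ((S • z : ℍ) : ℂ) = -(z : ℂ)⁻¹ := by
    rw [modular_S_smul]; simp [inv_neg]
  have hU (z : ℍ) : (((T * S) • z : ℍ) : ℂ) = 1 - (z : ℂ)⁻¹ := by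
    rw [mul_smul, modular_T_smul, coe_vadd, hS]; push_cast; ring
  have hne (z : ℍ) : (z : ℂ) ≠ 0 := z.ne_zero
  have hU2 (z : ℍ) : (((T * S) • (T * S) • z : ℍ) : ℂ) = (1 - (z : ℂ))⁻¹ := by
    have h1 := hne ((T * S) • z)
    rw [hU] at h1
    have h2 : (1 : ℂ) - z ≠ 0 := fun h => by
      apply h1
      rw [← sub_eq_zero.1 h]; simp
    have h0 := hne z
    have h3 : (z : ℂ) - 1 ≠ 0 := fun h => h2 (by linear_combination -h)
    rw [hU, hU]
    field_simp
    ring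
  have hs2 : ρ S ^ 2 = 1 := by
    ext z
    change ((S • S • z : ℍ) : ℂ) = z
    rw [hS, hS]; simp
  have hu3 : ρ (T * S) ^ 3 = 1 := by
    ext z
    change (((T * S) • (T * S) • (T * S) • z : ℍ) : ℂ) = z
    rw [hU2, hU]; simp
  obtain ⟨f, hf⟩ := exists_hom_zmod hs2
  obtain ⟨g, hg⟩ := exists_hom_zmod hu3
  let F : ∀ i : Bool, Multiplicative (ZMod (bif i then 2 else 3)) →* Equiv.Perm ℍ := fun i =>
    match i with
    | true => f
    | false => g
  let X : Bool → Set ℍ := fun i => {z | bif i then (z : ℂ).re < 0 else 0 < (z : ℂ).re}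
  have hSneg (z : ℍ) (hz : 0 < (z : ℂ).re) : ((S • z : ℍ) : ℂ).re < 0 := by
    rw [hS, Complex.neg_re, Complex.inv_re, neg_lt_zero]
    exact div_pos hz (Complex.normSq_pos.2 (hne z))
  have hUpos (z : ℍ) (hz : (z : ℂ).re < 0) : 0 < (((T * S) • z : ℍ) : ℂ).re := by
    have := div_neg_of_neg_of_pos hz (Complex.normSq_pos.2 (hne z))
    rw [hU, Complex.sub_re, Complex.one_re, Complex.inv_re]
    linarith
  have hU2pos (z : ℍ) (hz : (z : ℂ).re < 0) :
      0 < (((T * S) • (T * S) • z : ℍ) : ℂ).re := by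
    have h : 0 < (1 - (z : ℂ)).re := by rw [Complex.sub_re, Complex.one_re]; linarith
    rw [hU2, Complex.inv_re]
    exact div_pos h (Complex.normSq_pos.2 fun h0 => by simp [h0] at h)
  have hinj : Function.Injective (CoprodI.lift F) := by
    refine CoprodI.lift_injective_of_ping_pong F (Or.inr ⟨false, ?_⟩) X ?_ ?_ ?_
    · change 3 ≤ Cardinal.mk (ZMod 3)
      rw [Cardinal.mk_fintype, ZMod.card]
      norm_num
    · rintro (_ | _)
      · exact ⟨⟨⟨1, 1⟩, one_pos⟩, show (0 : ℝ) < 1 from one_pos⟩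
      · exact ⟨⟨⟨-1, 1⟩, one_pos⟩, show (-1 : ℝ) < 0 by norm_num⟩
    · have h : Disjoint (X true) (X false) :=
        Set.disjoint_left.2 fun z (h1 : (z : ℂ).re < 0) (h2 : 0 < (z : ℂ).re) => lt_asymm h1 h2
      rintro (_ | _) (_ | _) hij
      exacts [absurd rfl hij, h.symm, h, absurd rfl hij]
    · rintro (_ | _) (_ | _) hij x hx
      · exact absurd rfl hij
      · have hx' : x = Multiplicative.ofAdd 1 ∨
            x = Multiplicative.ofAdd 1 * Multiplicative.ofAdd 1 := by
          have : ∀ y : ZMod 3, y ≠ 0 → y = 1 ∨ y = 1 + 1 := by decide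
          exact this x hx
        rintro _ ⟨z, hz, rfl⟩
        rcases hx' with rfl | rfl
        · change 0 < ((g (Multiplicative.ofAdd 1) z : ℍ) : ℂ).re
          rw [hg]
          exact hUpos z hz
        · change 0 < ((g (Multiplicative.ofAdd 1 * Multiplicative.ofAdd 1) z : ℍ) : ℂ).re
          rw [map_mul, hg]
          exact hU2pos z hz
      · have hx' : x = Multiplicative.ofAdd 1 := by
          have : ∀ y : ZMod 2, y ≠ 0 → y = 1 := by decide
          exact this x hx
        rintro _ ⟨z, hz, rfl⟩
        subst hx'
        change ((f (Multiplicative.ofAdd 1) z : ℍ) : ℂ).re < 0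
        rw [hf]
        exact hSneg z hz
      · exact absurd rfl hij
  have hLs : CoprodI.lift F s = ρ S := (CoprodI.lift_of F _).trans hf
  have hLu : CoprodI.lift F u = ρ (T * S) := (CoprodI.lift_of F _).trans hg
  have hrange : ∀ A, ρ A ∈ (CoprodI.lift F).range := by
    have hle : Subgroup.closure {S, T} ≤ (CoprodI.lift F).range.comap ρ := by
      rw [Subgroup.closure_le]
      have h1 : S ∈ (CoprodI.lift F).range.comap ρ := ⟨s, hLs⟩
      have h2 : T * S ∈ (CoprodI.lift F).range.comap ρ := ⟨u, hLu⟩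
      rintro _ (rfl | rfl)
      · exact h1
      · exact (Subgroup.mul_mem_cancel_right _ h1).1 h2
    rw [SpecialLinearGroup.SL2Z_generators] at hle
    exact fun A => hle (Subgroup.mem_top A)
  let e := MonoidHom.ofInjective hinj
  let π : SL(2, ℤ) →* C2C3 := e.symm.toMonoidHom.comp (ρ.codRestrict _ hrange)
  have hπ (A : SL(2, ℤ)) : CoprodI.lift F (π A) = ρ A :=
    congrArg Subtype.val (e.apply_symm_apply _)
  refine ⟨π, MonoidHom.range_eq_top.1 ?_⟩
  rw [eq_top_iff, ← closure_s_u, Subgroup.closure_le]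
  rintro _ (rfl | rfl)
  · exact ⟨S, hinj ((hπ S).trans hLs.symm)⟩
  · exact ⟨T * S, hinj ((hπ _).trans hLu.symm)⟩

end C2C3

namespace C2C3

variable {X : Type*} [MulAction C2C3 X]

theorem exists_cocycle {Y : Type*} [Group Y] {a b : X → Y}
    (ha : ∀ x, a (s • x) * a x = 1) (hb : ∀ x, b (u • u • x) * b (u • x) * b x = 1) :
    ∃ c : C2C3 → X → Y, c s = a ∧ c u = b ∧ ∀ p q x, c (p * q) x = c p (q • x) * c q x := by
  let twist (p : C2C3) (d : X → Y) : Equiv.Perm (X × Y) :=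
    { toFun := fun z => (p • z.1, d z.1 * z.2)
      invFun := fun z => (p⁻¹ • z.1, (d (p⁻¹ • z.1))⁻¹ * z.2)
      left_inv := fun z => by simp
      right_inv := fun z => by simp }
  have hs : twist s a ^ 2 = 1 := by
    ext1 ⟨x, y⟩
    change ((s • s • x, a (s • x) * (a x * y)) : X × Y) = (x, y)
    rw [← mul_assoc, ha, one_mul, ← mul_smul, ← sq, s_sq, one_smul]
  have hu : twist u b ^ 3 = 1 := by
    ext1 ⟨x, y⟩
    change ((u • u • u • x, b (u • u • x) * (b (u • x) * (b x * y))) : X × Y) = (x, y)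
    rw [← mul_assoc, ← mul_assoc, hb, one_mul, ← mul_smul, ← mul_smul, ← pow_three', u_cube,
      one_smul]
  obtain ⟨θ, hθs, hθu⟩ := exists_hom hs hu
  have hθ (p : C2C3) : ∃ d, θ p = twist p d := by
    have hp : p ∈ Subgroup.closure {s, u} := closure_s_u ▸ Subgroup.mem_top p
    induction hp using Subgroup.closure_induction with
    | mem p hp =>
      rcases hp with rfl | rfl
      exacts [⟨a, hθs⟩, ⟨b, hθu⟩]
    | one => exact ⟨1, by ext1 z; simp [twist]⟩
    | mul p q _ _ hp hq =>
      obtain ⟨d, hd⟩ := hp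
      obtain ⟨d', hd'⟩ := hq
      exact ⟨fun x => d (q • x) * d' x, by ext1 z; simp [twist, hd, hd', mul_smul, mul_assoc]⟩
    | inv p _ hp =>
      obtain ⟨d, hd⟩ := hp
      refine ⟨fun x => (d (p⁻¹ • x))⁻¹, ?_⟩
      rw [map_inv, hd]
      exact Equiv.ext fun _ => rfl
  choose c hc using hθ
  have hc' (p : C2C3) (x : X) (y : Y) : θ p (x, y) = (p • x, c p x * y) := by rw [hc]; rfl
  have hfst (p : C2C3) (d : X → Y) (h : θ p = twist p d) : c p = d := by
    ext x
    have h1 : θ p (x, 1) = (p • x, d x * 1) := by rw [h]; rfl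
    rw [hc', mul_one, mul_one] at h1
    exact (Prod.ext_iff.1 h1).2
  refine ⟨c, hfst _ _ hθs, hfst _ _ hθu, fun p q x => ?_⟩
  have h1 : θ (p * q) (x, 1) = θ p (θ q (x, 1)) := by rw [map_mul]; rfl
  rw [hc', hc', hc', mul_one, mul_one] at h1
  exact (Prod.ext_iff.1 h1).2

theorem setoid_eq_top [MulAction.IsPretransitive C2C3 X] {t : Setoid X}
    (hs : ∀ x, t x (s • x)) (hu : ∀ x, t x (u • x)) : t = ⊤ := by
  have key (p : C2C3) : ∀ x, t x (p • x) := by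
    have hp : p ∈ Subgroup.closure {s, u} := closure_s_u ▸ Subgroup.mem_top p
    induction hp using Subgroup.closure_induction with
    | mem p hp => rcases hp with rfl | rfl <;> assumption
    | one => exact fun x => by rw [one_smul]
    | mul p q _ _ hp hq => exact fun x => by rw [mul_smul]; exact t.trans (hq x) (hp _)
    | inv p _ hp => exact fun x => by simpa using t.symm (hp (p⁻¹ • x))
  refine eq_top_iff.2 fun x y _ => ?_
  obtain ⟨p, rfl⟩ := MulAction.exists_smul_eq C2C3 x y
  exact key p x

/-- The permutation of a `C2C3`-set given by `s`. -/
abbrev sPerm (X : Type*) [MulAction C2C3 X] : Equiv.Perm X := MulAction.toPerm s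

/-- The permutation of a `C2C3`-set given by `u`. -/
abbrev uPerm (X : Type*) [MulAction C2C3 X] : Equiv.Perm X := MulAction.toPerm u

theorem sPerm_sq : sPerm X ^ 2 = 1 := by
  ext x
  change s • s • x = x
  rw [← mul_smul, ← sq, s_sq, one_smul]

theorem uPerm_cube : uPerm X ^ 3 = 1 := by
  ext x
  change u • u • u • x = x
  rw [← mul_smul, ← mul_smul, ← pow_three', u_cube, one_smul]

/-- If the cycles of `u` together with the cycles of `s` in `D` connect `X`, then the stabilizer
of a point surjects onto any group generated by elements of order dividing `2`, one for each cycle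
of `s` outside of `D`, and elements of order dividing `3`, one for each fixed point of `u`. -/
theorem exists_surjective_hom_stabilizer [Finite X] (x₀ : X)
    {D : Finset (Quotient (Equiv.Perm.SameCycle.setoid (sPerm X)))}
    (hD : Equiv.Perm.SameCycle.setoid (uPerm X) ⊔ ⨆ e ∈ D, (sPerm X).cycleSetoid e = ⊤)
    {Y : Type*} [Group Y] (v : {e // e ∉ D} → Y) (w : {x : X // u • x = x} → Y)
    (hv : ∀ e, v e ^ 2 = 1) (hw : ∀ x, w x ^ 3 = 1)
    (hgen : Subgroup.closure (Set.range v ∪ Set.range w) = ⊤) :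
    ∃ φ : MulAction.stabilizer C2C3 x₀ →* Y, Function.Surjective φ := by
  classical
  let cyc : X → Quotient (Equiv.Perm.SameCycle.setoid (sPerm X)) := Quotient.mk _
  have hcyc (x : X) : cyc (s • x) = cyc x :=
    Quotient.sound' (Equiv.Perm.SameCycle.symm ⟨1, rfl⟩)
  let a : X → Y := fun x => if h : cyc x ∉ D then v ⟨_, h⟩ else 1
  let b : X → Y := fun x => if h : u • x = x then w ⟨x, h⟩ else 1
  have ha (x : X) : a (s • x) * a x = 1 := by
    have h1 : a (s • x) = a x := by simp only [a, hcyc]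
    rw [h1, ← sq]
    by_cases h : cyc x ∉ D
    · simp only [a, dif_pos h, hv]
    · simp only [a, dif_neg h, one_pow]
  have hb (x : X) : b (u • u • x) * b (u • x) * b x = 1 := by
    by_cases h : u • x = x
    · rw [h, h, ← pow_three']
      simp only [b, dif_pos h, hw]
    · have h2 : u • u • x ≠ u • x := fun h' => h (smul_left_cancel _ h')
      have h3 : u • u • u • x ≠ u • u • x := fun h' => h2 (smul_left_cancel _ h')
      simp only [b, dif_neg h, dif_neg h2, dif_neg h3, one_mul]
  obtain ⟨c, hcs, hcu, hc⟩ := exists_cocycle ha hb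
  have hc1 (x : X) : c 1 x = 1 := by
    have := hc 1 1 x
    rwa [mul_one, one_smul, left_eq_mul] at this
  let t : Setoid (X × Y) :=
    { r := fun z z' => ∃ p : C2C3, p • z.1 = z'.1 ∧ c p z.1 * z.2 = z'.2
      iseqv :=
        { refl := fun z => ⟨1, one_smul _ _, by rw [hc1, one_mul]⟩
          symm := by
            rintro ⟨x, y⟩ ⟨x', y'⟩ ⟨p, rfl, rfl⟩
            refine ⟨p⁻¹, inv_smul_smul _ _, ?_⟩
            rw [← mul_assoc, ← hc, inv_mul_cancel, hc1, one_mul]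
          trans := by
            rintro ⟨x, y⟩ ⟨x', y'⟩ ⟨x'', y''⟩ ⟨p, rfl, rfl⟩ ⟨q, rfl, rfl⟩
            exact ⟨q * p, mul_smul _ _ _, by rw [hc, mul_assoc]⟩ } }
  have hts (x : X) (y : Y) : t (x, y) (s • x, a x * y) := ⟨s, rfl, by rw [hcs]⟩
  have htu (x : X) (y : Y) : t (x, y) (u • x, b x * y) := ⟨u, rfl, by rw [hcu]⟩
  have hX (x x' : X) (y : Y) : t (x, y) (x', y) := by
    have hle : (⊤ : Setoid X) ≤ t.comap fun x => (x, y) := by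
      rw [← hD]
      refine sup_le (Equiv.Perm.SameCycle.setoid_le fun x => ?_) (iSup₂_le fun e he => ?_)
      · change t (x, y) (u • x, y)
        by_cases h : u • x = x
        · rw [h]
        · have h1 := htu x y
          simp only [b, dif_neg h, one_mul] at h1
          exact h1
      · rintro x x' (rfl | ⟨hx, hx'⟩)
        · exact t.refl _
        · change t (x, y) (x', y)
          have hsame : (sPerm X).SameCycle x x' := Quotient.exact (hx.trans hx'.symm)
          rcases hsame.eq_or_of_sq_eq_one sPerm_sq with h | h
          · rw [h]
          · have h1 := hts x y
            have h2 : ¬ cyc x ∉ D := not_not.2 ((show cyc x = e from hx) ▸ he)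
            simp only [a, dif_neg h2, one_mul] at h1
            rw [h]
            exact h1
    exact hle (show (⊤ : Setoid X) x x' from trivial)
  have hY (g : Y) : ∀ x y, t (x, y) (x, g * y) := by
    have hg : g ∈ Subgroup.closure (Set.range v ∪ Set.range w) := hgen ▸ Subgroup.mem_top g
    induction hg using Subgroup.closure_induction with
    | mem g hg =>
      intro x y
      rcases hg with ⟨⟨e, he⟩, rfl⟩ | ⟨⟨x', hx'⟩, rfl⟩
      · obtain ⟨x', rfl⟩ := Quotient.exists_rep e
        have h1 := hts x' y
        have h2 : cyc x' ∉ D := he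
        simp only [a, dif_pos h2] at h1
        exact t.trans (hX x x' y) (t.trans h1 (hX _ _ _))
      · have h1 := htu x' y
        simp only [b, dif_pos hx'] at h1
        exact t.trans (hX x x' y) (t.trans h1 (hX _ _ _))
    | one => exact fun x y => by rw [one_mul]
    | mul g h _ _ hg hh =>
      exact fun x y => by rw [mul_assoc]; exact t.trans (hh x y) (hg x _)
    | inv g _ hg => exact fun x y => by simpa using t.symm (hg x (g⁻¹ * y))
  refine ⟨MonoidHom.mk' (fun p => c p x₀) fun p q => ?_, fun g => ?_⟩
  · have hq : (q : C2C3) • x₀ = x₀ := q.2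
    change c (p * q) x₀ = _
    rw [hc, hq]
  · obtain ⟨p, hp, hpg⟩ := hY g x₀ 1
    exact ⟨⟨p, hp⟩, by simpa using hpg⟩

theorem exists_surjective_hom_stabilizer_coprod [Finite X] [MulAction.IsPretransitive C2C3 X]
    (x₀ : X) : ∃ n m : ℕ, 1 < n ∧ 1 < m ∧ ∃ φ : MulAction.stabilizer C2C3 x₀ →*
      Coprod (Multiplicative (ZMod n)) (Multiplicative (ZMod m)), Function.Surjective φ := by
  classical
  have : Nonempty X := ⟨x₀⟩
  obtain ⟨D, hDcard, hD⟩ := Setoid.exists_finset_sup_eq_top (sPerm X).cycleSetoid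
    (Equiv.Perm.SameCycle.setoid (uPerm X)) <| setoid_eq_top
      (fun x => (le_sup_of_le_right (le_iSup (sPerm X).cycleSetoid (Quotient.mk _ x)) :
        _ ≤ Equiv.Perm.SameCycle.setoid (uPerm X) ⊔ _)
          (Or.inr ⟨rfl, Quotient.sound' (Equiv.Perm.SameCycle.symm ⟨1, rfl⟩)⟩))
      (fun x => (le_sup_left : Equiv.Perm.SameCycle.setoid (uPerm X) ≤ _) ⟨1, rfl⟩)
  have hlt : Nat.card (Quotient (Equiv.Perm.SameCycle.setoid (uPerm X))) <
      Nat.card (Quotient (Equiv.Perm.SameCycle.setoid (sPerm X))) + Nat.card {x : X // u • x = x} :=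
    Equiv.Perm.card_cycles_lt sPerm_sq uPerm_cube
  let ι := {e // e ∉ D} ⊕ {x : X // u • x = x}
  have hι : 1 < Nat.card ι := by
    cases nonempty_fintype (Quotient (Equiv.Perm.SameCycle.setoid (sPerm X)))
    have h1 : Nat.card {e // e ∉ D} =
        Nat.card (Quotient (Equiv.Perm.SameCycle.setoid (sPerm X))) - D.card := by
      rw [Nat.card_eq_fintype_card, Nat.card_eq_fintype_card, Fintype.card_subtype_compl,
        Fintype.card_coe]
    have h2 : Nat.card ι = _ := Nat.card_sum
    omega
  obtain ⟨z₁, z₂, hz⟩ := Finite.one_lt_card_iff_nontrivial.1 hι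
  let ord : ι → ℕ := Sum.elim (fun _ => 2) (fun _ => 3)
  have hord (z : ι) : 1 < ord z := by rcases z with z | z <;> simp [ord]
  let Y := Coprod (Multiplicative (ZMod (ord z₁))) (Multiplicative (ZMod (ord z₂)))
  let y : ι → Y := fun z => if z = z₁ then Coprod.inl (Multiplicative.ofAdd 1)
    else if z = z₂ then Coprod.inr (Multiplicative.ofAdd 1) else 1
  have hpow (n : ℕ) : (Multiplicative.ofAdd 1 : Multiplicative (ZMod n)) ^ n = 1 := by
    rw [← ofAdd_nsmul, nsmul_one, ZMod.natCast_self, ofAdd_zero]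
  have hy (z : ι) : y z ^ ord z = 1 := by
    by_cases h1 : z = z₁
    · subst h1
      simp only [y, if_pos, ← map_pow, hpow, map_one]
    · by_cases h2 : z = z₂
      · subst h2
        simp only [y, if_neg h1, if_pos, ← map_pow, hpow, map_one]
      · simp only [y, if_neg h1, if_neg h2, one_pow]
  have hgen : Subgroup.closure (Set.range y) = ⊤ := by
    rw [eq_top_iff, ← Coprod.range_inl_sup_range_inr, MonoidHom.range_eq_map,
      MonoidHom.range_eq_map, ← closure_ofAdd_one, ← closure_ofAdd_one, MonoidHom.map_closure,
      MonoidHom.map_closure, Set.image_singleton, Set.image_singleton]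
    refine sup_le (Subgroup.closure_mono ?_) (Subgroup.closure_mono ?_)
    · exact Set.singleton_subset_iff.2 ⟨z₁, if_pos rfl⟩
    · exact Set.singleton_subset_iff.2 ⟨z₂, (if_neg hz.symm).trans (if_pos rfl)⟩
  refine ⟨ord z₁, ord z₂, hord _, hord _, exists_surjective_hom_stabilizer x₀ hD (y ∘ Sum.inl)
    (y ∘ Sum.inr) (fun e => hy (Sum.inl e)) (fun x => hy (Sum.inr x)) ?_⟩
  rw [Set.range_comp, Set.range_comp, ← Set.image_union, Set.range_inl_union_range_inr,
    Set.image_univ, hgen]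

end C2C3

theorem finiteIndex_subgroup_SL2Z_isNontrivialAmalgam
    (H : Subgroup (Matrix.SpecialLinearGroup (Fin 2) ℤ)) (hH : H.FiniteIndex) :
    IsNontrivialAmalgam ↥H := by
  obtain ⟨π, hπ⟩ := C2C3.exists_surjective_hom_of_SL2Z
  have hfin : (H.map π).FiniteIndex :=
    ⟨fun h0 => hH.index_ne_zero (Nat.eq_zero_of_zero_dvd (h0 ▸ H.index_map_dvd hπ))⟩
  obtain ⟨n, m, hn, hm, φ, hφ⟩ := C2C3.exists_surjective_hom_stabilizer_coprod
    ((1 : C2C3) : C2C3 ⧸ H.map π)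
  have : Fact (1 < n) := ⟨hn⟩
  have : Fact (1 < m) := ⟨hm⟩
  have hstab (p : C2C3) :
      p ∈ MulAction.stabilizer C2C3 ((1 : C2C3) : C2C3 ⧸ H.map π) ↔ p ∈ H.map π := by
    rw [MulAction.stabilizer_quotient]
  let π' : H →* MulAction.stabilizer C2C3 ((1 : C2C3) : C2C3 ⧸ H.map π) :=
    (π.comp H.subtype).codRestrict _ fun x => (hstab _).2 ⟨x, x.2, rfl⟩
  have hπ' : Function.Surjective π' := by
    rintro ⟨p, hp⟩
    obtain ⟨x, hx, rfl⟩ := (hstab p).1 hp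
    exact ⟨⟨x, hx⟩, rfl⟩
  exact isNontrivialAmalgam_of_surjective_coprod (φ.comp π') (hφ.comp hπ')
end

section
/- Let G be a finite group that has the dihedral group D₈ of order 8 or the symmetric group S₃ as an epimorphic image. Then the unit group 𝒰(ℤG) of the integral group ring ℤG is virtually a nontrivial amalgamated product: there exists a finite-index subgroup H of 𝒰(ℤG) together with groups A, B, C, injective non-surjective group homomorphisms f : C → A and g : C → B, and a group isomorphism between H and the amalgamated free product A ∗_C B (the pushout of f and g). -/
universe u v w

open Monoid (PushoutI)

/-- A group mapping onto the free group on two generators splits as an amalgam of the preimages of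
the two cyclic free factors over the kernel. -/
theorem isNontrivialAmalgam_of_surjective {Γ : Type v} [Group Γ] (π : Γ →* FreeGroup Bool)
    (hπ : Function.Surjective π) : IsNontrivialAmalgam Γ := by
  let A : Bool → Subgroup Γ := fun b => (Subgroup.zpowers (FreeGroup.of b)).comap π
  have hle : ∀ b, π.ker ≤ A b := fun b x hx => by
    simp only [A, Subgroup.mem_comap, (MonoidHom.mem_ker).1 hx, one_mem]
  have hex : ∀ b, ∃ a : A b, π a = FreeGroup.of b := fun b => by
    obtain ⟨a, ha⟩ := hπ (FreeGroup.of b)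
    exact ⟨⟨a, by simp [A, ha]⟩, ha⟩
  choose a ha using hex
  have hns : ∀ b, ¬ Function.Surjective (Subgroup.inclusion (hle b)) := fun b hs => by
    obtain ⟨c, hc⟩ := hs (a b)
    have h : π (c : Γ) = FreeGroup.of b := by rw [← ha b, ← hc]; rfl
    exact FreeGroup.of_ne_one b (h.symm.trans c.2)
  let φ := boolHoms (Subgroup.inclusion (hle true)) (Subgroup.inclusion (hle false))
  let ι : (b : Bool) → A b →* PushoutI φ := fun b => match b with
    | true => PushoutI.of (φ := φ) true
    | false => PushoutI.of (φ := φ) false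
  have hι : ∀ b (c : π.ker), ι b (Subgroup.inclusion (hle b) c) = PushoutI.base φ c := fun b c => by
    cases b
    · exact PushoutI.of_apply_eq_base φ false c
    · exact PushoutI.of_apply_eq_base φ true c
  let sub : (b : Bool) → boolFam (A true) (A false) b →* Γ := fun b => match b with
    | true => (A true).subtype
    | false => (A false).subtype
  let Φ : PushoutI φ →* Γ := PushoutI.lift sub π.ker.subtype (by rintro (_ | _) <;> rfl)
  have hΦι : ∀ b (x : A b), Φ (ι b x) = x := fun b x => by
    cases b
    · exact PushoutI.lift_of (φ := φ) sub π.ker.subtype _ (i := false) x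
    · exact PushoutI.lift_of (φ := φ) sub π.ker.subtype _ (i := true) x
  have hΦbase : ∀ c, Φ (PushoutI.base φ c) = c := fun c => PushoutI.lift_base _ _ _ c
  have hind : ∀ {P : PushoutI φ → Prop}, (∀ b x, P (ι b x)) → (∀ c, P (PushoutI.base φ c)) →
      (∀ x y, P x → P y → P (x * y)) → ∀ x, P x := fun {P} h1 h2 h3 x => by
    refine PushoutI.induction_on x ?_ h2 h3
    rintro (_ | _) g
    · exact h1 false g
    · exact h1 true g
  have hnorm : (PushoutI.base φ).range.Normal := by
    refine ⟨fun n hn p => ?_⟩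
    revert n
    refine hind (P := fun p => ∀ n ∈ (PushoutI.base φ).range, p * n * p⁻¹ ∈ (PushoutI.base φ).range)
      ?_ ?_ ?_ p
    · rintro b x _ ⟨c, rfl⟩
      refine ⟨⟨x * c * x⁻¹, (MonoidHom.normal_ker π).conj_mem _ c.2 _⟩, ?_⟩
      rw [← hι b, ← hι b, ← map_inv, ← map_mul, ← map_mul]
      rfl
    · exact fun c n hn => mul_mem (mul_mem ⟨c, rfl⟩ hn) (inv_mem ⟨c, rfl⟩)
    · intro x y hx hy n hn
      have := hx _ (hy n hn)
      simpa only [mul_inv_rev, mul_assoc] using this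
  let s : FreeGroup Bool →* PushoutI φ := FreeGroup.lift fun b => ι b (a b)
  have hs : ∀ w, π (Φ (s w)) = w := fun w =>
    DFunLike.congr_fun (FreeGroup.ext_hom ((π.comp Φ).comp s) (MonoidHom.id _)
      fun b => by simp [s, hΦι, ha]) w
  have htop : ∀ p, p ∈ s.range ⊔ (PushoutI.base φ).range := by
    refine hind ?_ (fun c => Subgroup.mem_sup_right ⟨c, rfl⟩) (fun x y => mul_mem)
    intro b x
    obtain ⟨n, hn⟩ := Subgroup.mem_zpowers_iff.1 (Subgroup.mem_comap.1 x.2)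
    have hc : (a b : Γ) ^ (-n) * x ∈ π.ker := by
      rw [MonoidHom.mem_ker, map_mul, map_zpow, ha, ← hn]; simp
    have hx : x = a b ^ n * Subgroup.inclusion (hle b) ⟨_, hc⟩ := by
      ext; simp
    rw [hx, map_mul, hι, map_zpow]
    refine mul_mem (Subgroup.mem_sup_left ⟨FreeGroup.of b ^ n, ?_⟩)
      (Subgroup.mem_sup_right ⟨_, rfl⟩)
    simp [s]
  have hinj : Function.Injective Φ := by
    rw [injective_iff_map_eq_one]
    intro p hp
    obtain ⟨_, ⟨w, rfl⟩, _, ⟨c, rfl⟩, rfl⟩ := Subgroup.mem_sup_of_normal_right.1 (htop p)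
    rw [map_mul, hΦbase] at hp
    have hw : w = 1 := by
      have := congrArg π hp
      rwa [map_mul, hs, MonoidHom.mem_ker.1 c.2, mul_one, map_one] at this
    rw [hw, map_one, map_one, one_mul] at hp
    have hc : c = 1 := Subtype.ext hp
    rw [hw, hc, map_one, map_one, one_mul]
  have hsurj : Function.Surjective Φ := fun γ => by
    have hc : (Φ (s (π γ)))⁻¹ * γ ∈ π.ker := by
      rw [MonoidHom.mem_ker, map_mul, map_inv, hs, inv_mul_cancel]
    exact ⟨s (π γ) * PushoutI.base φ ⟨_, hc⟩, by rw [map_mul, hΦbase, mul_inv_cancel_left]⟩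
  exact ⟨A true, A false, π.ker, inferInstance, inferInstance, inferInstance,
    Subgroup.inclusion (hle true), Subgroup.inclusion (hle false),
    Subgroup.inclusion_injective _, Subgroup.inclusion_injective _, hns true, hns false,
    ⟨(MulEquiv.ofBijective Φ ⟨hinj, hsurj⟩).symm⟩⟩

/-- A free group on at most one generator is commutative. -/
theorem IsFreeGroup.commute_of_subsingleton_generators {K : Type*} [Group K] [IsFreeGroup K]
    [Subsingleton (IsFreeGroup.Generators K)] (x y : K) : Commute x y := by
  have hgen : ∀ (i : IsFreeGroup.Generators K) (z : K), Commute (IsFreeGroup.of i) z :=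
    fun i z => by
      have h : (MulAut.conj (IsFreeGroup.of i)).toMonoidHom = MonoidHom.id K :=
        IsFreeGroup.ext_hom fun j => by simp [Subsingleton.elim j i]
      exact mul_inv_eq_iff_eq_mul.1 (DFunLike.congr_fun h z)
  have h : (MulAut.conj x).toMonoidHom = MonoidHom.id K :=
    IsFreeGroup.ext_hom fun j => by simp [((hgen j x).symm).eq]
  exact mul_inv_eq_iff_eq_mul.1 (DFunLike.congr_fun h y)

/-- A noncommutative free group maps onto the free group on two generators. -/
theorem IsFreeGroup.exists_surjective_freeGroup_bool {K : Type*} [Group K] [IsFreeGroup K]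
    {x y : K} (hxy : ¬ Commute x y) : ∃ π : K →* FreeGroup Bool, Function.Surjective π := by
  classical
  have hnt : Nontrivial (IsFreeGroup.Generators K) := by
    by_contra h
    rw [not_nontrivial_iff_subsingleton] at h
    exact hxy (IsFreeGroup.commute_of_subsingleton_generators x y)
  obtain ⟨i, j, hij⟩ := hnt
  let π : K →* FreeGroup Bool := IsFreeGroup.lift fun k => FreeGroup.of (decide (k = i))
  let s : FreeGroup Bool →* K :=
    FreeGroup.lift fun b => IsFreeGroup.of (if b then i else j)
  have hs : π.comp s = MonoidHom.id _ := FreeGroup.ext_hom _ _ fun b => by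
    cases b <;> simp [π, s, hij.symm]
  exact ⟨π, fun w => ⟨s w, DFunLike.congr_fun hs w⟩⟩

/-- A subgroup of the image of a free group under an injective homomorphism is free. -/
theorem IsFreeGroup.of_le_range {F G : Type u} [Group F] [IsFreeGroup F] [Group G] {f : F →* G}
    (hf : Function.Injective f) {P : Subgroup G} (hP : P ≤ f.range) : IsFreeGroup P :=
  IsFreeGroup.ofMulEquiv (((P.comap f).equivMapOfInjective f hf).trans
    (MulEquiv.subgroupCongr (Subgroup.map_comap_eq_self hP)))

open Matrix MatrixGroups

/-- The transvections `!![1, 2; 0, 1]` and `!![1, 0; 2, 1]`, which freely generate Sanov's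
subgroup of `SL(2, ℤ)`. -/
def sanovGen : Bool → SL(2, ℤ)
  | true => ⟨!![1, 2; 0, 1], by simp⟩
  | false => ⟨!![1, 0; 2, 1], by simp⟩

theorem sanovGen_true_mul (M : SL(2, ℤ)) :
    (↑(sanovGen true * M) : Matrix (Fin 2) (Fin 2) ℤ) =
      !![M 0 0 + 2 * M 1 0, M 0 1 + 2 * M 1 1; M 1 0, M 1 1] := by
  rw [Matrix.SpecialLinearGroup.coe_mul, sanovGen, Matrix.SpecialLinearGroup.coe_mk]
  ext i j; fin_cases i <;> fin_cases j <;> simp [Matrix.mul_apply, Fin.sum_univ_two]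

theorem sanovGen_true_inv_mul (M : SL(2, ℤ)) :
    (↑((sanovGen true)⁻¹ * M) : Matrix (Fin 2) (Fin 2) ℤ) =
      !![M 0 0 - 2 * M 1 0, M 0 1 - 2 * M 1 1; M 1 0, M 1 1] := by
  rw [Matrix.SpecialLinearGroup.coe_mul, Matrix.SpecialLinearGroup.coe_inv, sanovGen,
    Matrix.SpecialLinearGroup.coe_mk, adjugate_fin_two_of]
  ext i j; fin_cases i <;> fin_cases j <;>
    simp [Matrix.mul_apply, Fin.sum_univ_two, sub_eq_add_neg]

theorem sanovGen_false_mul (M : SL(2, ℤ)) :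
    (↑(sanovGen false * M) : Matrix (Fin 2) (Fin 2) ℤ) =
      !![M 0 0, M 0 1; M 1 0 + 2 * M 0 0, M 1 1 + 2 * M 0 1] := by
  rw [Matrix.SpecialLinearGroup.coe_mul, sanovGen, Matrix.SpecialLinearGroup.coe_mk]
  ext i j; fin_cases i <;> fin_cases j <;> simp [Matrix.mul_apply, Fin.sum_univ_two, add_comm]

theorem sanovGen_false_inv_mul (M : SL(2, ℤ)) :
    (↑((sanovGen false)⁻¹ * M) : Matrix (Fin 2) (Fin 2) ℤ) =
      !![M 0 0, M 0 1; M 1 0 - 2 * M 0 0, M 1 1 - 2 * M 0 1] := by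
  rw [Matrix.SpecialLinearGroup.coe_mul, Matrix.SpecialLinearGroup.coe_inv, sanovGen,
    Matrix.SpecialLinearGroup.coe_mk, adjugate_fin_two_of]
  ext i j; fin_cases i <;> fin_cases j <;>
    simp [Matrix.mul_apply, Fin.sum_univ_two, sub_eq_add_neg, add_comm]

theorem lift_sanovGen_injective : Function.Injective (FreeGroup.lift sanovGen) := by
  let X : Bool → Set SL(2, ℤ) := fun b => match b with
    | true => {M | M 1 0 * M 1 0 ≤ M 0 0 * M 1 0}
    | false => {M | 0 ≤ M 0 0 * M 1 0 ∧ M 0 0 * M 1 0 < M 1 0 * M 1 0}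
  let Y : Bool → Set SL(2, ℤ) := fun b => match b with
    | true => {M | M 0 0 * M 1 0 < - (M 1 0 * M 1 0)}
    | false => {M | - (M 1 0 * M 1 0) ≤ M 0 0 * M 1 0 ∧ M 0 0 * M 1 0 < 0}
  have hcol : ∀ M : SL(2, ℤ), 0 < M 0 0 * M 0 0 + M 1 0 * M 1 0 := fun M => by
    have hdet := M.det_coe
    rw [Matrix.det_fin_two] at hdet
    by_contra! h
    have h0 : M 0 0 = 0 := by nlinarith [mul_self_nonneg (M 0 0), mul_self_nonneg (M 1 0)]
    have h1 : M 1 0 = 0 := by nlinarith [mul_self_nonneg (M 0 0), mul_self_nonneg (M 1 0)]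
    simp [h0, h1] at hdet
  refine FreeGroup.injective_lift_of_ping_pong sanovGen X Y ?_ ?_ ?_ ?_ ?_ ?_
  · rintro (_ | _)
    · exact ⟨ModularGroup.S, show (0 : ℤ) ≤ 0 * 1 ∧ (0 : ℤ) * 1 < 1 * 1 by decide⟩
    · exact ⟨1, by simp [X]⟩
  · rintro (_ | _) (_ | _) h <;>
      first
        | exact absurd rfl h
        | exact Set.disjoint_left.2 fun M h1 h2 => by
            simp only [X, Set.mem_ofPred_eq] at h1 h2
            omega
  · rintro (_ | _) (_ | _) h <;>
      first
        | exact absurd rfl h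
        | exact Set.disjoint_left.2 fun M h1 h2 => by
            simp only [Y, Set.mem_ofPred_eq] at h1 h2
            omega
  · rintro (_ | _) (_ | _) <;>
      exact Set.disjoint_left.2 fun M h1 h2 => by
        simp only [X, Y, Set.mem_ofPred_eq] at h1 h2
        have := mul_self_nonneg (M 1 0)
        omega
  · rintro (_ | _) _ ⟨M, hM, rfl⟩
    · simp only [X, Y, Set.mem_ofPred_eq, Set.mem_compl_iff, smul_eq_mul, sanovGen_false_mul]
        at hM ⊢
      change 0 ≤ M 0 0 * (M 1 0 + 2 * M 0 0) ∧
        M 0 0 * (M 1 0 + 2 * M 0 0) < (M 1 0 + 2 * M 0 0) * (M 1 0 + 2 * M 0 0)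
      have hne := hcol M
      generalize M 0 0 = x at *
      generalize M 1 0 = y at *
      have h : 0 ≤ x * y ∨ x * y < -(y * y) := by omega
      rcases h with h | h <;> constructor <;> nlinarith [sq_nonneg (x + y)]
    · simp only [X, Y, Set.mem_ofPred_eq, Set.mem_compl_iff, smul_eq_mul, sanovGen_true_mul] at hM ⊢
      change M 1 0 * M 1 0 ≤ (M 0 0 + 2 * M 1 0) * M 1 0
      nlinarith
  · rintro (_ | _) _ ⟨M, hM, rfl⟩
    · simp only [X, Y, Set.mem_ofPred_eq, Set.mem_compl_iff, smul_eq_mul, Pi.inv_apply,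
        sanovGen_false_inv_mul] at hM ⊢
      change -((M 1 0 - 2 * M 0 0) * (M 1 0 - 2 * M 0 0)) ≤ M 0 0 * (M 1 0 - 2 * M 0 0) ∧
        M 0 0 * (M 1 0 - 2 * M 0 0) < 0
      have hne := hcol M
      generalize M 0 0 = x at *
      generalize M 1 0 = y at *
      have h : x * y < 0 ∨ y * y ≤ x * y := by omega
      rcases h with h | h <;> constructor <;> nlinarith [sq_nonneg (x - y)]
    · simp only [X, Y, Set.mem_ofPred_eq, Set.mem_compl_iff, smul_eq_mul, Pi.inv_apply,
        sanovGen_true_inv_mul] at hM ⊢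
      change (M 0 0 - 2 * M 1 0) * M 1 0 < -(M 1 0 * M 1 0)
      nlinarith

theorem mem_range_lift_sanovGen (M : SL(2, ℤ)) (h00 : M 0 0 % 4 = 1) (h01 : M 0 1 % 2 = 0)
    (h10 : M 1 0 % 2 = 0) (h11 : M 1 1 % 4 = 1) : M ∈ (FreeGroup.lift sanovGen).range := by
  have hgen : ∀ b, sanovGen b ∈ (FreeGroup.lift sanovGen).range := fun b =>
    ⟨FreeGroup.of b, by simp⟩
  induction hn : (M 0 0).natAbs + (M 1 0).natAbs using Nat.strong_induction_on generalizing M with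
  | _ n ih =>
  have hdet := M.det_coe
  rw [Matrix.det_fin_two] at hdet
  by_cases hc : M 1 0 = 0
  · rw [hc, mul_zero, sub_zero] at hdet
    have h := Int.eq_one_or_neg_one_of_mul_eq_one hdet
    have h0 : M 0 0 = 1 := by omega
    rw [h0, one_mul] at hdet
    obtain ⟨k, hk⟩ : ∃ k, M 0 1 = 2 * k := ⟨M 0 1 / 2, by omega⟩
    have : M = sanovGen true ^ k := by
      have hT : sanovGen true = ModularGroup.T ^ (2 : ℤ) := by
        apply Subtype.ext
        rw [ModularGroup.coe_T_zpow]; rfl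
      rw [hT, ← _root_.zpow_mul]
      ext i j; fin_cases i <;> fin_cases j <;> simp [ModularGroup.coe_T_zpow, *]
    rw [this]
    exact zpow_mem (hgen true) k
  · have key : ∀ A ∈ (FreeGroup.lift sanovGen).range, (A * M) 0 0 % 4 = 1 → (A * M) 0 1 % 2 = 0 →
        (A * M) 1 0 % 2 = 0 → (A * M) 1 1 % 4 = 1 →
        ((A * M) 0 0).natAbs + ((A * M) 1 0).natAbs < n → M ∈ (FreeGroup.lift sanovGen).range :=
      fun A hA h1 h2 h3 h4 h5 => (Subgroup.mul_mem_cancel_left _ hA).1 (ih _ h5 _ h1 h2 h3 h4 rfl)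
    have hsign : (M 1 0).natAbs < (M 0 0).natAbs ∧
          ((M 0 0 + 2 * M 1 0).natAbs < (M 0 0).natAbs ∨
            (M 0 0 - 2 * M 1 0).natAbs < (M 0 0).natAbs) ∨
        ((M 1 0 + 2 * M 0 0).natAbs < (M 1 0).natAbs ∨
            (M 1 0 - 2 * M 0 0).natAbs < (M 1 0).natAbs) := by omega
    rcases hsign with ⟨-, h | h⟩ | h | h
    · refine key _ (hgen true) ?_ ?_ ?_ ?_ ?_ <;> rw [sanovGen_true_mul] <;> simp <;> omega
    · refine key _ (inv_mem (hgen true)) ?_ ?_ ?_ ?_ ?_ <;> rw [sanovGen_true_inv_mul] <;> simp <;>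
        omega
    · refine key _ (hgen false) ?_ ?_ ?_ ?_ ?_ <;> rw [sanovGen_false_mul] <;> simp <;> omega
    · refine key _ (inv_mem (hgen false)) ?_ ?_ ?_ ?_ ?_ <;> rw [sanovGen_false_inv_mul] <;>
        simp <;> omega

/-- The principal congruence subgroup of level four in `SL(2, ℤ)` is free, as are its subgroups. -/
theorem isFreeGroup_of_le_Gamma_four {P : Subgroup SL(2, ℤ)} (hP : P ≤ CongruenceSubgroup.Gamma 4) :
    IsFreeGroup P := by
  refine IsFreeGroup.of_le_range lift_sanovGen_injective (hP.trans fun M hM => ?_)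
  obtain ⟨h00, h01, h10, h11⟩ := CongruenceSubgroup.Gamma_mem.1 hM
  have e : ∀ a b : ℤ, (a : ZMod 4) = (b : ZMod 4) → a % 4 = b % 4 := fun a b h =>
    (ZMod.intCast_eq_intCast_iff a b 4).1 h
  have e00 := e _ 1 (by simpa using h00)
  have e01 := e _ 0 (by simpa using h01)
  have e10 := e _ 0 (by simpa using h10)
  have e11 := e _ 1 (by simpa using h11)
  exact mem_range_lift_sanovGen M (by omega) (by omega) (by omega) (by omega)

section GroupRing

variable {G : Type*} [Group G] [Fintype G] (ρ : G →* Matrix (Fin 2) (Fin 2) ℤ)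

/-- The group ring element with coefficients `g ↦ tr (B * ρ g⁻¹)`, a multiple of a preimage of `B`
under an irreducible representation `ρ`. -/
noncomputable def traceElement (B : Matrix (Fin 2) (Fin 2) ℤ) : MonoidAlgebra ℤ G :=
  ∑ g, MonoidAlgebra.single g (B * ρ g⁻¹).trace

theorem lift_traceElement (B : Matrix (Fin 2) (Fin 2) ℤ) :
    MonoidAlgebra.lift ℤ _ G ρ (traceElement ρ B) = ∑ g, (B * ρ g⁻¹).trace • ρ g := by
  simp [traceElement, MonoidAlgebra.lift_single]

theorem traceElement_zero : traceElement ρ 0 = 0 := by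
  simp [traceElement]

theorem traceElement_add (B C : Matrix (Fin 2) (Fin 2) ℤ) :
    traceElement ρ (B + C) = traceElement ρ B + traceElement ρ C := by
  simp [traceElement, add_mul, Finset.sum_add_distrib]

theorem traceElement_zsmul (n : ℤ) (B : Matrix (Fin 2) (Fin 2) ℤ) :
    traceElement ρ (n • B) = n • traceElement ρ B := by
  simp [traceElement, Finset.smul_sum, -zsmul_eq_mul]

theorem traceElement_mul (B : Matrix (Fin 2) (Fin 2) ℤ) (x : MonoidAlgebra ℤ G) :
    traceElement ρ B * x = traceElement ρ (B * MonoidAlgebra.lift ℤ _ G ρ x) := by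
  induction x using MonoidAlgebra.induction_on with
  | of h =>
    simp only [traceElement, Finset.sum_mul, MonoidAlgebra.of_apply, MonoidAlgebra.single_mul_single,
      mul_one, MonoidAlgebra.lift_single, one_smul]
    refine Fintype.sum_equiv (Equiv.mulRight h) _ _ fun g => ?_
    simp [mul_assoc, ← map_mul]
  | add x y hx hy => rw [mul_add, hx, hy, map_add, mul_add, traceElement_add]
  | smul r x hx => rw [mul_smul_comm, hx, map_smul, mul_smul_comm, traceElement_zsmul]

/-- A square-zero matrix yields a unipotent unit of the group ring. -/
noncomputable def unipotentUnit {k : ℤ}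
    (hk : ∀ B, ∑ g, (B * ρ g⁻¹).trace • ρ g = k • B) (E : Matrix (Fin 2) (Fin 2) ℤ)
    (hE : E * E = 0) : (MonoidAlgebra ℤ G)ˣ :=
  have h : traceElement ρ E * traceElement ρ E = 0 := by
    rw [traceElement_mul, lift_traceElement, hk, mul_smul_comm, hE, smul_zero, traceElement_zero]
  { val := 1 + (4 : ℤ) • traceElement ρ E
    inv := 1 - (4 : ℤ) • traceElement ρ E
    val_inv := by simp [mul_sub, add_mul, h, -zsmul_eq_mul]
    inv_val := by simp [mul_add, sub_mul, h, -zsmul_eq_mul] }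

theorem lift_unipotentUnit {k : ℤ}
    (hk : ∀ B, ∑ g, (B * ρ g⁻¹).trace • ρ g = k • B) (E : Matrix (Fin 2) (Fin 2) ℤ)
    (hE : E * E = 0) :
    MonoidAlgebra.lift ℤ _ G ρ (unipotentUnit ρ hk E hE : MonoidAlgebra ℤ G) =
      1 + (4 : ℤ) • k • E := by
  rw [unipotentUnit, map_add, map_one, map_zsmul, lift_traceElement, hk]

theorem exists_finiteIndex_isNontrivialAmalgam {k : ℤ} (hk0 : k ≠ 0)
    (hk : ∀ B, ∑ g, (B * ρ g⁻¹).trace • ρ g = k • B) :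
    ∃ H : Subgroup (MonoidAlgebra ℤ G)ˣ, H.FiniteIndex ∧ IsNontrivialAmalgam H := by
  let R : (MonoidAlgebra ℤ G)ˣ →* GL (Fin 2) ℤ :=
    Units.map (MonoidAlgebra.lift ℤ (Matrix (Fin 2) (Fin 2) ℤ) G ρ : _ →* _)
  let H : Subgroup (MonoidAlgebra ℤ G)ˣ :=
    ((GeneralLinearGroup.det.prod (GeneralLinearGroup.map (Int.castRingHom (ZMod 4)))).comp R).ker
  have hH : ∀ {u}, u ∈ H ↔ (R u).val.det = 1 ∧ (R u).val.map (Int.cast : ℤ → ZMod 4) = 1 := by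
    intro u
    simp only [H, MonoidHom.mem_ker, MonoidHom.comp_apply, MonoidHom.prod_apply, Prod.mk_eq_one]
    exact and_congr Units.ext_iff Units.ext_iff
  refine ⟨H, Subgroup.finiteIndex_ker _, ?_⟩
  let θ : H →* SL(2, ℤ) := MonoidHom.mk' (fun u => ⟨(R u).val, (hH.1 u.2).1⟩) fun u v =>
    Subtype.ext (congrArg Units.val (map_mul R u.1 v.1))
  have hθ : θ.range ≤ CongruenceSubgroup.Gamma 4 := by
    rintro _ ⟨u, rfl⟩
    have h := (hH.1 u.2).2
    have e := fun i j => congrFun (congrFun h i) j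
    exact CongruenceSubgroup.Gamma_mem.2 ⟨e 0 0, e 0 1, e 1 0, e 1 1⟩
  have hfree : IsFreeGroup θ.range := isFreeGroup_of_le_Gamma_four hθ
  have hunip : ∀ E (hE : E * E = 0), E.trace = 0 → E.det = 0 → ∃ u : H,
      (θ u : Matrix (Fin 2) (Fin 2) ℤ) = 1 + (4 : ℤ) • k • E := by
    intro E hE ht hd
    have hR := lift_unipotentUnit ρ hk E hE
    refine ⟨⟨unipotentUnit ρ hk E hE, hH.2 ⟨?_, ?_⟩⟩, hR⟩
    · change Matrix.det (MonoidAlgebra.lift ℤ _ G ρ _) = 1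
      rw [hR]
      rw [det_fin_two] at hd
      rw [trace_fin_two] at ht
      simp [det_fin_two, -zsmul_eq_mul]
      linear_combination (4 * k) ^ 2 * hd + 4 * k * ht
    · change Matrix.map (MonoidAlgebra.lift ℤ _ G ρ _) _ = 1
      rw [hR]
      have h4 : (4 : ZMod 4) = 0 := rfl
      ext i j
      fin_cases i <;> fin_cases j <;> simp [h4, -zsmul_eq_mul]
  obtain ⟨u, hu⟩ := hunip !![0, 1; 0, 0] (by decide) (by simp [trace_fin_two]) (by simp)
  obtain ⟨v, hv⟩ := hunip !![0, 0; 1, 0] (by decide) (by simp [trace_fin_two]) (by simp)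
  have huv : ¬ Commute (θ.rangeRestrict u) (θ.rangeRestrict v) := fun h => by
    have h1 : θ u * θ v = θ v * θ u := congrArg Subtype.val h
    have h2 := congrFun (congrFun (congrArg Subtype.val h1) 0) 0
    rw [Matrix.SpecialLinearGroup.coe_mul, Matrix.SpecialLinearGroup.coe_mul, hu, hv] at h2
    simp [Matrix.mul_apply, Fin.sum_univ_two, hk0, -zsmul_eq_mul] at h2
  obtain ⟨π, hπ⟩ := IsFreeGroup.exists_surjective_freeGroup_bool huv
  exact isNontrivialAmalgam_of_surjective (π.comp θ.rangeRestrict)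
    (hπ.comp θ.rangeRestrict_surjective)

/-- The trace identity follows from Schur orthogonality of the matrix coefficients. -/
theorem sum_trace_smul_of_orthogonality {ρ : G →* Matrix (Fin 2) (Fin 2) ℤ} {k : ℤ}
    (h : ∀ a b i j, ∑ g, ρ g⁻¹ b a * ρ g i j = if a = i ∧ b = j then k else 0)
    (B : Matrix (Fin 2) (Fin 2) ℤ) : ∑ g, (B * ρ g⁻¹).trace • ρ g = k • B := by
  ext i j
  simp only [Matrix.sum_apply, Matrix.smul_apply, trace_fin_two, Matrix.mul_apply,
    Fin.sum_univ_two, smul_eq_mul, add_mul, Finset.sum_add_distrib, mul_assoc, ← Finset.mul_sum, h]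
  fin_cases i <;> fin_cases j <;> simp [mul_comm]

/-- The trace identity for a representation inflates along epimorphisms. -/
theorem exists_finiteIndex_isNontrivialAmalgam_of_surjective {Q : Type*} [Group Q] [Fintype Q]
    {φ : G →* Q} (hφ : Function.Surjective φ) (ρ : Q →* Matrix (Fin 2) (Fin 2) ℤ) {k : ℤ}
    (hk0 : k ≠ 0) (hk : ∀ B, ∑ q, (B * ρ q⁻¹).trace • ρ q = k • B) :
    ∃ H : Subgroup (MonoidAlgebra ℤ G)ˣ, H.FiniteIndex ∧ IsNontrivialAmalgam H := by
  classical
  refine exists_finiteIndex_isNontrivialAmalgam (ρ.comp φ) (k := Fintype.card φ.ker * k)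
    (mul_ne_zero (Nat.cast_ne_zero.2 Fintype.card_ne_zero) hk0) fun B => ?_
  rw [mul_smul, ← hk, Finset.smul_sum, ← Finset.sum_fiberwise Finset.univ φ]
  refine Finset.sum_congr rfl fun q _ => ?_
  have hcard : (Finset.univ.filter fun g => φ g = q).card = Fintype.card φ.ker := by
    obtain ⟨g, rfl⟩ := hφ q
    rw [Fintype.card_subtype]
    refine Finset.card_bij' (fun h _ => g⁻¹ * h) (fun h _ => g * h) ?_ ?_ ?_ ?_ <;>
      simp +contextual [MonoidHom.mem_ker]
  rw [Finset.sum_congr rfl (g := fun _ => (B * ρ q⁻¹).trace • ρ q), Finset.sum_const, hcard,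
    natCast_zsmul]
  rintro g hg
  simp [← (Finset.mem_filter.1 hg).2]

end GroupRing

/-- The faithful two-dimensional representation of the dihedral group of order eight as the
symmetries of a square. -/
def squareRep : DihedralGroup 4 →* Matrix (Fin 2) (Fin 2) ℤ where
  toFun
    | .r i => !![0, -1; 1, 0] ^ i.val
    | .sr i => !![1, 0; 0, -1] * !![0, -1; 1, 0] ^ i.val
  map_one' := by decide
  map_mul' := by decide

/-- The action of the symmetric group on the permutation module `ℤ³` modulo its diagonal. -/
def triangleRep : Equiv.Perm (Fin 3) →* Matrix (Fin 2) (Fin 2) ℤ where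
  toFun σ := of fun i j => (if σ j.castSucc = i.castSucc then 1 else 0) -
    (if σ j.castSucc = 2 then 1 else 0)
  map_one' := by decide
  map_mul' := by decide

theorem squareRep_trace (B : Matrix (Fin 2) (Fin 2) ℤ) :
    ∑ q, (B * squareRep q⁻¹).trace • squareRep q = (4 : ℤ) • B :=
  sum_trace_smul_of_orthogonality (by decide) B

theorem triangleRep_trace (B : Matrix (Fin 2) (Fin 2) ℤ) :
    ∑ q, (B * triangleRep q⁻¹).trace • triangleRep q = (3 : ℤ) • B :=
  sum_trace_smul_of_orthogonality (by decide) B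

/-- If a finite group `G` has `D₈` or `S₃` as an epimorphic image, then `𝒰(ℤG)` is
virtually a nontrivial amalgamated product: it has a finite-index subgroup which is a
nontrivial free product with amalgamation. -/
theorem units_intGroupRing_virtually_amalgam (G : Type*) [Group G] [Finite G]
    (hG : (∃ φ : G →* DihedralGroup 4, Function.Surjective φ) ∨
          (∃ φ : G →* Equiv.Perm (Fin 3), Function.Surjective φ)) :
    ∃ H : Subgroup (MonoidAlgebra ℤ G)ˣ, H.FiniteIndex ∧ IsNontrivialAmalgam ↥H := by
  classical
  have := Fintype.ofFinite G
  rcases hG with ⟨φ, hφ⟩ | ⟨φ, hφ⟩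
  · exact exists_finiteIndex_isNontrivialAmalgam_of_surjective hφ squareRep (by decide)
      squareRep_trace
  · exact exists_finiteIndex_isNontrivialAmalgam_of_surjective hφ triangleRep (by decide)
      triangleRep_trace
end
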